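/- Let V ⊆ A^n be a smooth irreducible algebraic variety of dimension d. Then deg(TV) ≤ min{ deg(V)^{n−d+1}, deg(V)·((n−d)(deg(V)−1)+1)^d }. -/

import Mathlib

open MvPolynomial

/-- A subset of affine space is an algebraic set if it is the zero locus of an
ideal of polynomials. -/
def IsAlgebraicSet {K : Type} [Field K] {n : ℕ} (W : Set (Fin n → K)) : Prop :=
  ∃ I : Ideal (MvPolynomial (Fin n) K), W = zeroLocus K I

/-- An irreducible affine variety: an algebraic set whose vanishing ideal is prime. -/
def IsIrreducibleVariety {K : Type} [Field K] {n : ℕ} (W : Set (Fin n → K)) : Prop :=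
  IsAlgebraicSet W ∧ (vanishingIdeal K W).IsPrime

/-- The dimension of an affine algebraic set: the Krull dimension of its coordinate ring. -/
noncomputable def varDim {K : Type} [Field K] {n : ℕ} (W : Set (Fin n → K)) : ℕ :=
  ENat.toNat ((ringKrullDim (MvPolynomial (Fin n) K ⧸ vanishingIdeal K W)).unbotD 0)

/-- The (Zariski) tangent space of `W` at `p`:
all `y` with `∇f(p)·y = 0` for every `f ∈ I(W)`. -/
def tangentSpaceAt {K : Type} [Field K] {n : ℕ} (W : Set (Fin n → K)) (p : Fin n → K) :
    Set (Fin n → K) :=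
  {y | ∀ f ∈ vanishingIdeal K W, ∑ i, eval p (pderiv i f) * y i = 0}

/-- The dimension of the tangent space at a point. -/
noncomputable def tangentDimAt {K : Type} [Field K] {n : ℕ} (W : Set (Fin n → K))
    (p : Fin n → K) : ℕ :=
  Module.finrank K (Submodule.span K (tangentSpaceAt W p))

/-- A point of an (irreducible) variety is a smooth point when the tangent space has
the dimension of the variety. -/
def IsSmoothAt {K : Type} [Field K] {n : ℕ} (W : Set (Fin n → K)) (p : Fin n → K) : Prop :=
  tangentDimAt W p = varDim W

/-- A variety is smooth if it is smooth at each of its points. -/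
def IsSmoothVariety {K : Type} [Field K] {n : ℕ} (W : Set (Fin n → K)) : Prop :=
  ∀ p ∈ W, IsSmoothAt W p

/-- Projection `A^{2n} → A^n` to the first `n` coordinates. -/
def fstProj {K : Type} {n : ℕ} (z : Fin (n + n) → K) : Fin n → K :=
  fun i => z (Fin.castAdd n i)

/-- Projection `A^{2n} → A^n` to the last `n` coordinates. -/
def sndProj {K : Type} {n : ℕ} (z : Fin (n + n) → K) : Fin n → K :=
  fun i => z (Fin.natAdd n i)

/-- The tangent bundle `TW ⊆ A^{2n}`: pairs `(x, y)` with `x ∈ W` and `y ∈ T_x W`. -/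
def tangentBundle {K : Type} [Field K] {n : ℕ} (W : Set (Fin n → K)) :
    Set (Fin (n + n) → K) :=
  {z | fstProj z ∈ W ∧ sndProj z ∈ tangentSpaceAt W (fstProj z)}

/-- Zariski closure of a subset of affine space. -/
def zclosure {K : Type} [Field K] {n : ℕ} (W : Set (Fin n → K)) : Set (Fin n → K) :=
  zeroLocus K (vanishingIdeal K W)

/-- The tangential variety `Tan(W)`: the Zariski closure of `π₂(TW)`. -/
def tangentialVariety {K : Type} [Field K] {n : ℕ} (W : Set (Fin n → K)) :
    Set (Fin n → K) :=
  zclosure (sndProj '' tangentBundle W)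

/-- The geometric degree of an (irreducible) affine algebraic set: the maximal finite
number of points in an intersection with an affine-linear subspace of complementary
dimension. -/
noncomputable def geomDegree {K : Type} [Field K] {n : ℕ} (W : Set (Fin n → K)) : ℕ :=
  sSup {m | ∃ L : AffineSubspace K (Fin n → K),
    Module.finrank K L.direction = n - varDim W ∧
    (W ∩ (L : Set (Fin n → K))).Finite ∧ (W ∩ (L : Set (Fin n → K))).ncard = m}

/-- A linear variety: an affine-linear subspace of affine space. -/
def IsLinearVariety {K : Type} [Field K] {n : ℕ} (W : Set (Fin n → K)) : Prop :=
  ∃ L : AffineSubspace K (Fin n → K), W = (L : Set (Fin n → K))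

/-- A line: an affine-linear subspace of dimension 1. -/
def IsLine {K : Type} [Field K] {n : ℕ} (W : Set (Fin n → K)) : Prop :=
  ∃ L : AffineSubspace K (Fin n → K), W = (L : Set (Fin n → K)) ∧
    Module.finrank K L.direction = 1

open Classical in
/-- `ω(C)`: the number of points in the fiber of `π₂ : TC → Tan(C)` over a generic
point of `Tan(C)`; it is `0` when `C` is a line. -/
noncomputable def omegaCurve {K : Type} [Field K] {n : ℕ} (C : Set (Fin n → K)) : ℕ :=
  if IsLine C then 0
  else sInf {m | ∃ Z : Set (Fin n → K), IsAlgebraicSet Z ∧ ¬ tangentialVariety C ⊆ Z ∧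
    ∀ v ∈ tangentialVariety C \ Z,
      {z ∈ tangentBundle C | sndProj z = v}.ncard = m}

/-- A smooth irreducible algebraic curve. -/
def IsSmoothCurve {K : Type} [Field K] {n : ℕ} (C : Set (Fin n → K)) : Prop :=
  IsIrreducibleVariety C ∧ varDim C = 1 ∧ IsSmoothVariety C

namespace TB

/-- exponential growth beats polynomial growth -/
lemma le_of_growth (u : ℕ → ℕ) (D a b c : ℕ) (h0 : 1 ≤ u 0) (hu : ∀ N, u N ≤ (N + 1) ^ D)
    (h : ∀ N, a * u N ≤ b * u (N + c)) : a ≤ b := by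
  by_contra hab
  push Not at hab
  have hb : 0 < b := by
    rcases Nat.eq_zero_or_pos b with rfl | hb
    · have := h 0
      simp at this
      omega
    · exact hb
  have key : ∀ k, a ^ k ≤ b ^ k * u (k * c) := by
    intro k
    induction k with
    | zero => simpa using h0
    | succ k ih =>
      calc a ^ (k+1) = a * a ^ k := by ring
        _ ≤ a * (b ^ k * u (k * c)) := by gcongr
        _ = b ^ k * (a * u (k * c)) := by ring
        _ ≤ b ^ k * (b * u (k * c + c)) := Nat.mul_le_mul_left _ (h _)
        _ = b ^ (k+1) * u ((k+1) * c) := by ring_nf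
  have key2 : ∀ k, a ^ k ≤ b ^ k * ((k * c + 1) ^ D) := fun k =>
    (key k).trans (by gcongr; exact hu _)
  -- real version
  have hr : (1:ℝ) < (a:ℝ) / b := by
    rw [lt_div_iff₀ (by exact_mod_cast hb)]; simpa using (by exact_mod_cast hab : (b:ℝ) < a)
  have hlim := tendsto_pow_const_div_const_pow_of_one_lt D hr
  have hlim2 := hlim.const_mul (((c:ℝ) + 1) ^ D)
  rw [mul_zero] at hlim2
  obtain ⟨k, hk, hk1⟩ := ((hlim2.eventually (gt_mem_nhds (zero_lt_one))).and
    (Filter.eventually_ge_atTop 1)).exists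
  have h3 : ((a:ℝ)/b)^k ≤ ((k * c + 1 : ℕ):ℝ) ^ D := by
    rw [div_pow, div_le_iff₀ (by positivity), mul_comm]
    exact_mod_cast key2 k
  have h4 : ((k * c + 1 : ℕ):ℝ) ≤ ((c:ℝ) + 1) * k := by
    push_cast
    have : (1:ℝ) ≤ k := by exact_mod_cast hk1
    nlinarith
  have h5 : ((k * c + 1 : ℕ):ℝ) ^ D ≤ (((c:ℝ) + 1) * k) ^ D := by gcongr
  have hpos : 0 < ((a:ℝ)/b)^k := by positivity
  rw [← mul_div_assoc, div_lt_iff₀ hpos, ← mul_pow] at hk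
  linarith

/-- Exponents of total degree at most `N`. -/
def tdSet (κ : Type*) (N : ℕ) : Set (κ →₀ ℕ) := {β | (β.sum fun _ e => e) ≤ N}

/-- Exponents of weighted degree at most `N`. -/
def wSet {κ : Type*} (e : κ → ℕ) (N : ℕ) : Set (κ →₀ ℕ) := {β | (β.sum fun k m => e k * m) ≤ N}

lemma finite_tdSet (κ : Type*) [Finite κ] (N : ℕ) : (tdSet κ N).Finite := by
  classical
  have := Fintype.ofFinite κ
  have : Set.InjOn (fun (β : κ →₀ ℕ) => (β : κ → ℕ)) (tdSet κ N) := fun a _ b _ h => DFunLike.coe_injective h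
  refine Set.Finite.of_finite_image ?_ this
  refine Set.Finite.subset (Set.finite_Icc (0 : κ → ℕ) (fun _ : κ => N)) ?_
  rintro _ ⟨β, hβ, rfl⟩
  refine ⟨fun i => Nat.zero_le _, fun i => ?_⟩
  simp only [tdSet, Set.mem_ofPred_eq] at hβ
  rw [Finsupp.sum_fintype _ _ (by simp)] at hβ
  exact (Finset.single_le_sum (f := fun i => β i) (fun _ _ => Nat.zero_le _) (Finset.mem_univ i)).trans hβ

lemma wSet_subset {κ : Type*} [Fintype κ] (e : κ → ℕ) (he : ∀ k, 1 ≤ e k) (N : ℕ) :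
    wSet e N ⊆ tdSet κ N := by
  intro β hβ
  simp only [tdSet, wSet, Set.mem_ofPred_eq] at *
  rw [Finsupp.sum_fintype _ _ (by simp)] at *
  exact (Finset.sum_le_sum fun k _ => Nat.le_mul_of_pos_left _ (he k)).trans hβ

lemma card_tdSet_le (κ : Type*) [Fintype κ] (N : ℕ) :
    Nat.card (tdSet κ N) ≤ (N + 1) ^ (Fintype.card κ) := by
  classical
  have h : Nat.card (κ → Fin (N+1)) = (N+1)^(Fintype.card κ) := by simp
  rw [← h]
  refine Nat.card_le_card_of_injective (fun β : tdSet κ N => fun k => (⟨(β : κ →₀ ℕ) k, ?_⟩ : Fin (N+1))) ?_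
  · have hβ := β.2
    simp only [tdSet, Set.mem_ofPred_eq] at hβ
    rw [Finsupp.sum_fintype _ _ (by simp)] at hβ
    have := (Finset.single_le_sum (f := fun i => (β : κ →₀ ℕ) i) (fun _ _ => Nat.zero_le _) (Finset.mem_univ k)).trans hβ
    omega
  · intro a b hab
    ext k
    have := congrFun hab k
    simpa using this

lemma one_le_card_tdSet (κ : Type*) [Finite κ] (N : ℕ) : 1 ≤ Nat.card (tdSet κ N) := by
  have := (finite_tdSet κ N).to_subtype
  have : Nonempty (tdSet κ N) := ⟨0, by simp [tdSet]⟩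
  exact Nat.card_pos

/-- Rounding down gives the weighted count. -/
lemma card_tdSet_le_wSet {κ : Type*} [Fintype κ] (e : κ → ℕ) (he : ∀ k, 1 ≤ e k) (N : ℕ) :
    Nat.card (tdSet κ N) ≤ (∏ k, e k) * Nat.card (wSet e N) := by
  classical
  have h1 : ∏ k, e k = Nat.card (∀ k, Fin (e k)) := by simp
  rw [h1, ← Nat.card_prod]
  have := ((finite_tdSet κ N).subset (wSet_subset e he N)).to_subtype
  refine Nat.card_le_card_of_injective (fun β : tdSet κ N =>
    ((fun k => ⟨(β : κ →₀ ℕ) k % e k, Nat.mod_lt _ (he k)⟩ : ∀ k, Fin (e k)),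
     (⟨Finsupp.equivFunOnFinite.symm (fun k => (β : κ →₀ ℕ) k / e k), ?_⟩ : wSet e N))) ?_
  · have hβ := β.2
    simp only [tdSet, wSet, Set.mem_ofPred_eq] at *
    rw [Finsupp.sum_fintype _ _ (by simp)] at *
    refine le_trans (Finset.sum_le_sum fun k _ => ?_) hβ
    simpa using Nat.mul_div_le _ _
  · intro a b hab
    ext k
    have h1 := congrArg (fun z => (z.1 k : ℕ)) hab
    have h2 := congrArg (fun z => (z.2 : κ →₀ ℕ) k) hab
    simp only [Finsupp.equivFunOnFinite_symm_apply_apply] at h1 h2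
    rw [← Nat.div_add_mod ((a : κ →₀ ℕ) k) (e k), ← Nat.div_add_mod ((b : κ →₀ ℕ) k) (e k), h1, h2]

lemma finrank_restrictTotalDegree (K κ : Type*) [Field K] [Finite κ] (N : ℕ) :
    Module.finrank K (restrictTotalDegree κ K N) = Nat.card (tdSet κ N) :=
  Module.finrank_eq_nat_card_basis (basisRestrictSupport K (tdSet κ N))

end TB

namespace TB

/-- separating elements for a finite set of characters -/
lemma exists_sep {K A : Type*} [Field K] [CommRing A] [Algebra K A]
    (S : Finset (A →ₐ[K] K)) (χ : A →ₐ[K] K) :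
    ∃ g : A, χ g ≠ 0 ∧ ∀ ψ ∈ S, ψ ≠ χ → ψ g = 0 := by
  classical
  have h : ∀ ψ : A →ₐ[K] K, ∃ a : A, ψ ≠ χ → (χ a ≠ 0 ∧ ψ a = 0) := by
    intro ψ
    by_cases hψ : ψ = χ
    · exact ⟨0, fun h => absurd hψ h⟩
    · obtain ⟨a, ha⟩ : ∃ a, ψ a ≠ χ a := by
        by_contra hcon
        push Not at hcon
        exact hψ (AlgHom.ext hcon)
      refine ⟨a - algebraMap K A (ψ a), fun _ => ⟨?_, ?_⟩⟩
      · simpa [sub_eq_zero] using fun h => ha h.symm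
      · simp
  choose a ha using h
  refine ⟨∏ ψ ∈ S.erase χ, a ψ, ?_, ?_⟩
  · rw [map_prod, Finset.prod_ne_zero_iff]
    intro ψ hψ
    exact (ha ψ (Finset.ne_of_mem_erase hψ)).1
  · intro ψ hψ hne
    rw [map_prod]
    exact Finset.prod_eq_zero (Finset.mem_erase.2 ⟨hne, hψ⟩) (ha ψ hne).2

/-- A curve-like prime below an isolated zero. -/
lemma exists_prime_below {K A : Type*} [Field K] [CommRing A] [Algebra K A]
    [IsNoetherianRing A] {κ : Type*} [Fintype κ] (f : κ → A) (m : Ideal A) [m.IsPrime]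
    (hh : (Fintype.card κ : ℕ∞) ≤ m.height)
    (hm : m ∈ (Ideal.span (Set.range f)).minimalPrimes) (a : κ → K) (i0 : κ) (hi0 : a i0 ≠ 0) :
    ∃ (q : Ideal A) (t : A), q.IsPrime ∧ q ≤ m ∧ t ∉ q ∧ t ∈ m ∧
      ∀ i, f i - algebraMap K A (a i) * t ∈ q := by
  classical
  set t : A := algebraMap K A (a i0)⁻¹ * f i0 with ht
  have htt : algebraMap K A (a i0) * t = f i0 := by
    rw [ht, ← mul_assoc, ← map_mul, mul_inv_cancel₀ hi0, map_one, one_mul]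
  have hfm : ∀ i, f i ∈ m := fun i => hm.1.2 (Ideal.subset_span ⟨i, rfl⟩)
  have htm : t ∈ m := m.mul_mem_left _ (hfm i0)
  set s : Finset A := (Finset.univ.erase i0).image (fun i => f i - algebraMap K A (a i) * t) with hs
  have hsm : Ideal.span (s : Set A) ≤ m := by
    rw [Ideal.span_le]
    intro y hy
    simp only [hs, Finset.coe_image, Set.mem_image] at hy
    obtain ⟨i, -, rfl⟩ := hy
    exact m.sub_mem (hfm i) (m.mul_mem_left _ htm)
  obtain ⟨q, hq, hqm⟩ := Ideal.exists_minimalPrimes_le hsm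
  have hqp : q.IsPrime := hq.1.1
  have hqmem : ∀ i, f i - algebraMap K A (a i) * t ∈ q := by
    intro i
    by_cases hi : i = i0
    · subst hi; rw [htt, sub_self]; exact q.zero_mem
    · refine hq.1.2 (Ideal.subset_span ?_)
      simp only [hs, Finset.coe_image, Set.mem_image]
      exact ⟨i, by simp [hi], rfl⟩
  refine ⟨q, t, hqp, hqm, ?_, htm, hqmem⟩
  intro htq
  have hfq : Ideal.span (Set.range f) ≤ q := by
    rw [Ideal.span_le]
    rintro _ ⟨i, rfl⟩
    have := q.add_mem (hqmem i) (q.mul_mem_left (algebraMap K A (a i)) htq)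
    simpa using this
  have heq : m ≤ q := hm.2 ⟨hqp, hfq⟩ hqm
  have hqe : q = m := le_antisymm hqm heq
  have h1 := Ideal.height_le_card_of_mem_minimalPrimes_span_finset hq
  have h2 : s.card ≤ Fintype.card κ - 1 := by
    refine Finset.card_image_le.trans ?_
    simp [Finset.card_erase_of_mem]
  have h3 : 0 < Fintype.card κ := Fintype.card_pos_iff.2 ⟨i0⟩
  rw [hqe] at h1
  have h4 : (Fintype.card κ : ℕ∞) ≤ (s.card : ℕ∞) := hh.trans h1
  have h5 : Fintype.card κ ≤ s.card := by exact_mod_cast h4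
  omega

/-- Key independence statement. -/
lemma indep_of_isolated {K A : Type*} [Field K] [Infinite K] [CommRing A] [Algebra K A]
    [IsNoetherianRing A] {κ : Type*} [Fintype κ] (f : κ → A)
    (S : Finset (A →ₐ[K] K))
    (hh : ∀ χ ∈ S, (Fintype.card κ : ℕ∞) ≤ (RingHom.ker χ).height)
    (hm : ∀ χ ∈ S, RingHom.ker χ ∈ (Ideal.span (Set.range f)).minimalPrimes)
    (g : S → A) (hg : ∀ χ : S, χ.1 (g χ) ≠ 0) (hg0 : ∀ χ ψ : S, ψ ≠ χ → ψ.1 (g χ) = 0)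
    (P : S → MvPolynomial κ K) (hP : ∑ χ, aeval f (P χ) * g χ = 0) : P = 0 := by
  classical
  by_contra hne
  obtain ⟨χ0, hχ0⟩ : ∃ χ0, P χ0 ≠ 0 := by
    by_contra h
    push Not at h
    exact hne (funext h)
  have hfz : ∀ χ : S, ∀ i, χ.1 (f i) = 0 := fun χ i =>
    (RingHom.mem_ker).1 ((hm χ.1 χ.2).1.2 (Ideal.subset_span ⟨i, rfl⟩))
  obtain ⟨a, ha⟩ : ∃ a : κ → K, eval a (P χ0) ≠ 0 := by
    by_contra h
    push Not at h
    exact hχ0 (MvPolynomial.funext (fun x => by simpa using h x))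
  by_cases haz : a = 0
  · have h1 := congrArg χ0.1 hP
    rw [map_sum, map_zero, Finset.sum_eq_single χ0] at h1
    · rw [map_mul] at h1
      have h2 : χ0.1 (aeval f (P χ0)) = eval a (P χ0) := by
        rw [← AlgHom.comp_apply, MvPolynomial.comp_aeval, haz]
        have : (fun i => χ0.1 (f i)) = (0 : κ → K) := funext (hfz χ0)
        rw [this]; rfl
      rw [h2] at h1
      exact (mul_ne_zero ha (hg χ0)) h1
    · intro b _ hb
      rw [map_mul, hg0 b χ0 (Ne.symm hb), mul_zero]
    · simp
  · obtain ⟨i0, hi0⟩ : ∃ i0, a i0 ≠ 0 := by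
      by_contra h
      push Not at h
      exact haz (funext h)
    -- univariate restrictions
    let Q : S → Polynomial K := fun χ =>
      aeval (fun i => Polynomial.C (a i) * Polynomial.X) (P χ)
    have hQ1 : Q χ0 ≠ 0 := by
      intro h
      have h1 := congrArg (Polynomial.eval 1) h
      have h2 : Polynomial.eval 1 (Q χ0) = eval a (P χ0) := by
        have := (MvPolynomial.comp_aeval_apply (Polynomial.aeval (R := K) (1:K)) (f := fun i => Polynomial.C (a i) * Polynomial.X) (P χ0))
        rw [← Polynomial.coe_aeval_eq_eval]
        refine this.trans ?_
        simp [MvPolynomial.aeval_eq_eval]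
      rw [h2] at h1
      exact ha (by simpa using h1)
    -- minimal order
    have hex : ∃ k, ∃ χ, (Q χ).coeff k ≠ 0 := by
      obtain ⟨k, hk⟩ : ∃ k, (Q χ0).coeff k ≠ 0 := by
        by_contra h
        push Not at h
        exact hQ1 (Polynomial.ext h)
      exact ⟨k, χ0, hk⟩
    obtain ⟨χ1, hχ1⟩ := Nat.find_spec hex
    set k := Nat.find hex with hk
    have hdvd : ∀ χ, Polynomial.X ^ k ∣ Q χ := by
      intro χ
      rw [Polynomial.X_pow_dvd_iff]
      intro j hj
      have := Nat.find_min hex hj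
      push Not at this
      exact this χ
    choose Q' hQ' using hdvd
    have hχ1' : (Q' χ1).coeff 0 ≠ 0 := by
      have : (Q χ1).coeff k = (Q' χ1).coeff 0 := by
        rw [hQ' χ1]
        simpa using Polynomial.coeff_X_pow_mul (Q' χ1) k 0
      rwa [← this]
    have hprime : (RingHom.ker χ1.1).IsPrime := (hm χ1.1 χ1.2).1.1
    obtain ⟨q, t, hq, hqm, htq, htm, hft⟩ := exists_prime_below f (RingHom.ker χ1.1) (hh χ1.1 χ1.2)
      (hm χ1.1 χ1.2) a i0 hi0
    -- reduce mod q
    let π := Ideal.Quotient.mkₐ K q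
    have hπf : ∀ i, π (f i) = algebraMap K _ (a i) * π t := by
      intro i
      have := (Ideal.Quotient.eq (I := q)).2 (hft i)
      change π (f i) = π (algebraMap K A (a i) * t) at this
      rw [this, map_mul, AlgHom.commutes]
    have hπP : ∀ χ, π (aeval f (P χ)) = Polynomial.aeval (π t) (Q χ) := by
      intro χ
      rw [← AlgHom.comp_apply, MvPolynomial.comp_aeval, ← AlgHom.comp_apply,
        MvPolynomial.comp_aeval]
      congr 2
      funext i
      simp [hπf i]
    have h1 := congrArg π hP
    rw [map_sum, map_zero] at h1
    have h2 : π t ^ k * π (∑ χ, Polynomial.aeval t (Q' χ) * g χ) = 0 := by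
      rw [← h1, map_sum, Finset.mul_sum]
      refine Finset.sum_congr rfl fun χ _ => ?_
      rw [map_mul, map_mul, hπP χ, hQ' χ, map_mul, map_pow, Polynomial.aeval_X,
        Polynomial.aeval_algHom_apply]
      ring
    have hdom : IsDomain (A ⧸ q) := Ideal.Quotient.isDomain q
    have ht0 : π t ≠ 0 := fun h => htq (Ideal.Quotient.eq_zero_iff_mem.1 h)
    have h3 := (mul_eq_zero.1 h2).resolve_left (pow_ne_zero _ ht0)
    have h4 : (∑ χ, Polynomial.aeval t (Q' χ) * g χ) ∈ RingHom.ker χ1.1 :=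
      hqm (Ideal.Quotient.eq_zero_iff_mem.1 h3)
    rw [RingHom.mem_ker, map_sum, Finset.sum_eq_single χ1] at h4
    · rw [map_mul, ← Polynomial.aeval_algHom_apply] at h4
      have h5 : χ1.1 t = 0 := (RingHom.mem_ker).1 htm
      rw [h5, ← Polynomial.coeff_zero_eq_aeval_zero] at h4
      exact mul_ne_zero (by simpa using hχ1') (hg χ1) h4
    · intro b _ hb
      rw [map_mul, hg0 b χ1 (Ne.symm hb), mul_zero]
    · simp

/-- **Abstract Bezout inequality.** -/
theorem bezout {K A : Type*} [Field K] [Infinite K] [CommRing A] [IsDomain A] [Algebra K A]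
    [IsNoetherianRing A] {ι κ : Type*} [Fintype κ] (x : ι → A)
    (hx : Function.Surjective (aeval x : MvPolynomial ι K →ₐ[K] A))
    (l : κ → A) (δ : ℕ) (θ : Fin δ → A) (s : A) (hs : s ≠ 0) (c : ℕ)
    (hpack : ∀ α : ι →₀ ℕ, ∃ b : Fin δ → MvPolynomial κ K,
      (∀ j, (b j).totalDegree ≤ (α.sum fun _ e => e) + c) ∧
      s * aeval x (monomial α (1 : K)) = ∑ j, aeval l (b j) * θ j)
    (F : κ → MvPolynomial ι K) (e : κ → ℕ) (he : ∀ k, 1 ≤ e k)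
    (hF : ∀ k, (F k).totalDegree ≤ e k)
    (S : Finset (A →ₐ[K] K))
    (hh : ∀ χ ∈ S, (Fintype.card κ : ℕ∞) ≤ (RingHom.ker χ).height)
    (hm : ∀ χ ∈ S, RingHom.ker χ ∈
      (Ideal.span (Set.range fun k => aeval x (F k))).minimalPrimes) :
    S.card ≤ δ * ∏ k, e k := by
  classical
  -- separating elements
  have hsep : ∀ χ : S, ∃ G : MvPolynomial ι K, χ.1 (aeval x G) ≠ 0 ∧
      ∀ ψ : S, ψ ≠ χ → ψ.1 (aeval x G) = 0 := by
    intro χ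
    obtain ⟨g, hg, hg0⟩ := exists_sep S χ.1
    obtain ⟨G, rfl⟩ := hx g
    exact ⟨G, hg, fun ψ hψ => hg0 ψ.1 ψ.2 (fun h => hψ (Subtype.ext h))⟩
  choose G hG hG0 using hsep
  set c' : ℕ := Finset.univ.sup (fun χ : S => (G χ).totalDegree) with hc'
  -- the target map
  let Φ : ∀ M, (Fin δ → restrictTotalDegree κ K M) →ₗ[K] A := fun M =>
    ∑ j, (LinearMap.mulRight K (θ j)) ∘ₗ (aeval l : MvPolynomial κ K →ₐ[K] A).toLinearMap ∘ₗ
      (Submodule.subtype _) ∘ₗ LinearMap.proj j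
  have hΦ : ∀ M b, Φ M b = ∑ j, aeval l (b j : MvPolynomial κ K) * θ j := by
    intro M b
    simp [Φ, LinearMap.sum_apply]
  have hrange : ∀ M (p : MvPolynomial ι K), p.totalDegree ≤ M →
      s * aeval x p ∈ LinearMap.range (Φ (M + c)) := by
    intro M p hp
    have : s * aeval x p = ∑ α ∈ p.support, (p.coeff α) • (s * aeval x (monomial α (1:K))) := by
      conv_lhs => rw [p.as_sum, map_sum, Finset.mul_sum]
      refine Finset.sum_congr rfl fun α _ => ?_
      rw [← mul_smul_comm, ← map_smul, smul_monomial, smul_eq_mul, mul_one]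
    rw [this]
    refine Submodule.sum_mem _ fun α hα => Submodule.smul_mem _ _ ?_
    obtain ⟨b, hb, hsb⟩ := hpack α
    have hαM : (α.sum fun _ e => e) ≤ M := (le_totalDegree hα).trans hp
    refine ⟨fun j => ⟨b j, (mem_restrictTotalDegree _ _ _).2 ((hb j).trans (by omega))⟩, ?_⟩
    rw [hΦ, hsb]
  -- the independent family
  have hmain : ∀ N, S.card * Nat.card (wSet e N) ≤ δ * Nat.card (tdSet κ (N + (c' + c))) := by
    intro N
    have hfin : Finite (wSet e N) := ((finite_tdSet κ N).subset (wSet_subset e he N)).to_subtype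
    have := Fintype.ofFinite (wSet e N)
    let fam : S × wSet e N → A := fun p =>
      s * aeval x (aeval F (monomial (p.2 : κ →₀ ℕ) (1:K)) * G p.1)
    have hdeg : ∀ p : S × wSet e N,
        (aeval F (monomial (p.2 : κ →₀ ℕ) (1:K)) * G p.1).totalDegree ≤ N + c' := by
      intro p
      refine (totalDegree_mul _ _).trans (add_le_add ?_ (Finset.le_sup (f := fun χ : S => (G χ).totalDegree) (Finset.mem_univ p.1)))
      rw [aeval_monomial, map_one, one_mul, Finsupp.prod]
      refine (totalDegree_finsetProd _ _).trans ?_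
      have h1 : ((p.2 : κ →₀ ℕ).sum fun k m => e k * m) ≤ N := p.2.2
      refine le_trans ?_ h1
      rw [Finsupp.sum]
      refine Finset.sum_le_sum fun k _ => ?_
      refine (totalDegree_pow _ _).trans ?_
      rw [mul_comm]
      exact Nat.mul_le_mul_right _ (hF k)
    have hfamr : ∀ p, fam p ∈ LinearMap.range (Φ (N + (c' + c))) := by
      intro p
      have := hrange _ _ (hdeg p)
      rwa [add_assoc] at this
    have hli : LinearIndependent K fam := by
      rw [Fintype.linearIndependent_iff]
      intro w hw
      have h1 : s * (∑ χ : S, aeval (fun k => aeval x (F k))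
          (∑ β : wSet e N, monomial (β : κ →₀ ℕ) (w (χ, β))) * aeval x (G χ)) = 0 := by
        rw [← hw, Fintype.sum_prod_type, Finset.mul_sum]
        refine Finset.sum_congr rfl fun χ _ => ?_
        rw [map_sum, Finset.sum_mul, Finset.mul_sum]
        refine Finset.sum_congr rfl fun β _ => ?_
        simp only [fam]
        rw [map_mul, ← AlgHom.comp_apply (aeval x) (aeval F), MvPolynomial.comp_aeval,
          ← mul_smul_comm, ← smul_mul_assoc, ← map_smul, smul_monomial, smul_eq_mul, mul_one]
      have h2 := (mul_eq_zero.1 h1).resolve_left hs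
      have h3 := indep_of_isolated (fun k => aeval x (F k)) S hh hm (fun χ => aeval x (G χ))
        hG hG0 _ h2
      rintro ⟨χ, β⟩
      have h4 := congrArg (fun p => coeff (β : κ →₀ ℕ) (p χ)) h3
      simp only [coeff_sum, coeff_monomial, Pi.zero_apply, coeff_zero] at h4
      rw [Finset.sum_eq_single β] at h4
      · simpa using h4
      · intro b _ hb
        rw [if_neg (fun h => hb (Subtype.ext h))]
      · simp
    have h5 : LinearIndependent K (fun p => (⟨fam p, hfamr p⟩ : LinearMap.range (Φ (N + (c' + c))))) :=
      LinearIndependent.of_comp (Submodule.subtype _) hli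
    have h6 := h5.fintype_card_le_finrank
    rw [Fintype.card_prod, Fintype.card_coe, ← Nat.card_eq_fintype_card] at h6
    refine h6.trans ((LinearMap.finrank_range_le _).trans ?_)
    rw [Module.finrank_pi_fintype]
    simp [finrank_restrictTotalDegree]
  refine le_of_growth (fun N => Nat.card (tdSet κ N)) (Fintype.card κ) _ _ (c' + c)
    (one_le_card_tdSet κ 0) (card_tdSet_le κ) ?_
  intro N
  calc S.card * Nat.card (tdSet κ N) ≤ S.card * ((∏ k, e k) * Nat.card (wSet e N)) :=
        Nat.mul_le_mul_left _ (card_tdSet_le_wSet e he N)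
    _ = (∏ k, e k) * (S.card * Nat.card (wSet e N)) := by ring
    _ ≤ (∏ k, e k) * (δ * Nat.card (tdSet κ (N + (c' + c)))) := Nat.mul_le_mul_left _ (hmain N)
    _ = _ := by ring

end TB

namespace TB

lemma height_maximal_mvPolynomial (k : ℕ) {R : Type*} [CommRing R] [IsNoetherianRing R]
    [IsJacobsonRing R] (h : ℕ∞) (hR : ∀ M : Ideal R, M.IsMaximal → h ≤ M.height) :
    ∀ M : Ideal (MvPolynomial (Fin k) R), M.IsMaximal → h + (k : ℕ∞) ≤ M.height := by
  induction k with
  | zero =>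
    intro M hM
    let e := (isEmptyRingEquiv R (Fin 0)).symm
    rw [← RingEquiv.height_comap e M]
    simpa using hR _ (Ideal.comap_isMaximal_of_equiv e)
  | succ k ih =>
    intro M hM
    let e := (finSuccEquiv R k).symm.toRingEquiv
    rw [← RingEquiv.height_comap e M]
    have hM' : (M.comap e).IsMaximal := Ideal.comap_isMaximal_of_equiv e
    have h1 := Polynomial.isMaximal_comap_C_of_isJacobsonRing (M.comap e)
    have hlo : (M.comap e).LiesOver ((M.comap e).comap (Polynomial.C : MvPolynomial (Fin k) R →+* _)) := ⟨rfl⟩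
    rw [Polynomial.height_eq_height_add_one ((M.comap e).comap Polynomial.C) (M.comap e)]
    have := ih _ h1
    push_cast
    rw [← add_assoc]
    exact add_le_add_left this 1

lemma ringKrullDim_le_of_isIntegral {R S : Type*} [CommRing R] [CommRing S] [Algebra R S]
    [Algebra.IsIntegral R S] : ringKrullDim S ≤ ringKrullDim R := by
  refine Order.krullDim_le_of_strictMono
    (fun p : PrimeSpectrum S => PrimeSpectrum.comap (algebraMap R S) p) ?_
  intro p q hpq
  have : p.asIdeal < q.asIdeal := hpq
  have := Ideal.IsIntegral.comap_lt_comap (R := R) this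
  exact this

lemma height_maximal_of_integral {R S : Type*} [CommRing R] [CommRing S] [IsDomain S]
    [IsNoetherianRing R] [IsNoetherianRing S] [Algebra R S] [FaithfulSMul R S] [Algebra.IsIntegral R S]
    [IsIntegrallyClosed R] (h : ℕ∞) (hR : ∀ M : Ideal R, M.IsMaximal → h ≤ M.height)
    (M : Ideal S) (hM : M.IsMaximal) : h ≤ M.height := by
  have h1 : (M.under R).IsMaximal := Ideal.isMaximal_comap_of_isIntegral_of_isMaximal M
  rw [Ideal.height_eq_height_add_of_liesOver_of_hasGoingDown (M.under R) M]
  exact (hR _ h1).trans le_self_add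

lemma krullDim_eq_of_isIntegral_mv {K : Type*} [Field K] {S : Type*} [CommRing S] [IsDomain S]
    [IsNoetherianRing S] [Algebra K S] {k : ℕ} (y : Fin k → S)
    (hinj : Function.Injective (aeval y : MvPolynomial (Fin k) K →ₐ[K] S))
    (hIntg : (aeval y : MvPolynomial (Fin k) K →ₐ[K] S).IsIntegral) :
    ringKrullDim S = k ∧ ∀ M : Ideal S, M.IsMaximal → (k : ℕ∞) ≤ M.height := by
  let _ : Algebra (MvPolynomial (Fin k) K) S := (aeval y : MvPolynomial (Fin k) K →ₐ[K] S).toAlgebra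
  have : Algebra.IsIntegral (MvPolynomial (Fin k) K) S := ⟨hIntg⟩
  have : FaithfulSMul (MvPolynomial (Fin k) K) S :=
    (faithfulSMul_iff_algebraMap_injective _ _).2 hinj
  have hh : ∀ M : Ideal S, M.IsMaximal → (k : ℕ∞) ≤ M.height := by
    refine height_maximal_of_integral (R := MvPolynomial (Fin k) K) (k : ℕ∞) ?_
    simpa using height_maximal_mvPolynomial k (R := K) 0 (by simp)
  refine ⟨le_antisymm ?_ ?_, hh⟩
  · refine (ringKrullDim_le_of_isIntegral (R := MvPolynomial (Fin k) K)).trans ?_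
    rw [MvPolynomial.ringKrullDim_of_isNoetherianRing]
    simp
  · obtain ⟨M, hM⟩ := Ideal.exists_maximal S
    have h1 := hh M hM
    have h2 := Ideal.height_le_ringKrullDim_of_ne_top hM.ne_top
    exact le_trans (by exact_mod_cast h1) h2

lemma krullDim_lt_of_isIntegral_mv {K : Type*} [Field K] {S : Type*} [CommRing S] [Nontrivial S]
    [Algebra K S] {k : ℕ} (y : Fin k → S)
    (hinj : ¬ Function.Injective (aeval y : MvPolynomial (Fin k) K →ₐ[K] S))
    (hIntg : (aeval y : MvPolynomial (Fin k) K →ₐ[K] S).IsIntegral) :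
    ringKrullDim S + 1 ≤ k := by
  rw [injective_iff_map_eq_zero] at hinj
  push Not at hinj
  obtain ⟨f, hf, hf0⟩ := hinj
  let φ : (MvPolynomial (Fin k) K ⧸ Ideal.span {f}) →+* S :=
    Ideal.Quotient.lift (Ideal.span {f}) (aeval y : MvPolynomial (Fin k) K →ₐ[K] S).toRingHom (by
      intro a ha
      obtain ⟨b, rfl⟩ := Ideal.mem_span_singleton.1 ha
      show aeval y (f * b) = 0
      rw [map_mul, hf, zero_mul])
  let _ := φ.toAlgebra
  have hφ : φ.IsIntegral := RingHom.IsIntegral.tower_top (Ideal.Quotient.mk _) φ hIntg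
  have : Algebra.IsIntegral (MvPolynomial (Fin k) K ⧸ Ideal.span {f}) S := ⟨hφ⟩
  have h1 := ringKrullDim_le_of_isIntegral (R := MvPolynomial (Fin k) K ⧸ Ideal.span {f}) (S := S)
  have h2 := ringKrullDim_quotient_succ_le_of_nonZeroDivisor (mem_nonZeroDivisors_of_ne_zero hf0)
  rw [MvPolynomial.ringKrullDim_of_isNoetherianRing] at h2
  simp at h2
  exact (add_le_add_left h1 1).trans h2

end TB

namespace TB

lemma isIntegral_subalgebra_trans {K R : Type*} [Field K] [CommRing R] [Algebra K R]
    (B B' : Subalgebra K R) (h : ∀ b ∈ B, IsIntegral B' b) (x : R) (hx : IsIntegral B x) :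
    IsIntegral B' x := by
  obtain ⟨p, hp, hpx⟩ := hx
  let ι : B →+* integralClosure B' R :=
    B.toSubring.subtype.codRestrict (integralClosure B' R).toSubring (fun b => h b b.2)
  have : IsIntegral (integralClosure B' R) x := by
    refine ⟨p.map ι, hp.map ι, ?_⟩
    rw [Polynomial.eval₂_map]
    exact hpx
  exact isIntegral_trans x this

lemma coeff_prod_deg {R ι : Type*} [CommRing R] (s : Finset ι) (f : ι → Polynomial R) (d : ι → ℕ)
    (hf : ∀ i ∈ s, (f i).natDegree ≤ d i) :
    (∏ i ∈ s, f i).natDegree ≤ ∑ i ∈ s, d i ∧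
      (∏ i ∈ s, f i).coeff (∑ i ∈ s, d i) = ∏ i ∈ s, (f i).coeff (d i) := by
  classical
  induction s using Finset.induction_on with
  | empty => simp
  | insert a s ha ih =>
    obtain ⟨h1, h2⟩ := ih fun i hi => hf i (Finset.mem_insert_of_mem hi)
    have h3 := hf a (Finset.mem_insert_self a s)
    rw [Finset.prod_insert ha, Finset.prod_insert ha, Finset.sum_insert ha]
    exact ⟨Polynomial.natDegree_mul_le_of_le h3 h1,
      by rw [Polynomial.coeff_mul_add_eq_of_natDegree_le h3 h1, h2]⟩

lemma step_integral {K R σ : Type*} [Field K] [CommRing R] [Algebra K R] [Fintype σ]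
    (B : Subalgebra K R) (f : MvPolynomial σ K) (r : ℕ) (hr : f.totalDegree ≤ r) (Z : B)
    (Y : σ → B) (v : σ → K) (hv : eval v (homogeneousComponent r f) ≠ 0) (t : R)
    (h : ∑ α ∈ f.support, algebraMap K R (coeff α f) * (Z : R) ^ (r - α.degree) *
      ∏ i, ((Y i : R) + algebraMap K R (v i) * t) ^ (α i) = 0) : IsIntegral B t := by
  classical
  let c : K := eval v (homogeneousComponent r f)
  let fac : σ → Polynomial B := fun i => Polynomial.C (Y i) + Polynomial.C (algebraMap K B (v i)) * Polynomial.X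
  have hfac : ∀ i, (fac i).natDegree ≤ 1 := by
    intro i; simp only [fac]; compute_degree
  have hfac1 : ∀ i, (fac i).coeff 1 = algebraMap K B (v i) := by
    intro i; simp [fac, Polynomial.coeff_C]
  let P : Polynomial B := ∑ α ∈ f.support,
    Polynomial.C (algebraMap K B (coeff α f) * Z ^ (r - α.degree)) * ∏ i, fac i ^ (α i)
  have hprod : ∀ α : σ →₀ ℕ, (∏ i, fac i ^ (α i)).natDegree ≤ α.degree ∧
      (∏ i, fac i ^ (α i)).coeff α.degree = ∏ i, algebraMap K B (v i) ^ (α i) := by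
    intro α
    have := coeff_prod_deg Finset.univ (fun i => fac i ^ α i) (fun i => α i) (by
      intro i _
      refine Polynomial.natDegree_pow_le.trans ?_
      have := Nat.mul_le_mul_left (α i) (hfac i)
      omega)
    rw [Finsupp.degree_eq_sum]
    refine ⟨this.1, this.2.trans (Finset.prod_congr rfl fun i _ => ?_)⟩
    have := Polynomial.coeff_pow_of_natDegree_le (hfac i) (m := α i)
    rw [mul_one] at this
    rw [this, hfac1]
  have hdeg : ∀ α ∈ f.support, α.degree ≤ r := by
    intro α hα
    refine le_trans ?_ hr
    have := le_totalDegree hα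
    rwa [Finsupp.degree_eq_sum, ← Finsupp.sum_fintype α (fun _ e => e) (by simp)]
  have hPdeg : P.natDegree ≤ r := by
    refine Polynomial.natDegree_sum_le_of_forall_le _ _ fun α hα => ?_
    refine (Polynomial.natDegree_C_mul_le _ _).trans ((hprod α).1.trans (hdeg α hα))
  have hPc : P.coeff r = algebraMap K B c := by
    simp only [P, Polynomial.finsetSum_coeff, c, homogeneousComponent_apply, map_sum, Finset.sum_filter]
    refine Finset.sum_congr rfl fun α hα => ?_
    rw [Polynomial.coeff_C_mul]
    split_ifs with h1
    · have h2 := (hprod α).2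
      rw [h1] at h2
      rw [h2, h1, Nat.sub_self, pow_zero, mul_one, eval_monomial, map_mul]
      congr 1
      rw [Finsupp.prod_fintype _ _ (by simp), map_prod]
      simp
    · rw [Polynomial.coeff_eq_zero_of_natDegree_lt, mul_zero, map_zero, map_zero]
      have := hdeg α hα
      exact lt_of_le_of_lt (hprod α).1 (lt_of_le_of_ne this h1)
  have hPt : Polynomial.eval₂ (algebraMap B R) t P = 0 := by
    rw [← h]
    simp only [P, Polynomial.eval₂_finsetSum, Polynomial.eval₂_mul, Polynomial.eval₂_C, Polynomial.eval₂_finsetProd, Polynomial.eval₂_pow, fac, Polynomial.eval₂_add, Polynomial.eval₂_X]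
    rfl
  have hc : algebraMap K B c⁻¹ * algebraMap K B c = 1 := by
    rw [← map_mul, inv_mul_cancel₀ hv, map_one]
  refine ⟨Polynomial.C (algebraMap K B c⁻¹) * P, ?_, ?_⟩
  · refine Polynomial.monic_of_natDegree_le_of_coeff_eq_one r ((Polynomial.natDegree_C_mul_le _ _).trans hPdeg) ?_
    rw [Polynomial.coeff_C_mul, hPc, hc]
  · rw [Polynomial.eval₂_mul, hPt, mul_zero]

/-- the Rees type subalgebra generated by `X` and the `y_j X` -/
noncomputable def rees (K : Type*) {A : Type*} [Field K] [CommRing A] [Algebra K A] {k : Type*} (y : k → A) :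
    Subalgebra K (Polynomial A) :=
  Algebra.adjoin K (insert Polynomial.X (Set.range fun j => Polynomial.C (y j) * Polynomial.X))

lemma X_mem_rees (K : Type*) {A : Type*} [Field K] [CommRing A] [Algebra K A] {k : Type*} (y : k → A) :
    Polynomial.X ∈ rees K y := Algebra.subset_adjoin (Set.mem_insert _ _)

lemma y_mem_rees (K : Type*) {A : Type*} [Field K] [CommRing A] [Algebra K A] {k : Type*} (y : k → A) (j : k) :
    Polynomial.C (y j) * Polynomial.X ∈ rees K y :=
  Algebra.subset_adjoin (Set.mem_insert_of_mem _ ⟨j, rfl⟩)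

lemma rees_coeff {K : Type*} {A : Type*} [Field K] [CommRing A] [Algebra K A] {k : Type*} (y : k → A)
    (b : Polynomial A) (hb : b ∈ rees K y) (m : ℕ) :
    ∃ q : MvPolynomial k K, q.totalDegree ≤ m ∧ aeval y q = b.coeff m := by
  induction hb using Algebra.adjoin_induction generalizing m with
  | mem x hx =>
    rcases hx with rfl | ⟨j, rfl⟩
    · by_cases h : m = 1
      · exact ⟨1, by simp, by simp [h]⟩
      · exact ⟨0, by simp, by rw [Polynomial.coeff_X]; simp [Ne.symm h]⟩
    · by_cases h : m = 1
      · exact ⟨X j, by simp [h], by simp [h]⟩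
      · exact ⟨0, by simp, by simp [Polynomial.coeff_X, Ne.symm h]⟩
  | algebraMap c =>
    by_cases h : m = 0
    · exact ⟨C c, by simp, by simp [h, Polynomial.algebraMap_apply]⟩
    · exact ⟨0, by simp, by simp [h, Polynomial.algebraMap_apply, Polynomial.coeff_C]⟩
  | add a b _ _ iha ihb =>
    obtain ⟨p, hp, hp'⟩ := iha m
    obtain ⟨q, hq, hq'⟩ := ihb m
    exact ⟨p + q, (totalDegree_add _ _).trans (max_le hp hq), by simp [hp', hq']⟩
  | mul a b _ _ iha ihb =>
    choose p hp hp' using iha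
    choose q hq hq' using ihb
    refine ⟨∑ ij ∈ Finset.HasAntidiagonal.antidiagonal m, p ij.1 * q ij.2, ?_, ?_⟩
    · refine totalDegree_finsetSum_le fun ij hij => ?_
      refine (totalDegree_mul _ _).trans ?_
      have := Finset.HasAntidiagonal.mem_antidiagonal.1 hij
      have := hp ij.1
      have := hq ij.2
      omega
    · rw [Polynomial.coeff_mul, map_sum]
      simp [hp', hq']

/-- `θ X` is integral over the Rees algebra -/
def RInt (K : Type*) {A : Type*} [Field K] [CommRing A] [Algebra K A] {k : Type*} (y : k → A) (θ : A) : Prop :=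
  IsIntegral (rees K y) (Polynomial.C θ * Polynomial.X)

lemma RInt.relation {K : Type*} {A : Type*} [Field K] [CommRing A] [Algebra K A] {k : Type*} {y : k → A} {θ : A}
    (h : RInt K y θ) : ∃ (r : ℕ) (b : ℕ → MvPolynomial k K), (∀ j < r, (b j).totalDegree ≤ r - j) ∧
      θ ^ r + ∑ j ∈ Finset.range r, aeval y (b j) * θ ^ j = 0 := by
  obtain ⟨p, hp, hp0⟩ := h
  choose b hb hb' using fun j => rees_coeff y (p.coeff j : Polynomial A) (p.coeff j).2 (p.natDegree - j)
  refine ⟨p.natDegree, b, fun j _ => hb j, ?_⟩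
  rw [Polynomial.eval₂_eq_sum_range] at hp0
  have := congrArg (fun q : Polynomial A => q.coeff p.natDegree) hp0
  simp only [Polynomial.finsetSum_coeff, Polynomial.coeff_zero] at this
  rw [← this, Finset.sum_range_succ, add_comm]
  congr 1
  · refine Finset.sum_congr rfl fun j hj => ?_
    rw [mul_pow, ← Polynomial.C_pow, hb']
    rw [← mul_assoc, Polynomial.coeff_mul_X_pow', if_pos (Finset.mem_range.1 hj).le, Polynomial.coeff_mul_C]
    rfl
  · rw [hp.coeff_natDegree]
    rw [mul_pow, ← Polynomial.C_pow, map_one, one_mul, Polynomial.coeff_C_mul, Polynomial.coeff_X_pow_self, mul_one]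

lemma RInt.sum {K : Type*} {A : Type*} [Field K] [CommRing A] [Algebra K A] {k : Type*} {y : k → A} {ι : Type*}
    (s : Finset ι) (c : ι → K) (x : ι → A)
    (h : ∀ i, RInt K y (x i)) : RInt K y (∑ i ∈ s, c i • x i) := by
  have : Polynomial.C (∑ i ∈ s, c i • x i) * Polynomial.X =
      ∑ i ∈ s, algebraMap (rees K y) (Polynomial A) (algebraMap K _ (c i)) * (Polynomial.C (x i) * Polynomial.X) := by
    rw [map_sum, Finset.sum_mul]
    refine Finset.sum_congr rfl fun i _ => ?_
    rw [Algebra.smul_def, map_mul, mul_assoc]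
    rfl
  rw [RInt, this]
  exact IsIntegral.sum _ fun i _ => isIntegral_algebraMap.mul (h i)

lemma RInt.isIntegral {K : Type*} {A : Type*} [Field K] [CommRing A] [Algebra K A] {k : Type*} {y : k → A} {θ : A}
    (h : RInt K y θ) : (aeval y : MvPolynomial k K →ₐ[K] A).toRingHom.IsIntegralElem θ := by
  obtain ⟨r, b, -, h⟩ := h.relation
  refine ⟨Polynomial.X ^ r + ∑ j ∈ Finset.range r, Polynomial.C (b j) * Polynomial.X ^ j, ?_, ?_⟩
  · refine Polynomial.monic_X_pow_add ?_
    rw [Polynomial.degree_lt_iff_coeff_zero]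
    intro m hm
    rw [Polynomial.finsetSum_coeff]
    refine Finset.sum_eq_zero fun j hj => ?_
    rw [Polynomial.coeff_C_mul_X_pow, if_neg]
    have := Finset.mem_range.1 hj
    omega
  · simp only [Polynomial.eval₂_add, Polynomial.eval₂_X_pow, Polynomial.eval₂_finsetSum, Polynomial.eval₂_mul, Polynomial.eval₂_C]
    exact h
end TB

namespace TB

lemma exists_linform {K : Type*} [Field K] {m d : ℕ} (W : Submodule K (Fin m → K))
    (hW : Module.finrank K W ≤ d) (hd : d < m) :
    ∃ l : (Fin m → K) →ₗ[K] K, l ≠ 0 ∧ ∀ w ∈ W, l w = 0 := by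
  have : W ≠ ⊤ := by
    rintro rfl
    rw [finrank_top, Module.finrank_fin_fun] at hW
    omega
  obtain ⟨f, hf, h⟩ := W.exists_le_ker_of_lt_top (lt_top_iff_ne_top.2 this)
  exact ⟨f, hf, fun w hw => h hw⟩

lemma exists_vec {K : Type*} [Field K] [Infinite K] {m : ℕ} (f : MvPolynomial (Fin m) K) (hf : f ≠ 0)
    (l : (Fin m → K) →ₗ[K] K) (hl : l ≠ 0) : ∃ v, eval v f ≠ 0 ∧ l v ≠ 0 := by
  let q : MvPolynomial (Fin m) K := ∑ i, C (l (Pi.single i 1)) * X i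
  have hq : ∀ v, eval v q = l v := by
    intro v
    have : v = ∑ i, v i • (Pi.single i 1 : Fin m → K) := by
      simpa using (pi_eq_sum_univ' v)
    conv_rhs => rw [this]
    simp [q, mul_comm]
  have hq0 : q ≠ 0 := by
    rintro h
    apply hl
    ext v
    simp only [LinearMap.comp_apply]
    rw [← hq, h]; simp
  have : f * q ≠ 0 := mul_ne_zero hf hq0
  by_contra! hcon
  apply this
  apply MvPolynomial.funext
  intro v
  rw [map_mul, map_zero]
  by_cases h : eval v f = 0
  · rw [h, zero_mul]
  · rw [hq, hcon v h, mul_zero]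

/-- linear combinations -/
noncomputable def lin {K A : Type*} [Field K] [CommRing A] [Algebra K A] {k n : ℕ}
    (x : Fin n → A) (M : Matrix (Fin k) (Fin n) K) : Fin k → A := fun j => ∑ i, M j i • x i

lemma rint_all_isIntegral {K A : Type*} [Field K] [CommRing A] [Algebra K A] {k n : ℕ}
    (x : Fin n → A) (hx : Function.Surjective (aeval x : MvPolynomial (Fin n) K →ₐ[K] A))
    (y : Fin k → A) (h : ∀ i, RInt K y (x i)) :
    (aeval y : MvPolynomial (Fin k) K →ₐ[K] A).IsIntegral := by
  intro a
  obtain ⟨p, rfl⟩ := hx a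
  let _ : Algebra (MvPolynomial (Fin k) K) A := (aeval y : MvPolynomial (Fin k) K →ₐ[K] A).toAlgebra
  show IsIntegral (MvPolynomial (Fin k) K) (aeval x p)
  have hI : ∀ i, IsIntegral (MvPolynomial (Fin k) K) (x i) := fun i => (h i).isIntegral
  induction p using MvPolynomial.induction_on with
  | C c =>
    rw [aeval_C]
    have : algebraMap K A c = algebraMap (MvPolynomial (Fin k) K) A (C c) := by
      show _ = aeval y (C c)
      rw [aeval_C]
    rw [this]
    exact isIntegral_algebraMap
  | add p q hp hq => rw [map_add]; exact hp.add hq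
  | mul_X p i hp => rw [map_mul, aeval_X]; exact hp.mul (hI i)

lemma noether_step {K A : Type*} [Field K] [Infinite K] [CommRing A] [Algebra K A] {k d n : ℕ}
    (x : Fin n → A) (T : Submodule K (Fin n → K)) (hT : Module.finrank K T ≤ d) (hdk : d ≤ k)
    (M : Matrix (Fin (k + 1)) (Fin n) K)
    (hM : ∀ i, RInt K (lin x M) (x i)) (hMT : ∀ w ∈ T, M.mulVec w = 0 → w = 0)
    (hinj : ¬ Function.Injective (aeval (lin x M) : MvPolynomial (Fin (k+1)) K →ₐ[K] A)) :
    ∃ M' : Matrix (Fin k) (Fin n) K, (∀ i, RInt K (lin x M') (x i)) ∧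
      ∀ w ∈ T, M'.mulVec w = 0 → w = 0 := by
  rw [injective_iff_map_eq_zero] at hinj
  push Not at hinj
  obtain ⟨f, hf, hf0⟩ := hinj
  set r := f.totalDegree with hr
  have hfr : homogeneousComponent r f ≠ 0 := by
    obtain ⟨α, hα, hα'⟩ := f.support.exists_mem_eq_sup (support_nonempty.2 hf0) (fun s => s.sum fun _ e => e)
    intro h0
    have : coeff α (homogeneousComponent r f) = coeff α f := by
      rw [coeff_homogeneousComponent, if_pos]
      rw [hr, totalDegree, hα', Finsupp.degree_eq_sum, Finsupp.sum_fintype _ _ (by simp)]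
    rw [h0, coeff_zero] at this
    exact mem_support_iff.1 hα this.symm
  obtain ⟨l, hl, hlW⟩ := exists_linform (T.map M.mulVecLin) ((Submodule.finrank_map_le _ _).trans hT)
    (Nat.lt_succ_of_le hdk)
  obtain ⟨v0, hv0, hlv0⟩ := exists_vec _ hfr l hl
  have hv0' : v0 ≠ 0 := by rintro rfl; exact hlv0 (map_zero l)
  obtain ⟨i0, hi0⟩ : ∃ i, v0 i ≠ 0 := by
    by_contra! h
    exact hv0' (funext h)
  -- normalise
  obtain ⟨v, hv, hlv, hvi⟩ : ∃ v : Fin (k+1) → K, eval v (homogeneousComponent r f) ≠ 0 ∧ l v ≠ 0 ∧ v i0 = 1 := by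
    refine ⟨(v0 i0)⁻¹ • v0, ?_, ?_, ?_⟩
    · have h2 : eval ((v0 i0)⁻¹ • v0) (homogeneousComponent r f) = (v0 i0)⁻¹ ^ r * eval v0 (homogeneousComponent r f) := by
        simp only [homogeneousComponent_apply, map_sum, Finset.mul_sum, eval_monomial]
        refine Finset.sum_congr rfl fun α hα => ?_
        have h3 := (Finset.mem_filter.1 hα).2
        rw [Finsupp.prod_fintype _ _ (by simp), Finsupp.prod_fintype _ _ (by simp)]
        simp only [Pi.smul_apply, smul_eq_mul, mul_pow, Finset.prod_mul_distrib]
        rw [Finset.prod_pow_eq_pow_sum, ← Finsupp.degree_eq_sum, h3]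
        ring
      rw [h2]
      exact mul_ne_zero (pow_ne_zero _ (inv_ne_zero hi0)) hv0
    · rw [map_smul]; exact smul_ne_zero (inv_ne_zero hi0) hlv0
    · simp [hi0]
  let M' : Matrix (Fin k) (Fin n) K := fun j => M (i0.succAbove j) - v (i0.succAbove j) • M i0
  set y := lin x M with hy
  have hy' : ∀ j, lin x M' j = y (i0.succAbove j) - v (i0.succAbove j) • y i0 := by
    intro j
    simp only [lin, hy, M', Pi.sub_apply, Pi.smul_apply, sub_smul, Finset.sum_sub_distrib, Finset.smul_sum, smul_assoc]
  let B := rees K (lin x M')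
  let t : Polynomial A := Polynomial.C (y i0) * Polynomial.X
  have hYm : ∀ i, Polynomial.C (y i - v i • y i0) * Polynomial.X ∈ B := by
    intro i
    by_cases hi : i = i0
    · subst hi
      rw [hvi]
      simp
    · obtain ⟨j, rfl⟩ := Fin.exists_succAbove_eq hi
      rw [← hy']
      exact y_mem_rees K _ j
  let Y : Fin (k+1) → B := fun i => ⟨_, hYm i⟩
  have hYt : ∀ i, (Y i : Polynomial A) + algebraMap K (Polynomial A) (v i) * t = Polynomial.C (y i) * Polynomial.X := by
    intro i
    simp only [Y, t, map_sub, Algebra.smul_def, map_mul]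
    rw [Polynomial.algebraMap_apply]
    ring
  have ht : IsIntegral B t := by
    refine step_integral B f r le_rfl ⟨Polynomial.X, X_mem_rees K _⟩ Y v hv t ?_
    have : ∀ α ∈ f.support, algebraMap K (Polynomial A) (coeff α f) * (Polynomial.X) ^ (r - α.degree) *
      ∏ i, ((Y i : Polynomial A) + algebraMap K (Polynomial A) (v i) * t) ^ (α i) =
        Polynomial.C (algebraMap K A (coeff α f) * ∏ i, y i ^ α i) * Polynomial.X ^ r := by
      intro α hα
      simp only [hYt, mul_pow, Finset.prod_mul_distrib, Finset.prod_pow_eq_pow_sum]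
      rw [← Finsupp.degree_eq_sum]
      have h1 : α.degree ≤ r := by
        have := le_totalDegree hα
        rwa [Finsupp.degree_eq_sum, ← Finsupp.sum_fintype α (fun _ e => e) (by simp)]
      rw [map_mul, Polynomial.algebraMap_apply, map_prod]
      simp only [map_pow]
      conv_rhs => rw [← Nat.sub_add_cancel h1, pow_add]
      ring
    rw [Finset.sum_congr rfl this, ← Finset.sum_mul, ← map_sum]
    have h2 : ∑ α ∈ f.support, (algebraMap K A (coeff α f) * ∏ i, y i ^ α i) = 0 := by
      rw [← hf, aeval_def, eval₂_eq']
    rw [h2, map_zero, zero_mul]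
  refine ⟨M', fun i => ?_, fun w hw hMw => ?_⟩
  · refine isIntegral_subalgebra_trans (rees K y) B ?_ _ (hM i)
    intro b hb
    have hle : rees K y ≤ (integralClosure B (Polynomial A)).restrictScalars K := by
      refine Algebra.adjoin_le ?_
      rintro _ (rfl | ⟨i, rfl⟩)
      · exact isIntegral_algebraMap (R := B) (x := ⟨_, X_mem_rees K _⟩)
      · show IsIntegral B _
        simp only
        rw [← hYt i]
        refine (isIntegral_algebraMap (R := B) (x := Y i)).add (IsIntegral.mul ?_ ht)
        exact isIntegral_algebraMap (R := B) (x := algebraMap K B (v i))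
    exact hle hb
  · apply hMT w hw
    have h1 : M.mulVec w = (M i0 ⬝ᵥ w) • v := by
      ext i
      by_cases hi : i = i0
      · subst hi
        simp [hvi, Matrix.mulVec]
      · obtain ⟨j, rfl⟩ := Fin.exists_succAbove_eq hi
        have := congrFun hMw j
        simp only [M', Matrix.mulVec, Pi.zero_apply, sub_dotProduct, smul_dotProduct, smul_eq_mul] at this
        simp only [Matrix.mulVec, Pi.smul_apply, smul_eq_mul]
        linear_combination this
    have h2 : l (M.mulVec w) = 0 := hlW _ ⟨w, hw, rfl⟩
    rw [h1, map_smul, smul_eq_mul] at h2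
    have h3 : M i0 ⬝ᵥ w = 0 := (mul_eq_zero.1 h2).resolve_right hlv
    rw [h1, h3, zero_smul]

theorem exists_noether {K A : Type*} [Field K] [Infinite K] [CommRing A] [IsDomain A]
    [IsNoetherianRing A] [Algebra K A] {d n : ℕ}
    (x : Fin n → A) (hx : Function.Surjective (aeval x : MvPolynomial (Fin n) K →ₐ[K] A))
    (hd : ringKrullDim A = d) (T : Submodule K (Fin n → K)) (hT : Module.finrank K T ≤ d) :
    ∃ M : Matrix (Fin d) (Fin n) K, (∀ i, RInt K (lin x M) (x i)) ∧
      (∀ w ∈ T, M.mulVec w = 0 → w = 0) ∧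
      Function.Injective (aeval (lin x M) : MvPolynomial (Fin d) K →ₐ[K] A) := by
  have key : ∀ m, (∃ M : Matrix (Fin (d + m)) (Fin n) K, (∀ i, RInt K (lin x M) (x i)) ∧
      (∀ w ∈ T, M.mulVec w = 0 → w = 0)) → ∃ M : Matrix (Fin d) (Fin n) K, (∀ i, RInt K (lin x M) (x i)) ∧
      (∀ w ∈ T, M.mulVec w = 0 → w = 0) := by
    intro m
    induction m with
    | zero => exact fun h => h
    | succ m ih =>
      rintro ⟨M, h1, h2⟩
      apply ih
      refine noether_step x T hT (Nat.le_add_right d m) M h1 h2 ?_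
      intro hinj
      have := (krullDim_eq_of_isIntegral_mv (lin x M) hinj (rint_all_isIntegral x hx _ h1)).1
      rw [hd] at this
      have : d = d + (m + 1) := by exact_mod_cast this
      omega
  have hdn : d ≤ n := by
    have := ringKrullDim_le_of_surjective (aeval x : MvPolynomial (Fin n) K →ₐ[K] A).toRingHom hx
    rw [MvPolynomial.ringKrullDim_of_isNoetherianRing, hd] at this
    simp at this
    exact_mod_cast this
  obtain ⟨m, rfl⟩ := Nat.exists_eq_add_of_le hdn
  obtain ⟨M, h1, h2⟩ := key m ⟨1, by
    have : lin x (1 : Matrix (Fin (d+m)) (Fin (d+m)) K) = x := by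
      ext j; simp [lin, Matrix.one_apply]
    intro i
    rw [this]
    have := isIntegral_algebraMap (R := rees K x) (A := Polynomial A) (x := ⟨_, y_mem_rees K x i⟩)
    exact this, by intro w _ h; simpa using h⟩
  refine ⟨M, h1, h2, ?_⟩
  by_contra hinj
  have := krullDim_lt_of_isIntegral_mv (lin x M) hinj (rint_all_isIntegral x hx _ h1)
  rw [hd] at this
  have : d + 1 ≤ d := by exact_mod_cast this
  omega
end TB

namespace TB

open scoped IntermediateField in
theorem exists_primitive {R S : Type*} [CommRing R] [IsDomain R] [IsIntegrallyClosed R] [CharZero R]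
    [CommRing S] [IsDomain S] [Algebra R S] [FaithfulSMul R S] [Module.Finite R S] :
    ∃ (δ : ℕ) (θ : S), (minpoly R θ).natDegree = δ ∧
      (∀ t : S, (minpoly R t).natDegree ≤ δ) ∧
      (∃ r : R, r ≠ 0 ∧ ∃ u v : Polynomial R,
        u * minpoly R θ + v * (minpoly R θ).derivative = Polynomial.C r) ∧
      ∀ (ι : Type) [Fintype ι] (m : ι → S), ∃ s : R, s ≠ 0 ∧ ∃ a : ι → Fin δ → R, ∀ i,
        algebraMap R S s * m i = ∑ k, algebraMap R S (a i k) * θ ^ (k : ℕ) := by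
  let F := FractionRing R
  let L := FractionRing S
  have hIntg : Algebra.IsIntegral R S := inferInstance
  let _ : Algebra F L := FractionRing.liftAlgebra R L
  have : IsScalarTower R F L := FractionRing.isScalarTower_liftAlgebra R L
  have hinj : Function.Injective (algebraMap R S) := FaithfulSMul.algebraMap_injective R S
  have : CharZero F := charZero_of_injective_algebraMap (IsFractionRing.injective R F)
  have hmul : ∀ l : L, ∃ s : R, s ≠ 0 ∧ ∃ a : S, algebraMap S L a = algebraMap R L s * l := by
    intro l
    obtain ⟨a, b, hb, rfl⟩ := IsFractionRing.div_surjective (A := S) l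
    obtain ⟨s, hs, c, hc⟩ := (hIntg.isIntegral b).isAlgebraic.exists_nonzero_dvd hb
    refine ⟨s, hs, a * c, ?_⟩
    have hb0 : algebraMap S L b ≠ 0 := by
      simpa using nonZeroDivisors.ne_zero hb
    rw [IsScalarTower.algebraMap_apply R S L, hc]
    simp only [map_mul]
    rw [mul_div_assoc', eq_div_iff hb0]
    ring
  have : Module.Finite F L := by
    obtain ⟨g, hg⟩ := (inferInstance : Module.Finite R S).fg_top
    classical
    refine ⟨⟨g.image (algebraMap S L), ?_⟩⟩
    rw [eq_top_iff]
    intro l _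
    obtain ⟨s, hs, a, ha⟩ := hmul l
    have h1 : ∀ a : S, algebraMap S L a ∈ Submodule.span F ((g.image (algebraMap S L) : Finset L) : Set L) := by
      intro a
      have : a ∈ Submodule.span R (g : Set S) := by rw [hg]; trivial
      induction this using Submodule.span_induction with
      | mem x hx => exact Submodule.subset_span (Finset.mem_coe.2 (Finset.mem_image_of_mem _ hx))
      | zero => simp
      | add x y _ _ hx hy => rw [map_add]; exact add_mem hx hy
      | smul r x _ hx =>
        have : algebraMap S L (r • x) = algebraMap R F r • algebraMap S L x := by
          rw [Algebra.smul_def, Algebra.smul_def, map_mul, ← IsScalarTower.algebraMap_apply, ← IsScalarTower.algebraMap_apply]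
        rw [this]
        exact Submodule.smul_mem _ _ hx
    have hs' : algebraMap R F s ≠ 0 := by simpa using hs
    have h2 : l = (algebraMap R F s)⁻¹ • algebraMap S L a := by
      rw [ha, Algebra.smul_def, IsScalarTower.algebraMap_apply R F L, ← mul_assoc, ← map_mul, inv_mul_cancel₀ hs', map_one, one_mul]
    rw [h2]
    exact Submodule.smul_mem _ _ (h1 a)
  obtain ⟨θ0, hθ0⟩ := Field.exists_primitive_element F L
  obtain ⟨s0, hs0, θ, hθ⟩ := hmul θ0
  have hs0' : algebraMap R F s0 ≠ 0 := by simpa using hs0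
  have hθtop : F⟮algebraMap S L θ⟯ = ⊤ := by
    rw [eq_top_iff, ← hθ0]
    rw [IntermediateField.adjoin_simple_le_iff]
    have h1 : θ0 = algebraMap F L (algebraMap R F s0)⁻¹ * algebraMap S L θ := by
      rw [hθ, IsScalarTower.algebraMap_apply R F L, ← mul_assoc, ← map_mul, inv_mul_cancel₀ hs0', map_one, one_mul]
    rw [h1]
    exact mul_mem (IntermediateField.algebraMap_mem _ _) (IntermediateField.mem_adjoin_simple_self _ _)
  have hmin : ∀ t : S, minpoly F (algebraMap S L t) = (minpoly R t).map (algebraMap R F) := fun t =>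
    minpoly.isIntegrallyClosed_eq_field_fractions F L (hIntg.isIntegral t)
  have hdeg : ∀ t : S, (minpoly F (algebraMap S L t)).natDegree = (minpoly R t).natDegree := by
    intro t
    rw [hmin, (minpoly.monic (hIntg.isIntegral t)).natDegree_map]
  have hfr : (minpoly R θ).natDegree = Module.finrank F L := by
    rw [← hdeg, ← IntermediateField.adjoin.finrank (Algebra.IsIntegral.isIntegral _), hθtop,
      IntermediateField.finrank_top']
  refine ⟨(minpoly R θ).natDegree, θ, rfl, ?_, ?_, ?_⟩
  · intro t
    rw [hfr, ← hdeg]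
    exact minpoly.natDegree_le _
  · have hsep : (minpoly F (algebraMap S L θ)).Separable :=
      Algebra.IsSeparable.isSeparable F (algebraMap S L θ)
    obtain ⟨u, v, huv⟩ := hsep
    obtain ⟨b, hb2, hb⟩ := IsLocalization.integerNormalization_spec (nonZeroDivisors R) u
    obtain ⟨c, hc2, hc⟩ := IsLocalization.integerNormalization_spec (nonZeroDivisors R) v
    refine ⟨b * c, mul_ne_zero (nonZeroDivisors.ne_zero hb2) (nonZeroDivisors.ne_zero hc2),
      Polynomial.C (c : R) * IsLocalization.integerNormalization (nonZeroDivisors R) u,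
      Polynomial.C (b : R) * IsLocalization.integerNormalization (nonZeroDivisors R) v, ?_⟩
    apply Polynomial.map_injective (algebraMap R F) (IsFractionRing.injective R F)
    simp only [Polynomial.map_add, Polynomial.map_mul, hb, hc, Polynomial.map_C, ← Polynomial.derivative_map, ← hmin]
    simp only [Algebra.smul_def, Polynomial.algebraMap_apply, map_mul]
    linear_combination (Polynomial.C (algebraMap R F b) * Polynomial.C (algebraMap R F c)) * huv
  · intro ι _ m
    have hth : IsIntegral F (algebraMap S L θ) := Algebra.IsIntegral.isIntegral _
    have hrep : ∀ l : L, ∃ p : Polynomial F, p.natDegree < (minpoly R θ).natDegree ∧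
        Polynomial.aeval (algebraMap S L θ) p = l := by
      intro l
      have hl : l ∈ F⟮algebraMap S L θ⟯ := by rw [hθtop]; trivial
      rw [← IntermediateField.mem_toSubalgebra, IntermediateField.adjoin_simple_toSubalgebra_of_isAlgebraic hth.isAlgebraic,
        Algebra.adjoin_singleton_eq_range_aeval] at hl
      obtain ⟨p, rfl⟩ := hl
      refine ⟨p %ₘ minpoly F (algebraMap S L θ), ?_, ?_⟩
      · rw [← hdeg]
        exact Polynomial.natDegree_modByMonic_lt _ (minpoly.monic hth) (minpoly.ne_one F _)
      · exact Polynomial.aeval_modByMonic_eq_self_of_root (minpoly.aeval F _)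
    choose p hp hp' using fun i => hrep (algebraMap S L (m i))
    obtain ⟨s, hs⟩ := IsLocalization.exist_integer_multiples_of_finite (nonZeroDivisors R)
      (fun ik : ι × Fin (minpoly R θ).natDegree => (p ik.1).coeff ik.2)
    choose a ha using hs
    refine ⟨s, nonZeroDivisors.ne_zero s.2, fun i k => a (i, k), fun i => ?_⟩
    apply IsFractionRing.injective S L
    rw [map_mul, ← hp' i, Polynomial.aeval_eq_sum_range' (hp i), Finset.mul_sum, map_sum, Finset.sum_range]
    refine Finset.sum_congr rfl fun k _ => ?_
    rw [map_mul, map_pow, ← IsScalarTower.algebraMap_apply, ← IsScalarTower.algebraMap_apply,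
      IsScalarTower.algebraMap_apply R F L (a (i, k)), ha, Algebra.smul_def, Algebra.smul_def, map_mul,
      ← IsScalarTower.algebraMap_apply, mul_assoc]
end TB

namespace TB

lemma pow_reduce {K A k : Type*} [Field K] [CommRing A] [Algebra K A] {y : k → A} {θ : A} (r : ℕ)
    (b : ℕ → MvPolynomial k K) (hb : ∀ j < r, (b j).totalDegree ≤ r - j)
    (h : θ ^ r + ∑ j ∈ Finset.range r, aeval y (b j) * θ ^ j = 0) (e : ℕ) :
    ∃ c : ℕ → MvPolynomial k K, (∀ j, (c j).totalDegree ≤ e) ∧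
      θ ^ e = ∑ j ∈ Finset.range r, aeval y (c j) * θ ^ j := by
  induction e using Nat.strong_induction_on with
  | _ e ih =>
    by_cases he : e < r
    · refine ⟨fun j => if j = e then 1 else 0, fun j => by dsimp only; split_ifs <;> simp, ?_⟩
      rw [Finset.sum_eq_single e]
      · simp
      · intro j _ hj; simp [hj]
      · intro h; exact absurd (Finset.mem_range.2 he) h
    · push Not at he
      have : ∀ j : ℕ, ∃ c : ℕ → MvPolynomial k K, j < r → (∀ i, (c i).totalDegree ≤ e - r + j) ∧
          θ ^ (e - r + j) = ∑ i ∈ Finset.range r, aeval y (c i) * θ ^ i := by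
        intro j
        by_cases hj : j < r
        · obtain ⟨c, h1⟩ := ih (e - r + j) (by omega)
          exact ⟨c, fun _ => h1⟩
        · exact ⟨0, fun h => absurd h hj⟩
      choose c hc using this
      refine ⟨fun i => - ∑ j ∈ Finset.range r, b j * c j i, fun i => ?_, ?_⟩
      · rw [totalDegree_neg]
        refine totalDegree_finsetSum_le fun j hj => ?_
        have hj := Finset.mem_range.1 hj
        refine (totalDegree_mul _ _).trans ?_
        have h1 := hb j hj
        have h2 := (hc j hj).1 i
        omega
      · have h1 : θ ^ r = - ∑ j ∈ Finset.range r, aeval y (b j) * θ ^ j := by linear_combination h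
        have h2 : θ ^ e = θ ^ (e - r) * θ ^ r := by rw [← pow_add]; congr 1; omega
        rw [h2, h1]
        simp only [map_neg, map_sum, neg_mul, Finset.sum_neg_distrib, mul_neg, Finset.sum_mul, Finset.mul_sum]
        congr 1
        rw [Finset.sum_comm]
        refine Finset.sum_congr rfl fun j hj => ?_
        have hj := Finset.mem_range.1 hj
        have h3 := (hc j hj).2
        calc θ ^ (e - r) * (aeval y (b j) * θ ^ j) = aeval y (b j) * θ ^ (e - r + j) := by rw [pow_add]; ring
          _ = _ := by
            rw [h3, Finset.mul_sum]
            refine Finset.sum_congr rfl fun i _ => ?_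
            rw [map_mul, mul_assoc]

lemma monomials_pack {K A k : Type*} [Field K] [CommRing A] [Algebra K A] {y : k → A} {n : ℕ}
    (x : Fin n → A) (h : ∀ i, RInt K y (x i)) :
    ∃ (r : Fin n → ℕ) (m : ((i : Fin n) → Fin (r i)) → A), ∀ α : Fin n →₀ ℕ,
      ∃ b : ((i : Fin n) → Fin (r i)) → MvPolynomial k K,
        (∀ j, (b j).totalDegree ≤ (α.sum fun _ e => e)) ∧
        aeval x (monomial α (1:K)) = ∑ j, aeval y (b j) * m j := by
  choose r b hb hr using fun i => (h i).relation
  choose c hc hc' using fun i => pow_reduce (r i) (b i) (hb i) (hr i)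
  refine ⟨r, fun β => ∏ i, x i ^ (β i : ℕ), fun α => ⟨fun β => ∏ i, c i (α i) (β i), fun β => ?_, ?_⟩⟩
  · refine (totalDegree_finsetProd _ _).trans ?_
    rw [Finsupp.sum_fintype _ _ (by simp)]
    exact Finset.sum_le_sum fun i _ => hc i _ _
  · rw [aeval_monomial, map_one, one_mul, Finsupp.prod_fintype _ _ (by simp)]
    have : ∀ i, x i ^ α i = ∑ j : Fin (r i), aeval y (c i (α i) j) * x i ^ (j : ℕ) := by
      intro i
      rw [hc' i (α i), Finset.sum_range]
    simp only [this]
    rw [Finset.prod_univ_sum, Fintype.piFinset_univ]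
    refine Finset.sum_congr rfl fun β _ => ?_
    rw [Finset.prod_mul_distrib, map_prod]

lemma exists_char {K A : Type*} [Field K] [IsAlgClosed K] [CommRing A] [Algebra K A]
    [Algebra.FiniteType K A] (Q : Ideal A) (hQ : Q.IsMaximal) :
    ∃ χ : A →ₐ[K] K, RingHom.ker χ = Q := by
  let _ : Field (A ⧸ Q) := Ideal.Quotient.field Q
  have : Algebra.FiniteType K (A ⧸ Q) := inferInstance
  have : Module.Finite K (A ⧸ Q) := finite_of_finite_type_of_isJacobsonRing K (A ⧸ Q)
  have hb := IsAlgClosed.algebraMap_bijective_of_isIntegral (k := K) (K := A ⧸ Q)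
  let e : K ≃ₐ[K] (A ⧸ Q) := AlgEquiv.ofBijective (Algebra.ofId K (A ⧸ Q)) hb
  refine ⟨(e.symm : (A ⧸ Q) →ₐ[K] K).comp (Ideal.Quotient.mkₐ K Q), ?_⟩
  ext a
  rw [RingHom.mem_ker]
  simp [Ideal.Quotient.eq_zero_iff_mem]

theorem package {K A : Type*} [Field K] [IsAlgClosed K] [CharZero K] [CommRing A] [IsDomain A]
    [Algebra K A] {n d : ℕ}
    (x : Fin n → A) (hx : Function.Surjective (aeval x : MvPolynomial (Fin n) K →ₐ[K] A))
    (y : Fin d → A) (hy : ∀ i, RInt K y (x i))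
    (hinj : Function.Injective (aeval y : MvPolynomial (Fin d) K →ₐ[K] A)) :
    ∃ (δ : ℕ) (θ : Fin δ → A) (s : A) (c : ℕ), s ≠ 0 ∧
      (∀ α : Fin n →₀ ℕ, ∃ b : Fin δ → MvPolynomial (Fin d) K,
        (∀ j, (b j).totalDegree ≤ (α.sum fun _ e => e) + c) ∧
        s * aeval x (monomial α (1:K)) = ∑ j, aeval y (b j) * θ j) ∧
      (∀ t : A, ∃ p : Polynomial (MvPolynomial (Fin d) K), p.Monic ∧ p.natDegree ≤ δ ∧
        Polynomial.eval₂ (aeval y : MvPolynomial (Fin d) K →ₐ[K] A).toRingHom t p = 0 ∧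
        ∀ q, Polynomial.eval₂ (aeval y : MvPolynomial (Fin d) K →ₐ[K] A).toRingHom t q = 0 → p ∣ q) ∧
      ∃ (a : Fin d → K) (S : Finset (A →ₐ[K] K)), S.card = δ ∧ ∀ χ ∈ S, ∀ j, χ (y j) = a j := by
  classical
  have hI := rint_all_isIntegral x hx y hy
  have hft : Algebra.FiniteType K A := Algebra.FiniteType.of_surjective _ hx
  let _ : Algebra (MvPolynomial (Fin d) K) A := (aeval y : MvPolynomial (Fin d) K →ₐ[K] A).toAlgebra
  have hal : ∀ p : MvPolynomial (Fin d) K, algebraMap (MvPolynomial (Fin d) K) A p = aeval y p := fun p => rfl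
  have hIntg : Algebra.IsIntegral (MvPolynomial (Fin d) K) A := ⟨hI⟩
  have : FaithfulSMul (MvPolynomial (Fin d) K) A :=
    (faithfulSMul_iff_algebraMap_injective _ _).2 hinj
  have : IsScalarTower K (MvPolynomial (Fin d) K) A := IsScalarTower.of_algebraMap_eq (by
    intro c; rw [hal, MvPolynomial.algebraMap_eq, aeval_C])
  have hft' : Algebra.FiniteType (MvPolynomial (Fin d) K) A :=
    Algebra.FiniteType.of_restrictScalars_finiteType K _ A
  have : Module.Finite (MvPolynomial (Fin d) K) A := Algebra.IsIntegral.finite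
  obtain ⟨δ, θ, h1, h2, ⟨r, hr0, u, v, huv⟩, h4⟩ := exists_primitive (R := MvPolynomial (Fin d) K) (S := A)
  obtain ⟨rr, m, hm⟩ := monomials_pack x hy
  obtain ⟨s, hs, a, ha⟩ := h4 _ m
  refine ⟨δ, fun k => θ ^ (k : ℕ), aeval y s, Finset.univ.sup fun ik : _ × Fin δ => (a ik.1 ik.2).totalDegree,
    ?_, ?_, ?_, ?_⟩
  · intro h; exact hs (hinj (by rw [h, map_zero]))
  · intro α
    obtain ⟨b, hb, hb'⟩ := hm α
    refine ⟨fun k => ∑ j, b j * a j k, fun k => ?_, ?_⟩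
    · refine totalDegree_finsetSum_le fun j _ => ?_
      refine (totalDegree_mul _ _).trans (add_le_add (hb j) ?_)
      exact Finset.le_sup (f := fun ik : _ × Fin δ => (a ik.1 ik.2).totalDegree) (Finset.mem_univ (j, k))
    · rw [hb', Finset.mul_sum]
      have : ∀ j, aeval y s * (aeval y (b j) * m j) = ∑ k : Fin δ, aeval y (b j * a j k) * θ ^ (k : ℕ) := by
        intro j
        have := ha j
        simp only [hal] at this
        calc _ = aeval y (b j) * (aeval y s * m j) := by ring
          _ = _ := by
            rw [this, Finset.mul_sum]
            simp [mul_assoc]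
      simp only [this, map_sum, Finset.sum_mul]
      rw [Finset.sum_comm]
  · intro t
    refine ⟨minpoly (MvPolynomial (Fin d) K) t, minpoly.monic (hIntg.isIntegral t), h2 t, minpoly.aeval _ t, ?_⟩
    intro q hq
    exact minpoly.isIntegrallyClosed_dvd (hIntg.isIntegral t) hq
  · obtain ⟨a, ha⟩ : ∃ a, eval a r ≠ 0 := by
      by_contra! h
      exact hr0 (MvPolynomial.funext fun a => by rw [h, map_zero])
    set μ := minpoly (MvPolynomial (Fin d) K) θ with hμ
    have hμm : μ.Monic := minpoly.monic (hIntg.isIntegral θ)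
    let ν : Polynomial K := μ.map (eval a)
    have hνm : ν.Monic := hμm.map _
    have hνd : ν.natDegree = δ := by rw [hμm.natDegree_map, h1]
    have hsep : ν.Separable := by
      refine ⟨Polynomial.C (eval a r)⁻¹ * u.map (eval a), Polynomial.C (eval a r)⁻¹ * v.map (eval a), ?_⟩
      have := congrArg (Polynomial.map (eval a)) huv
      simp only [Polynomial.map_add, Polynomial.map_mul, Polynomial.map_C, ← Polynomial.derivative_map] at this
      have h5 : Polynomial.C (eval a r)⁻¹ * Polynomial.C (eval a r) = 1 := by
        rw [← Polynomial.C_mul, inv_mul_cancel₀ ha, Polynomial.C_1]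
      linear_combination Polynomial.C (eval a r)⁻¹ * this + h5
    have hcard : ν.roots.toFinset.card = δ := by
      rw [Multiset.toFinset_card_of_nodup (Polynomial.nodup_roots hsep), ← hνd]
      exact (IsAlgClosed.splits ν).natDegree_eq_card_roots.symm
    have hlift : ∀ ρ : K, ∃ χ : A →ₐ[K] K, ν.IsRoot ρ → (∀ j, χ (y j) = a j) ∧ χ θ = ρ := by
      intro ρ
      by_cases hρ : ν.IsRoot ρ
      swap
      · obtain ⟨Q, hQ⟩ := Ideal.exists_maximal A
        obtain ⟨χ, -⟩ := exists_char (K := K) Q hQ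
        exact ⟨χ, fun h => absurd h hρ⟩
      let ψ : Polynomial (MvPolynomial (Fin d) K) →+* A := (Polynomial.aeval θ : Polynomial (MvPolynomial (Fin d) K) →ₐ[MvPolynomial (Fin d) K] A).toRingHom
      let ev : Polynomial (MvPolynomial (Fin d) K) →+* K := Polynomial.eval₂RingHom (eval a) ρ
      have hevs : Function.Surjective ev := fun c => ⟨Polynomial.C (C c), by simp [ev]⟩
      let _ : Algebra (Polynomial (MvPolynomial (Fin d) K)) A := ψ.toAlgebra
      have hψ : ψ.IsIntegral := by
        refine RingHom.IsIntegral.tower_top (Polynomial.C : MvPolynomial (Fin d) K →+* Polynomial (MvPolynomial (Fin d) K)) ψ ?_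
        have : ψ.comp Polynomial.C = algebraMap (MvPolynomial (Fin d) K) A := by
          refine RingHom.ext fun p => ?_
          exact Polynomial.aeval_C _ _
        rw [this]
        exact hI
      have : Algebra.IsIntegral (Polynomial (MvPolynomial (Fin d) K)) A := ⟨hψ⟩
      have hPmax : (RingHom.ker ev).IsMaximal := RingHom.ker_isMaximal_of_surjective ev hevs
      obtain ⟨Q, hQ, hQP⟩ := Ideal.exists_ideal_over_maximal_of_isIntegral (S := A) (RingHom.ker ev) (by
        intro q hq
        have hq' : Polynomial.aeval θ q = 0 := hq
        obtain ⟨w, rfl⟩ := minpoly.isIntegrallyClosed_dvd (hIntg.isIntegral θ) hq'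
        rw [RingHom.mem_ker, map_mul]
        have : ev μ = 0 := by
          have := hρ
          rw [Polynomial.IsRoot, Polynomial.eval_map] at this
          exact this
        rw [← hμ, this, zero_mul])
      obtain ⟨χ, hχ⟩ := exists_char (K := K) Q hQ
      have key : ∀ q : Polynomial (MvPolynomial (Fin d) K), ev q = 0 → χ (ψ q) = 0 := by
        intro q hq
        have : q ∈ Ideal.comap (algebraMap (Polynomial (MvPolynomial (Fin d) K)) A) Q := by rw [hQP]; exact hq
        rw [← hχ] at this
        exact this
      refine ⟨χ, fun _ => ⟨fun j => ?_, ?_⟩⟩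
      · have := key (Polynomial.C (X j - C (a j))) (by simp [ev])
        have h6 : ψ (Polynomial.C (X j - C (a j))) = y j - algebraMap K A (a j) := by
          simp only [ψ, AlgHom.toRingHom_eq_coe, RingHom.coe_coe, Polynomial.aeval_C, hal, map_sub, aeval_X, aeval_C]
        rw [h6, map_sub, sub_eq_zero, AlgHom.commutes] at this
        exact this
      · have := key (Polynomial.X - Polynomial.C (C ρ)) (by simp [ev])
        have h6 : ψ (Polynomial.X - Polynomial.C (C ρ)) = θ - algebraMap K A ρ := by
          simp only [ψ, AlgHom.toRingHom_eq_coe, RingHom.coe_coe, Polynomial.aeval_C, hal, map_sub, Polynomial.aeval_X, aeval_C]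
        rw [h6, map_sub, sub_eq_zero, AlgHom.commutes] at this
        exact this
    choose χ hχ using hlift
    refine ⟨a, ν.roots.toFinset.image χ, ?_, ?_⟩
    · rw [Finset.card_image_of_injOn, hcard]
      intro ρ hρ ρ' hρ' h
      have e1 := (hχ ρ (Polynomial.isRoot_of_mem_roots (Multiset.mem_toFinset.1 hρ))).2
      have e2 := (hχ ρ' (Polynomial.isRoot_of_mem_roots (Multiset.mem_toFinset.1 hρ'))).2
      rw [← e1, h, e2]
    · intro ψ hψ
      obtain ⟨ρ, hρ, rfl⟩ := Finset.mem_image.1 hψ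
      exact (hχ ρ (Polynomial.isRoot_of_mem_roots (Multiset.mem_toFinset.1 hρ))).1

lemma fiber_finite {K A : Type*} [Field K] [CommRing A] [Algebra K A] {n : ℕ} {k : Type*}
    (x : Fin n → A) (hx : Function.Surjective (aeval x : MvPolynomial (Fin n) K →ₐ[K] A))
    (y : k → A) (hy : ∀ i, RInt K y (x i)) (a : k → K) :
    {χ : A →ₐ[K] K | ∀ j, χ (y j) = a j}.Finite := by
  have hext : Function.Injective fun (χ : A →ₐ[K] K) (i : Fin n) => χ (x i) := by
    intro χ χ' h
    have : χ.comp (aeval x : MvPolynomial (Fin n) K →ₐ[K] A) = χ'.comp (aeval x) := by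
      apply MvPolynomial.algHom_ext
      intro i
      simpa using congrFun h i
    ext b
    obtain ⟨p, rfl⟩ := hx b
    exact DFunLike.congr_fun this p
  choose p hp hp0 using fun i => (hy i).isIntegral
  refine Set.Finite.of_finite_image (f := fun (χ : A →ₐ[K] K) (i : Fin n) => χ (x i)) ?_ hext.injOn
  classical
  refine (Set.Finite.pi' (t := fun i => {ρ | ((p i).map (eval a)).IsRoot ρ}) fun i =>
    Polynomial.finite_setOf_isRoot ((hp i).map _).ne_zero).subset ?_
  rintro _ ⟨χ, hχ, rfl⟩ i
  have := congrArg χ (hp0 i)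
  rw [map_zero] at this
  rw [Set.mem_ofPred_eq, Polynomial.IsRoot, Polynomial.eval_map, ← this]
  have h2 : χ.toRingHom.comp (aeval y : MvPolynomial k K →ₐ[K] A).toRingHom = eval a := by
    apply MvPolynomial.ringHom_ext
    · intro c; simp
    · intro j; simpa using hχ j
  have h3 := Polynomial.hom_eval₂ (p i) (aeval y : MvPolynomial k K →ₐ[K] A).toRingHom χ.toRingHom (x i)
  rw [h2] at h3
  exact h3.symm
end TB

namespace TB

lemma iso_min {K A : Type*} [Field K] [IsAlgClosed K] [CommRing A] [Algebra K A]
    [Algebra.FiniteType K A] (J : Ideal A) (χ : A →ₐ[K] K) (hJ : J ≤ RingHom.ker χ) (s : A)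
    (hs : χ s ≠ 0) (S : Finset (A →ₐ[K] K))
    (hS : ∀ ψ : A →ₐ[K] K, J ≤ RingHom.ker ψ → ψ s ≠ 0 → ψ ∈ S) :
    RingHom.ker χ ∈ J.minimalPrimes := by
  refine ⟨⟨RingHom.ker_isPrime _, hJ⟩, ?_⟩
  rintro q ⟨hq, hJq⟩ hqχ g hg
  obtain ⟨h, hh, hh'⟩ := exists_sep S χ
  have : IsJacobsonRing A := isJacobsonRing_of_finiteType (A := K)
  have hqJ : q.jacobson = q := (isJacobsonRing_iff_prime_eq.1 this) q hq
  have key : g * (s * h) ∈ q := by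
    rw [← hqJ, Ideal.jacobson, Ideal.mem_sInf]
    rintro M ⟨hqM, hM⟩
    obtain ⟨ψ, rfl⟩ := exists_char (K := K) M hM
    rw [RingHom.mem_ker, map_mul, map_mul]
    by_cases h1 : ψ s = 0
    · rw [h1]; ring
    · by_cases h2 : ψ = χ
      · rw [h2, (RingHom.mem_ker).1 hg]; ring
      · rw [hh' ψ (hS ψ (hJq.trans hqM) h1) h2]; ring
  rcases hq.mem_or_mem key with h1 | h1
  · exact h1
  · have := hqχ h1
    rw [RingHom.mem_ker, map_mul] at this
    exact absurd this (mul_ne_zero hs hh)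

/-- coordinate ring -/
abbrev CR {K : Type} [Field K] {n : ℕ} (V : Set (Fin n → K)) : Type :=
  MvPolynomial (Fin n) K ⧸ vanishingIdeal K V

/-- coordinate functions -/
noncomputable def cx {K : Type} [Field K] {n : ℕ} (V : Set (Fin n → K)) (i : Fin n) : CR V :=
  Ideal.Quotient.mkₐ K (vanishingIdeal K V) (X i)

lemma aeval_cx {K : Type} [Field K] {n : ℕ} (V : Set (Fin n → K)) :
    (aeval (cx V) : MvPolynomial (Fin n) K →ₐ[K] CR V) = Ideal.Quotient.mkₐ K (vanishingIdeal K V) := by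
  ext i; simp [cx]

lemma cx_surj {K : Type} [Field K] {n : ℕ} (V : Set (Fin n → K)) :
    Function.Surjective (aeval (cx V) : MvPolynomial (Fin n) K →ₐ[K] CR V) := by
  rw [aeval_cx]; exact Ideal.Quotient.mkₐ_surjective _ _

/-- the character given by a point -/
noncomputable def ch {K : Type} [Field K] {n : ℕ} {V : Set (Fin n → K)} {p : Fin n → K} (hp : p ∈ V) :
    CR V →ₐ[K] K :=
  Ideal.Quotient.liftₐ (vanishingIdeal K V) (aeval p) (fun _ hf => hf p hp)

lemma ch_aeval {K : Type} [Field K] {n : ℕ} {V : Set (Fin n → K)} {p : Fin n → K} (hp : p ∈ V)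
    (f : MvPolynomial (Fin n) K) : ch hp (aeval (cx V) f) = eval p f := by
  rw [aeval_cx]; rfl

lemma ch_cx {K : Type} [Field K] {n : ℕ} {V : Set (Fin n → K)} {p : Fin n → K} (hp : p ∈ V)
    (i : Fin n) : ch hp (cx V i) = p i := by
  have := ch_aeval hp (X i)
  simpa using this

lemma char_eval {K A : Type*} [Field K] [CommRing A] [Algebra K A] {σ : Type*} (ψ : A →ₐ[K] K) (x : σ → A)
    (f : MvPolynomial σ K) : ψ (aeval x f) = eval (fun i => ψ (x i)) f := by
  rw [← AlgHom.comp_apply, comp_aeval]; rfl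

lemma char_mem {K : Type} [Field K] {n : ℕ} {V : Set (Fin n → K)} (hV : IsAlgebraicSet V)
    (ψ : CR V →ₐ[K] K) : (fun i => ψ (cx V i)) ∈ V := by
  obtain ⟨I, rfl⟩ := hV
  intro f hf
  have : (aeval (fun i => ψ (cx (zeroLocus K I) i)) : MvPolynomial (Fin n) K →ₐ[K] K) f =
    ψ (aeval (cx (zeroLocus K I)) f) := (char_eval _ _ _).symm
  rw [this, aeval_cx]
  have : Ideal.Quotient.mkₐ K (vanishingIdeal K (zeroLocus K I)) f = 0 := by
    rw [Ideal.Quotient.mkₐ_eq_mk, Ideal.Quotient.eq_zero_iff_mem]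
    intro x hx
    exact hx f hf
  rw [this, map_zero]

lemma char_ext {K A : Type*} [Field K] [CommRing A] [Algebra K A] {σ : Type*} (x : σ → A)
    (hx : Function.Surjective (aeval x : MvPolynomial σ K →ₐ[K] A)) {ψ χ : A →ₐ[K] K}
    (h : ∀ i, ψ (x i) = χ (x i)) : ψ = χ := by
  ext a
  obtain ⟨f, rfl⟩ := hx a
  rw [char_eval, char_eval]
  congr 2
  ext i; exact h i

lemma eq_ch {K : Type} [Field K] {n : ℕ} {V : Set (Fin n → K)} (hV : IsAlgebraicSet V)
    (ψ : CR V →ₐ[K] K) : ψ = ch (char_mem hV ψ) :=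
  char_ext (cx V) (cx_surj V) fun i => (ch_cx (char_mem hV ψ) i).symm

lemma krullDim_CR {K : Type} [Field K] {n d : ℕ} {V : Set (Fin n → K)} (h1 : IsIrreducibleVariety V)
    (hd : varDim V = d) : ringKrullDim (CR V) = d := by
  have := h1.2
  have hle : ringKrullDim (CR V) ≤ n := by
    refine (ringKrullDim_quotient_le _).trans ?_
    rw [MvPolynomial.ringKrullDim_of_isNoetherianRing]
    simp
  have hge : 0 ≤ ringKrullDim (CR V) := ringKrullDim_nonneg_of_nontrivial
  obtain ⟨e, he⟩ : ∃ e : ℕ, ringKrullDim (CR V) = e := by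
    generalize ringKrullDim (CR V) = r at hle hge
    induction r with
    | bot => simp at hge
    | coe r =>
      induction r with
      | top => exact absurd (WithBot.coe_le_coe.1 hle) (not_le.2 (ENat.natCast_lt_top n))
      | coe r => exact ⟨r, rfl⟩
  rw [he]
  have h3 : varDim V = e := by
    rw [varDim, he]; rfl
  rw [← hd, h3]

/-- an affine subspace is cut out by linear equations -/
lemma affine_eqs {K : Type*} [Field K] {N e : ℕ} (L : AffineSubspace K (Fin N → K))
    (p0 : Fin N → K) (hp0 : p0 ∈ L) (hN : N ≤ Module.finrank K L.direction + e) :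
    ∃ (w : Matrix (Fin e) (Fin N) K), ∀ p, p ∈ L ↔ w.mulVec p = w.mulVec p0 := by
  have h1 : Module.finrank K ((Fin N → K) ⧸ L.direction) ≤ Module.finrank K (Fin e → K) := by
    have := Submodule.finrank_quotient_add_finrank L.direction
    simp at this ⊢
    omega
  obtain ⟨f, hf⟩ := (_root_.finrank_le_iff_exists_linearMap).1 h1
  refine ⟨LinearMap.toMatrix' (f ∘ₗ L.direction.mkQ), fun p => ?_⟩
  rw [LinearMap.toMatrix'_mulVec, LinearMap.toMatrix'_mulVec, LinearMap.comp_apply, LinearMap.comp_apply,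
    hf.eq_iff, ← sub_eq_zero, ← map_sub, Submodule.mkQ_apply, Submodule.Quotient.mk_eq_zero]
  rw [← vsub_eq_sub, AffineSubspace.vsub_right_mem_direction_iff_mem hp0]

end TB

namespace TB

/-- affine linear form -/
noncomputable def affForm {K : Type*} [Field K] {σ : Type*} [Fintype σ] (w : σ → K) (c : K) : MvPolynomial σ K :=
  ∑ i, C (w i) * X i - C c

lemma eval_affForm {K : Type*} [Field K] {σ : Type*} [Fintype σ] (w : σ → K) (c : K) (p : σ → K) :
    eval p (affForm w c) = w ⬝ᵥ p - c := by
  simp [affForm, dotProduct]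

lemma affForm_deg {K : Type*} [Field K] {σ : Type*} [Fintype σ] (w : σ → K) (c : K) :
    (affForm w c).totalDegree ≤ 1 := by
  refine (totalDegree_sub _ _).trans (max_le ?_ (by simp))
  refine totalDegree_finsetSum_le fun i _ => (totalDegree_mul _ _).trans ?_
  simp

lemma rows_indep {K A : Type*} [Field K] [CommRing A] [Algebra K A] {n d : ℕ} (x : Fin n → A)
    (M : Matrix (Fin d) (Fin n) K) 
    (hinj : Function.Injective (aeval (lin x M) : MvPolynomial (Fin d) K →ₐ[K] A)) :
    LinearIndependent K M.row := by
  rw [Fintype.linearIndependent_iff]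
  intro g hg j
  have h0 : aeval (lin x M) (∑ j, C (g j) * X j : MvPolynomial (Fin d) K) = 0 := by
    simp only [map_sum, map_mul, aeval_X, lin, aeval_C, Finset.mul_sum]
    rw [Finset.sum_comm]
    refine Finset.sum_eq_zero fun i _ => ?_
    have := congrFun hg i
    simp only [Finset.sum_apply, Pi.smul_apply, Matrix.row_apply, Pi.zero_apply, smul_eq_mul] at this
    have h2 := congrArg (fun t => t • x i) this
    simp only [zero_smul, Finset.sum_smul] at h2
    rw [← h2]
    refine Finset.sum_congr rfl fun j _ => ?_
    rw [mul_smul, Algebra.smul_def (g j)]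
  have h1 : (∑ j, C (g j) * X j : MvPolynomial (Fin d) K) = 0 := hinj (by rw [h0, map_zero])
  have := congrArg (eval (Pi.single j 1)) h1
  simpa [Pi.single_apply] using this

lemma finrank_ker_rows {K : Type*} [Field K] {n d : ℕ} (M : Matrix (Fin d) (Fin n) K)
    (h : LinearIndependent K M.row) : Module.finrank K (LinearMap.ker M.mulVecLin) + d = n := by
  have h1 := h.rank_matrix
  have h2 := LinearMap.finrank_range_add_finrank_ker M.mulVecLin
  rw [Matrix.rank] at h1
  simp at h1 h2
  omega

lemma char_lin {K A : Type*} [Field K] [CommRing A] [Algebra K A] {n d : ℕ} (x : Fin n → A)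
    (M : Matrix (Fin d) (Fin n) K) (ψ : A →ₐ[K] K) (j) :
    ψ (lin x M j) = M.mulVec (fun i => ψ (x i)) j := by
  simp [lin, Matrix.mulVec, dotProduct]

theorem geomDegree_eq {K : Type} [Field K] [IsAlgClosed K] {n d : ℕ} {V : Set (Fin n → K)}
    (h1 : IsIrreducibleVariety V) (hd : varDim V = d)
    (M : Matrix (Fin d) (Fin n) K) (hM : ∀ i, RInt K (lin (cx V) M) (cx V i))
    (hinj : Function.Injective (aeval (lin (cx V) M) : MvPolynomial (Fin d) K →ₐ[K] CR V))
    (δ : ℕ) (θ : Fin δ → CR V) (s : CR V) (c : ℕ) (hs : s ≠ 0)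
    (hpack : ∀ α : Fin n →₀ ℕ, ∃ b : Fin δ → MvPolynomial (Fin d) K,
        (∀ j, (b j).totalDegree ≤ (α.sum fun _ e => e) + c) ∧
        s * aeval (cx V) (monomial α (1:K)) = ∑ j, aeval (lin (cx V) M) (b j) * θ j)
    (a : Fin d → K) (S : Finset (CR V →ₐ[K] K)) (hS : S.card = δ)
    (hSa : ∀ χ ∈ S, ∀ j, χ (lin (cx V) M j) = a j) : geomDegree V = δ := by
  classical
  have := h1.2
  have hle : δ ∈ upperBounds {m | ∃ L : AffineSubspace K (Fin n → K),
      Module.finrank K L.direction = n - varDim V ∧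
      (V ∩ (L : Set (Fin n → K))).Finite ∧ (V ∩ (L : Set (Fin n → K))).ncard = m} := by
    rintro m ⟨L, hL, hfin, rfl⟩
    rcases (V ∩ (L : Set (Fin n → K))).eq_empty_or_nonempty with he | ⟨p0, hp0V, hp0⟩
    · rw [he]; simp
    obtain ⟨w, hw⟩ := affine_eqs (e := d) L p0 hp0 (by omega)
    let F : Fin d → MvPolynomial (Fin n) K := fun k => affForm (w k) (w.mulVec p0 k)
    have hker : ∀ ψ : CR V →ₐ[K] K, Ideal.span (Set.range fun k => aeval (cx V) (F k)) ≤ RingHom.ker ψ ↔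
        (fun i => ψ (cx V i)) ∈ L := by
      intro ψ
      rw [Ideal.span_le, Set.range_subset_iff, hw, funext_iff]
      refine forall_congr' fun k => ?_
      rw [SetLike.mem_coe, RingHom.mem_ker, char_eval, eval_affForm, sub_eq_zero]
      rfl
    let S' : Finset (CR V →ₐ[K] K) := hfin.toFinset.attach.image
      fun p => ch ((hfin.mem_toFinset.1 p.2).1)
    have hS' : ∀ ψ : CR V →ₐ[K] K, ψ ∈ S' ↔ (fun i => ψ (cx V i)) ∈ L := by
      intro ψ
      simp only [S', Finset.mem_image, Finset.mem_attach, true_and]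
      constructor
      · rintro ⟨p, rfl⟩
        simp only [ch_cx]
        exact (hfin.mem_toFinset.1 p.2).2
      · intro h
        exact ⟨⟨_, hfin.mem_toFinset.2 ⟨char_mem h1.1 ψ, h⟩⟩, (eq_ch h1.1 ψ).symm⟩
    have hcard : S'.card = (V ∩ (L : Set (Fin n → K))).ncard := by
      rw [Finset.card_image_of_injective, Finset.card_attach, Set.ncard_eq_toFinset_card _ hfin]
      intro p q hpq
      ext i
      have := congrArg (fun χ => χ (cx V i)) hpq
      simpa [ch_cx] using this
    have hb := bezout (cx V) (cx_surj V) (lin (cx V) M) δ θ s hs c hpack F (fun _ => 1) (fun _ => le_rfl)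
      (fun k => affForm_deg _ _) S' ?_ ?_
    · rw [← hcard]; simpa using hb
    · intro χ _
      rw [Fintype.card_fin]
      exact (krullDim_eq_of_isIntegral_mv _ hinj (rint_all_isIntegral _ (cx_surj V) _ hM)).2 _
        (RingHom.ker_isMaximal_of_surjective _ (fun c => ⟨algebraMap K _ c, by simp⟩))
    · intro χ hχ
      refine iso_min _ χ ((hker χ).2 ((hS' χ).1 hχ)) 1 (by simp) S' fun ψ hψ _ => ?_
      exact (hS' ψ).2 ((hker ψ).1 hψ)
  refine le_antisymm (csSup_le' hle) ?_
  rcases S.eq_empty_or_nonempty with he | ⟨χ0, hχ0⟩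
  · rw [← hS, he]; simp
  let p0 : Fin n → K := fun i => χ0 (cx V i)
  have hp0 : M.mulVec p0 = a := by
    ext j; rw [← hSa χ0 hχ0 j, char_lin]
  let L := AffineSubspace.mk' p0 (LinearMap.ker M.mulVecLin)
  have hL : ∀ p, p ∈ L ↔ M.mulVec p = a := by
    intro p
    rw [AffineSubspace.mem_mk', LinearMap.mem_ker, vsub_eq_sub, Matrix.mulVecLin_apply, Matrix.mulVec_sub, hp0,
      sub_eq_zero]
  have hfin : (V ∩ (L : Set (Fin n → K))).Finite := by
    refine ((fiber_finite (cx V) (cx_surj V) _ hM a).image fun χ i => χ (cx V i)).subset ?_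
    rintro p ⟨hp, hpL⟩
    refine ⟨ch hp, fun j => ?_, ?_⟩
    · rw [char_lin]; simp only [ch_cx]; exact congrFun ((hL p).1 hpL) j
    · ext i; simp [ch_cx]
  have hn := finrank_ker_rows M (rows_indep _ _ hinj)
  refine le_trans ?_ (le_csSup ⟨δ, hle⟩ ⟨L, ?_, hfin, rfl⟩)
  · rw [← hS, ← Set.ncard_coe_finset S]
    refine Set.ncard_le_ncard_of_injOn (fun χ i => χ (cx V i)) ?_ ?_ hfin
    · intro χ hχ
      refine ⟨char_mem h1.1 χ, (hL _).2 ?_⟩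
      ext j; rw [← char_lin]; exact hSa χ hχ j
    · intro χ _ χ' _ h
      exact char_ext _ (cx_surj V) fun i => congrFun h i
  · rw [AffineSubspace.direction_mk']; omega

/-- normalisation whose degree is the geometric degree -/
theorem exists_norm {K : Type} [Field K] [IsAlgClosed K] [CharZero K] {n d : ℕ} {V : Set (Fin n → K)}
    (h1 : IsIrreducibleVariety V) (hd : varDim V = d)
    (T : Submodule K (Fin n → K)) (hT : Module.finrank K T ≤ d) :
    1 ≤ geomDegree V ∧ d ≤ n ∧ ∃ M : Matrix (Fin d) (Fin n) K, (∀ i, RInt K (lin (cx V) M) (cx V i)) ∧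
      (∀ w ∈ T, M.mulVec w = 0 → w = 0) ∧
      Function.Injective (aeval (lin (cx V) M) : MvPolynomial (Fin d) K →ₐ[K] CR V) ∧
      (∀ Q : Ideal (CR V), Q.IsMaximal → (d : ℕ∞) ≤ Q.height) ∧
      LinearIndependent K M.row ∧
      (∃ (θ : Fin (geomDegree V) → CR V) (s : CR V) (c : ℕ), s ≠ 0 ∧
      (∀ α : Fin n →₀ ℕ, ∃ b : Fin (geomDegree V) → MvPolynomial (Fin d) K,
        (∀ j, (b j).totalDegree ≤ (α.sum fun _ e => e) + c) ∧
        s * aeval (cx V) (monomial α (1:K)) = ∑ j, aeval (lin (cx V) M) (b j) * θ j)) ∧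
      (∀ t : CR V, ∃ p : Polynomial (MvPolynomial (Fin d) K), p.Monic ∧ p.natDegree ≤ geomDegree V ∧
        Polynomial.eval₂ (aeval (lin (cx V) M) : MvPolynomial (Fin d) K →ₐ[K] CR V).toRingHom t p = 0 ∧
        ∀ q, Polynomial.eval₂ (aeval (lin (cx V) M) : MvPolynomial (Fin d) K →ₐ[K] CR V).toRingHom t q = 0 → p ∣ q) := by
  have := h1.2
  obtain ⟨M, hM, hMT, hinj⟩ := exists_noether (cx V) (cx_surj V) (krullDim_CR h1 hd) T hT
  obtain ⟨δ, θ, s, c, hs, hpack, hmin, a, S, hS, hSa⟩ := package (cx V) (cx_surj V) (lin (cx V) M) hM hinj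
  have hδ := geomDegree_eq h1 hd M hM hinj δ θ s c hs hpack a S hS hSa
  subst hδ
  refine ⟨?_, ?_, M, hM, hMT, hinj, 
    (krullDim_eq_of_isIntegral_mv _ hinj (rint_all_isIntegral _ (cx_surj V) _ hM)).2, rows_indep _ _ hinj,
    ⟨θ, s, c, hs, hpack⟩, hmin⟩
  · by_contra hcon
    obtain ⟨p, hp, hdeg, h0, -⟩ := hmin 0
    have : p = 1 := Polynomial.Monic.natDegree_eq_zero hp |>.1 (by omega)
    rw [this, Polynomial.eval₂_one] at h0
    exact one_ne_zero h0
  · have := finrank_ker_rows M (rows_indep _ _ hinj)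
    omega

end TB

namespace TB

/-- extend a family by one more element -/
def oe {A : Type*} {k : Type*} (y : k → A) (t : A) : Option k → A := fun o => o.elim t y

lemma totalDegree_aeval_le {K σ τ : Type*} [Field K] (g : σ → MvPolynomial τ K) (hg : ∀ i, (g i).totalDegree ≤ 1)
    (f : MvPolynomial σ K) : (aeval g f).totalDegree ≤ f.totalDegree := by
  conv_lhs => rw [f.as_sum, map_sum]
  refine totalDegree_finsetSum_le fun α hα => ?_
  rw [aeval_monomial]
  refine (totalDegree_mul _ _).trans ?_
  rw [MvPolynomial.algebraMap_eq, totalDegree_C, zero_add, Finsupp.prod]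
  refine (totalDegree_finsetProd _ _).trans ?_
  refine le_trans (Finset.sum_le_sum fun i _ => ?_) (le_totalDegree hα)
  refine (totalDegree_pow _ _).trans ?_
  simpa using Nat.mul_le_mul_left (α i) (hg i)

lemma eval₂_optionEquivLeft {K A : Type*} [Field K] [CommRing A] [Algebra K A] {k : Type*} (y : k → A) (t : A)
    (f : MvPolynomial (Option k) K) :
    Polynomial.eval₂ (aeval y : MvPolynomial k K →ₐ[K] A).toRingHom t (optionEquivLeft K k f) = aeval (oe y t) f := by
  induction f using MvPolynomial.induction_on with
  | C a => simp [optionEquivLeft_C]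
  | add p q hp hq => simp only [map_add, Polynomial.eval₂_add, hp, hq]
  | mul_X p o hp =>
    rw [map_mul, Polynomial.eval₂_mul, hp, map_mul, aeval_X]
    congr 1
    cases o with
    | none => simp [optionEquivLeft_X_none, oe]
    | some i => simp [optionEquivLeft_X_some, oe]

lemma exists_minpol {K A : Type*} [Field K] [CommRing A] [Algebra K A] {d D : ℕ} (y : Fin d → A) (t : A)
    (ht : RInt K y t)
    (h : ∃ p : Polynomial (MvPolynomial (Fin d) K), p.Monic ∧ p.natDegree ≤ D ∧
        Polynomial.eval₂ (aeval y : MvPolynomial (Fin d) K →ₐ[K] A).toRingHom t p = 0 ∧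
        ∀ q, Polynomial.eval₂ (aeval y : MvPolynomial (Fin d) K →ₐ[K] A).toRingHom t q = 0 → p ∣ q) :
    ∃ f : MvPolynomial (Option (Fin d)) K, f.totalDegree ≤ D ∧ aeval (oe y t) f = 0 ∧
      ∀ g : MvPolynomial (Option (Fin d)) K, aeval (oe y t) g = 0 → f ∣ g := by
  obtain ⟨p, hp, hpD, hp0, hpm⟩ := h
  let e := optionEquivLeft K (Fin d)
  have hpe : e (e.symm p) = p := e.apply_symm_apply p
  have hdvd : ∀ g : MvPolynomial (Option (Fin d)) K, aeval (oe y t) g = 0 → e.symm p ∣ g := by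
    intro g hg
    obtain ⟨h, hh⟩ := hpm (e g) (by rw [eval₂_optionEquivLeft, hg])
    refine ⟨e.symm h, e.injective ?_⟩
    rw [map_mul, hpe, e.apply_symm_apply, hh]
  refine ⟨e.symm p, ?_, ?_, hdvd⟩
  · obtain ⟨r, b, hb, hr⟩ := ht.relation
    let q : MvPolynomial (Option (Fin d)) K := X none ^ r + ∑ j ∈ Finset.range r, rename some (b j) * X none ^ j
    have hq0 : aeval (oe y t) q = 0 := by
      rw [← hr]
      simp only [q, map_add, map_pow, aeval_X, map_sum, map_mul, aeval_rename]
      rfl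
    have hqd : q.totalDegree ≤ r := by
      refine (totalDegree_add _ _).trans (max_le ?_ ?_)
      · simp [totalDegree_X_pow]
      · refine totalDegree_finsetSum_le fun j hj => (totalDegree_mul _ _).trans ?_
        rw [totalDegree_X_pow]
        have := hb j (Finset.mem_range.1 hj)
        have h2 := totalDegree_rename_le some (b j)
        have := Finset.mem_range.1 hj
        omega
    have hren : ∀ b : MvPolynomial (Fin d) K, e (rename some b) = Polynomial.C b := by
      intro b
      induction b using MvPolynomial.induction_on with
      | C a => simp [e, optionEquivLeft_C]
      | add p q hp hq => simp only [map_add, hp, hq]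
      | mul_X p i hp => rw [map_mul, map_mul, hp, rename_X, optionEquivLeft_X_some, map_mul]
    have hqe : e q = Polynomial.X ^ r + ∑ j ∈ Finset.range r, Polynomial.C (b j) * Polynomial.X ^ j := by
      simp only [q, map_add, map_pow, map_sum, map_mul, hren]
      simp [e, optionEquivLeft_X_none]
    have hlt : (∑ j ∈ Finset.range r, Polynomial.C (b j) * Polynomial.X ^ j).degree < ((r : ℕ) : WithBot ℕ) := by
      rw [Polynomial.degree_lt_iff_coeff_zero]
      intro m hm
      rw [Polynomial.finsetSum_coeff]
      refine Finset.sum_eq_zero fun j hj => ?_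
      rw [Polynomial.coeff_C_mul_X_pow, if_neg]
      have := Finset.mem_range.1 hj
      omega
    have hqm : (e q).Monic := by
      rw [hqe]; exact Polynomial.monic_X_pow_add hlt
    have hqn : (e q).natDegree = r := by
      rw [hqe]
      refine Polynomial.natDegree_eq_of_degree_eq_some ?_
      rw [Polynomial.degree_add_eq_left_of_degree_lt, Polynomial.degree_X_pow]
      rwa [Polynomial.degree_X_pow]
    obtain ⟨h, hh⟩ := hdvd q hq0
    have hq_ne : q ≠ 0 := fun h0 => hqm.ne_zero (by rw [h0, map_zero])
    have hpne : e.symm p ≠ 0 := fun h0 => hq_ne (by rw [hh, h0, zero_mul])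
    have hhne : h ≠ 0 := fun h0 => hq_ne (by rw [hh, h0, mul_zero])
    have h1 : q.totalDegree = (e.symm p).totalDegree + h.totalDegree := by
      rw [hh, totalDegree_mul_of_isDomain hpne hhne]
    have h2 : (e q).natDegree = p.natDegree + (e h).natDegree := by
      rw [hh, map_mul, hpe, Polynomial.natDegree_mul hp.ne_zero]
      intro h0; exact hhne (e.injective (by rw [h0, map_zero]))
    have h3 : (e h).natDegree ≤ h.totalDegree := by
      rw [natDegree_optionEquivLeft]; exact degreeOf_le_totalDegree _ _
    omega
  · rw [← eval₂_optionEquivLeft]; erw [hpe]; exact hp0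

end TB

namespace TB

lemma oe_comp {A B : Type*} {k : Type*} (y : k → A) (t : A) (φ : A → B) :
    (fun o => φ (oe y t o)) = oe (fun j => φ (y j)) (φ t) := by
  funext o; cases o <;> rfl

lemma mem_ker_sub {K A : Type*} [Field K] [CommRing A] [Algebra K A] (χ : A →ₐ[K] K) (a : A) :
    a - algebraMap K A (χ a) ∈ RingHom.ker χ := by
  rw [RingHom.mem_ker]; simp

lemma pderiv_ne {K A : Type*} [Field K] [IsAlgClosed K] [CommRing A] [Algebra K A] [Algebra.FiniteType K A]
    {d : ℕ} (y : Fin d → A) (hIntg : (aeval y : MvPolynomial (Fin d) K →ₐ[K] A).IsIntegral)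
    (χ : A →ₐ[K] K)
    (hm : RingHom.ker χ ≤ Ideal.span (Set.range fun j => y j - algebraMap K A (χ (y j))) ⊔ (RingHom.ker χ) * RingHom.ker χ)
    (t : A) (ht : ∀ ψ : A →ₐ[K] K, (∀ j, ψ (y j) = χ (y j)) → ψ t = χ t → ψ = χ)
    (f : MvPolynomial (Option (Fin d)) K) (hf0 : aeval (oe y t) f = 0)
    (hf : ∀ g : MvPolynomial (Option (Fin d)) K, aeval (oe y t) g = 0 → f ∣ g) :
    eval (oe (fun j => χ (y j)) (χ t)) (pderiv none f) ≠ 0 := by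
  classical
  have hNoeth : IsNoetherianRing A := Algebra.FiniteType.isNoetherianRing K A
  let φ : (MvPolynomial (Option (Fin d)) K) →ₐ[K] A := aeval (oe y t)
  have hφ : ∀ g : (MvPolynomial (Option (Fin d)) K), χ (φ g) = eval (oe (fun j => χ (y j)) (χ t)) g := by
    intro g
    rw [char_eval, oe_comp]
  -- the ideal generated by ℓ and t
  let Y : Ideal A := Ideal.span (Set.range fun j => y j - algebraMap K A (χ (y j)))
  let J : Ideal A := Y ⊔ Ideal.span {t - algebraMap K A (χ t)}
  set m : Ideal A := RingHom.ker χ with hmdef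
  have hmmax : m.IsMaximal := RingHom.ker_isMaximal_of_surjective _ (fun c => ⟨algebraMap K _ c, by simp⟩)
  have hJ : m ≤ J := by
    have hrad : m ≤ J.radical := by
      intro g hg
      have hj : J.radical.jacobson = J.radical :=
        (isJacobsonRing_iff.1 (isJacobsonRing_of_finiteType (A := K) (B := A))) _ J.radical_isRadical
      rw [← hj, Ideal.jacobson, Ideal.mem_sInf]
      rintro Q ⟨hJQ, hQ⟩
      obtain ⟨ψ, rfl⟩ := exists_char (K := K) Q hQ
      have hJψ : J ≤ RingHom.ker ψ := Ideal.le_radical.trans hJQ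
      have : ψ = χ := by
        apply ht
        · intro j
          have : y j - algebraMap K A (χ (y j)) ∈ RingHom.ker ψ :=
            hJψ (Ideal.mem_sup_left (Ideal.subset_span ⟨j, rfl⟩))
          rw [RingHom.mem_ker] at this
          simpa [sub_eq_zero] using this
        · have : t - algebraMap K A (χ t) ∈ RingHom.ker ψ :=
            hJψ (Ideal.mem_sup_right (Ideal.subset_span rfl))
          rw [RingHom.mem_ker] at this
          simpa [sub_eq_zero] using this
      rw [this]; exact hg
    obtain ⟨N, hN⟩ := Ideal.exists_pow_le_of_le_radical_of_fg hrad (IsNoetherian.noetherian m)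
    have hk : ∀ k : ℕ, m ≤ J ⊔ m ^ k := by
      intro k
      induction k with
      | zero => simp
      | succ k ih =>
        refine hm.trans (sup_le (le_sup_left.trans le_sup_left) ?_)
        calc m * m ≤ (J ⊔ m ^ k) * m := Ideal.mul_mono_left ih
          _ = J * m ⊔ m ^ (k + 1) := by rw [Ideal.sup_mul, pow_succ]
          _ ≤ J ⊔ m ^ (k + 1) := sup_le_sup_right Ideal.mul_le_left _
    exact (hk N).trans (sup_le le_rfl hN)
  -- conductor
  obtain ⟨ρ, hρ1, hρ⟩ : ∃ ρ : (MvPolynomial (Option (Fin d)) K), χ (φ ρ) = 1 ∧ ∀ a : A, ∃ b : (MvPolynomial (Option (Fin d)) K), φ b = φ ρ * a := by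
    let _ : Algebra (MvPolynomial (Option (Fin d)) K) A := φ.toAlgebra
    have hal : ∀ p : (MvPolynomial (Option (Fin d)) K), algebraMap (MvPolynomial (Option (Fin d)) K) A p = φ p := fun _ => rfl
    have hsm : ∀ (p : (MvPolynomial (Option (Fin d)) K)) (a : A), p • a = φ p * a := fun p a => by rw [Algebra.smul_def, hal]
    have : IsScalarTower K (MvPolynomial (Option (Fin d)) K) A := IsScalarTower.of_algebraMap_eq (by
      intro c; rw [hal, MvPolynomial.algebraMap_eq, aeval_C])
    have hft' : Algebra.FiniteType (MvPolynomial (Option (Fin d)) K) A := Algebra.FiniteType.of_restrictScalars_finiteType K _ A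
    have hi : Algebra.IsIntegral (MvPolynomial (Option (Fin d)) K) A := ⟨fun a => by
      obtain ⟨p, hp, hp0⟩ := hIntg a
      refine ⟨p.map (rename some : MvPolynomial (Fin d) K →ₐ[K] (MvPolynomial (Option (Fin d)) K)).toRingHom, hp.map _, ?_⟩
      rw [Polynomial.eval₂_map, ← hp0]
      congr 1
      ext i
      · simp [hal, φ]
      · simp [hal, φ, oe]⟩
    have : Module.Finite (MvPolynomial (Option (Fin d)) K) A := Algebra.IsIntegral.finite
    let N' : Submodule (MvPolynomial (Option (Fin d)) K) A := LinearMap.range (Algebra.linearMap (MvPolynomial (Option (Fin d)) K) A)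
    let I : Ideal (MvPolynomial (Option (Fin d)) K) := RingHom.ker (χ.comp φ)
    have hle : (⊤ : Submodule (MvPolynomial (Option (Fin d)) K) (A ⧸ N')) ≤ I • (⊤ : Submodule (MvPolynomial (Option (Fin d)) K) (A ⧸ N')) := by
      have hJN : ∀ a ∈ J, N'.mkQ a ∈ I • (⊤ : Submodule (MvPolynomial (Option (Fin d)) K) (A ⧸ N')) := by
        have key : ∀ (q : (MvPolynomial (Option (Fin d)) K)) (c : A), q ∈ I → N'.mkQ (c * φ q) ∈ I • (⊤ : Submodule (MvPolynomial (Option (Fin d)) K) (A ⧸ N')) := by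
          intro q c hq
          rw [mul_comm, ← hsm, map_smul]
          exact Submodule.smul_mem_smul hq trivial
        intro a ha
        obtain ⟨b, hb, c, hc, rfl⟩ := Submodule.mem_sup.1 ha
        rw [map_add]
        refine Submodule.add_mem _ ?_ ?_
        · obtain ⟨w, rfl⟩ := Ideal.mem_span_range_iff_exists_fun.1 hb
          rw [map_sum]
          refine Submodule.sum_mem _ fun j _ => ?_
          have := key (X (some j) - C (χ (y j))) (w j) (by simp [I, RingHom.mem_ker, φ, oe])
          simpa [φ, oe] using this
        · obtain ⟨w, rfl⟩ := Ideal.mem_span_singleton'.1 hc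
          have := key (X none - C (χ t)) w (by simp [I, RingHom.mem_ker, φ, oe])
          simpa [φ, oe] using this
      intro a _
      obtain ⟨a, rfl⟩ := N'.mkQ_surjective a
      have h1 := hJN _ (hJ (mem_ker_sub χ a))
      rw [map_sub] at h1
      have h2 : N'.mkQ (algebraMap K A (χ a)) = 0 := by
        rw [Submodule.mkQ_apply, Submodule.Quotient.mk_eq_zero]
        exact ⟨C (χ a), by simp [hal, φ]⟩
      rwa [h2, sub_zero] at h1
    obtain ⟨r, hr1, hr⟩ := Submodule.exists_sub_one_mem_and_smul_eq_zero_of_fg_of_le_smul I ⊤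
      Module.Finite.fg_top hle
    refine ⟨r, ?_, fun a => ?_⟩
    · have : χ (φ (r - 1)) = 0 := hr1
      simpa [sub_eq_zero] using this
    · have := hr (N'.mkQ a) trivial
      rw [← map_smul, Submodule.mkQ_apply, Submodule.Quotient.mk_eq_zero] at this
      obtain ⟨b, hb⟩ := this
      exact ⟨b, by rw [← hsm]; exact hb⟩
  -- local generation
  obtain ⟨w, hw1, hw⟩ : ∃ w : A, χ w = 1 ∧ ∀ a ∈ m, w * a ∈ Y := by
    have hle : m.map (Ideal.Quotient.mk Y) ≤ (m.map (Ideal.Quotient.mk Y)) • m.map (Ideal.Quotient.mk Y) := by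
      rw [smul_eq_mul, ← Ideal.map_mul]
      refine (Ideal.map_mono hm).trans ?_
      rw [Ideal.map_sup]
      refine sup_le ?_ le_rfl
      rw [Ideal.map_quotient_self]; exact bot_le
    obtain ⟨r, hr1, hr⟩ := Submodule.exists_sub_one_mem_and_smul_eq_zero_of_fg_of_le_smul _ _
      (IsNoetherian.noetherian _) hle
    obtain ⟨r, rfl⟩ := Ideal.Quotient.mk_surjective r
    have hYm : Y ≤ m := Ideal.span_le.2 (by rintro _ ⟨j, rfl⟩; exact mem_ker_sub χ _)
    refine ⟨r, ?_, fun a ha => ?_⟩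
    · have : r - 1 ∈ m := by
        rw [← map_one (Ideal.Quotient.mk Y), ← map_sub] at hr1
        obtain ⟨z, hz, hz'⟩ := (Ideal.mem_map_iff_of_surjective _ Ideal.Quotient.mk_surjective).1 hr1
        rw [Ideal.Quotient.eq] at hz'
        have := m.sub_mem hz (hYm hz')
        simpa using this
      rw [hmdef, RingHom.mem_ker] at this
      simpa [sub_eq_zero] using this
    · have := hr _ (Ideal.mem_map_of_mem _ ha)
      rw [smul_eq_mul, ← map_mul, Ideal.Quotient.eq_zero_iff_mem] at this
      exact this
  obtain ⟨c, hc⟩ := Ideal.mem_span_range_iff_exists_fun.1 (hw _ (mem_ker_sub χ t))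
  obtain ⟨W, hW⟩ := hρ w
  choose Cc hCc using fun j => hρ (c j)
  let g : (MvPolynomial (Option (Fin d)) K) := W * (X none - C (χ t)) - ∑ j, Cc j * (X (some j) - C (χ (y j)))
  have hg0 : φ g = 0 := by
    have e1 : φ (X none - C (χ t)) = t - algebraMap K A (χ t) := by simp [φ, oe]
    have e2 : ∀ j, φ (X (some j) - C (χ (y j))) = y j - algebraMap K A (χ (y j)) := by simp [φ, oe]
    simp only [g, map_sub φ (W * _), map_mul φ W, map_mul φ (Cc _), map_sum, e1, e2, hW, hCc, mul_assoc]
    rw [← hc, Finset.mul_sum, sub_self]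
  obtain ⟨h, hh⟩ := hf g hg0
  have hd : eval (oe (fun j => χ (y j)) (χ t)) (pderiv none g) = 1 := by
    have e3 : eval (oe (fun j => χ (y j)) (χ t)) W = 1 := by
      rw [← hφ, hW, map_mul, hρ1, hw1, one_mul]
    simp [g, Derivation.leibniz, pderiv_X, oe, Pi.single_apply]
    exact e3
  intro h0
  rw [hh, Derivation.leibniz, map_add, smul_eq_mul, smul_eq_mul, map_mul, map_mul, h0, ← hφ, 
    show φ f = 0 from hf0, map_zero] at hd
  simp at hd

end TB

namespace TB

lemma exists_avoid {K E ι : Type*} [Field K] [Infinite K] [AddCommGroup E] [Module K E] [Finite ι]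
    (W : ι → Submodule K E) (hW : ∀ i, W i ≠ ⊤) : ∃ u : E, ∀ i, u ∉ W i := by
  by_contra hcon
  push Not at hcon
  obtain ⟨i, hi⟩ := Subspace.exists_eq_top_of_iUnion_eq_univ (p := W) (by
    ext u; simpa using hcon u)
  exact hW i hi

/-- gradient at a point, as a linear map -/
noncomputable def grad {K : Type*} [Field K] {σ : Type*} (p : σ → K) : MvPolynomial σ K →ₗ[K] (σ → K) where
  toFun f i := eval p (pderiv i f)
  map_add' f g := by ext i; simp
  map_smul' c f := by ext i; simp [smul_eval]

lemma grad_apply {K : Type*} [Field K] {σ : Type*} (p : σ → K) (f : MvPolynomial σ K) (i : σ) :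
    grad p f i = eval p (pderiv i f) := rfl

lemma taylor {K A : Type*} [Field K] [CommRing A] [Algebra K A] {σ : Type*} [Fintype σ] (x : σ → A) (p : σ → K)
    (m : Ideal A) (hm : ∀ i, x i - algebraMap K A (p i) ∈ m) (f : MvPolynomial σ K) :
    aeval x f - algebraMap K A (eval p f) - ∑ i, algebraMap K A (grad p f i) * (x i - algebraMap K A (p i)) ∈ m * m := by
  classical
  have hsum : ∀ f : MvPolynomial σ K, 
      ∑ i, algebraMap K A (grad p f i) * (x i - algebraMap K A (p i)) ∈ m := fun f =>
    Ideal.sum_mem _ fun i _ => Ideal.mul_mem_left _ _ (hm i)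
  induction f using MvPolynomial.induction_on with
  | C a => simp [grad_apply]
  | add f g hf hg =>
    convert Ideal.add_mem _ hf hg using 1
    simp only [map_add, Pi.add_apply, add_mul, Finset.sum_add_distrib]
    ring
  | mul_X f j hf =>
    have e : ∑ i, algebraMap K A (grad p (f * X j) i) * (x i - algebraMap K A (p i)) =
      algebraMap K A (p j) * ∑ i, algebraMap K A (grad p f i) * (x i - algebraMap K A (p i)) +
       algebraMap K A (eval p f) * (x j - algebraMap K A (p j)) := by
      simp only [grad_apply, Derivation.leibniz, pderiv_X, smul_eq_mul, map_add, map_mul, eval_X, add_mul,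
        Finset.sum_add_distrib, Finset.mul_sum]
      rw [add_comm]
      congr 1
      · exact Finset.sum_congr rfl fun i _ => by ring
      · rw [Finset.sum_eq_single j]
        · simp
        · intro i _ hi
          simp [Pi.single_apply, hi]
        · simp
    rw [e, map_mul, map_mul, aeval_X, eval_X]
    have h1 := Ideal.mul_mem_left _ (x j) hf
    have h2 := Ideal.mul_mem_mul (hsum f) (hm j)
    convert Ideal.add_mem _ h1 h2 using 1
    rw [map_mul]
    ring

lemma chain {K : Type*} [Field K] {σ τ : Type*} [Fintype τ] (p : σ → K) (g : τ → MvPolynomial σ K)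
    (f : MvPolynomial τ K) :
    grad p (aeval g f) = ∑ o, eval p (aeval g (pderiv o f)) • grad p (g o) := by
  classical
  induction f using MvPolynomial.induction_on with
  | C a => ext i; simp [grad_apply, MvPolynomial.algebraMap_eq]
  | add f h hf hg => simp only [map_add, hf, hg, add_smul, Finset.sum_add_distrib]
  | mul_X f j hf =>
    ext i
    have := congrFun hf i
    simp only [Finset.sum_apply, Pi.smul_apply, smul_eq_mul, grad_apply] at this ⊢
    simp only [map_mul, aeval_X, Derivation.leibniz, smul_eq_mul, map_add, this, pderiv_X, add_mul,
      Finset.sum_add_distrib, Finset.mul_sum]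
    congr 1
    · rw [Finset.sum_eq_single j]
      · simp
      · intro o _ ho; simp [Pi.single_apply, ho.symm]
      · simp
    · exact Finset.sum_congr rfl fun i _ => by ring

lemma top_of_perp {K : Type*} [Field K] {n : ℕ} (W : Submodule K (Fin n → K))
    (h : ∀ w : Fin n → K, (∀ v ∈ W, v ⬝ᵥ w = 0) → w = 0) : W = ⊤ := by
  by_contra hW
  obtain ⟨f, hf, hfW⟩ := Submodule.exists_le_ker_of_lt_top W (lt_top_iff_ne_top.2 hW)
  have hfe : ∀ v, f v = v ⬝ᵥ fun i => f (Pi.single i 1) := by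
    intro v
    conv_lhs => rw [pi_eq_sum_univ' v, map_sum]
    simp [dotProduct]
  apply hf
  have := h (fun i => f (Pi.single i 1)) fun v hv => by rw [← hfe]; exact hfW hv
  ext v
  have h2 := congrFun this v
  simpa using h2

/-- tangent space as a submodule -/
def tsub {K : Type} [Field K] {n : ℕ} (V : Set (Fin n → K)) (p : Fin n → K) : Submodule K (Fin n → K) where
  carrier := tangentSpaceAt V p
  add_mem' := by
    intro a b ha hb f hf
    have h1 := ha f hf
    have h2 := hb f hf
    simp only [Pi.add_apply, mul_add, Finset.sum_add_distrib, h1, h2, add_zero]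
  zero_mem' := by intro f _; simp
  smul_mem' := by
    intro c a ha f hf
    have h1 := ha f hf
    have : ∑ i, eval p (pderiv i f) * (c • a) i = c * ∑ i, eval p (pderiv i f) * a i := by
      rw [Finset.mul_sum]; exact Finset.sum_congr rfl fun i _ => by simp; ring
    rw [this, h1, mul_zero]

lemma mem_tsub {K : Type} [Field K] {n : ℕ} (V : Set (Fin n → K)) (p y : Fin n → K) :
    y ∈ tsub V p ↔ ∀ f ∈ vanishingIdeal K V, grad p f ⬝ᵥ y = 0 := Iff.rfl

lemma finrank_tsub {K : Type} [Field K] {n : ℕ} (V : Set (Fin n → K)) (p : Fin n → K) :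
    Module.finrank K (tsub V p) = tangentDimAt V p := by
  have : Submodule.span K (tangentSpaceAt V p) = tsub V p := Submodule.span_eq (tsub V p)
  rw [tangentDimAt, this]

end TB

namespace TB

/-- the ideal as a subspace -/
noncomputable def idsub {K : Type} [Field K] {n : ℕ} (V : Set (Fin n → K)) : Submodule K (MvPolynomial (Fin n) K) :=
  (vanishingIdeal K V).restrictScalars K

/-- elements of the ideal of degree at most D -/
noncomputable def idD {K : Type} [Field K] {n : ℕ} (V : Set (Fin n → K)) (D : ℕ) :
    Submodule K (MvPolynomial (Fin n) K) :=
  idsub V ⊓ restrictTotalDegree (Fin n) K D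

lemma mem_idD {K : Type} [Field K] {n : ℕ} (V : Set (Fin n → K)) (D : ℕ) (f : MvPolynomial (Fin n) K) :
    f ∈ idD V D ↔ f ∈ vanishingIdeal K V ∧ f.totalDegree ≤ D := by
  rw [idD, Submodule.mem_inf, mem_restrictTotalDegree]; rfl

lemma aeval_cx_eq_zero {K : Type} [Field K] {n : ℕ} (V : Set (Fin n → K)) (f : MvPolynomial (Fin n) K) :
    aeval (cx V) f = 0 ↔ f ∈ vanishingIdeal K V := by
  rw [aeval_cx, Ideal.Quotient.mkₐ_eq_mk, Ideal.Quotient.eq_zero_iff_mem]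

lemma ker_le_sup {K : Type} [Field K] {n d : ℕ} {V : Set (Fin n → K)} {p : Fin n → K} (hp : p ∈ V)
    (M : Matrix (Fin d) (Fin n) K) (hM : ∀ w ∈ tsub V p, M.mulVec w = 0 → w = 0) :
    RingHom.ker (ch hp) ≤ Ideal.span (Set.range fun j => lin (cx V) M j - algebraMap K (CR V) (ch hp (lin (cx V) M j)))
      ⊔ (RingHom.ker (ch hp)) * RingHom.ker (ch hp) := by
  have htop : (idsub V).map (grad p) ⊔ Submodule.span K (Set.range M.row) = ⊤ := by
    refine top_of_perp _ fun w hw => hM w ?_ ?_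
    · rw [mem_tsub]
      intro f hf
      exact hw _ (Submodule.mem_sup_left ⟨f, hf, rfl⟩)
    · ext j
      exact hw _ (Submodule.mem_sup_right (Submodule.subset_span ⟨j, rfl⟩))
  intro g hg
  obtain ⟨F, rfl⟩ := cx_surj V g
  rw [RingHom.mem_ker, ch_aeval] at hg
  have hmem : ∀ i, cx V i - algebraMap K (CR V) (p i) ∈ RingHom.ker (ch hp) := fun i => by
    have := mem_ker_sub (ch hp) (cx V i); rwa [ch_cx] at this
  have h1 := taylor (cx V) p _ hmem F
  have hF : grad p F ∈ (idsub V).map (grad p) ⊔ Submodule.span K (Set.range M.row) := by rw [htop]; trivial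
  obtain ⟨_, ⟨f, hf, rfl⟩, r, hr, hfr⟩ := Submodule.mem_sup.1 hF
  obtain ⟨c, rfl⟩ := (Submodule.mem_span_range_iff_exists_fun K).1 hr
  have h2 := taylor (cx V) p _ hmem f
  have hf0 : eval p f = 0 := hf p hp
  rw [(aeval_cx_eq_zero V f).2 hf, hf0, map_zero] at h2
  rw [hg, map_zero] at h1
  have h3 := Ideal.sub_mem _ h1 h2
  have e : aeval (cx V) F = (∑ j, algebraMap K (CR V) (c j) *
      (lin (cx V) M j - algebraMap K (CR V) (ch hp (lin (cx V) M j)))) +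
      ((aeval (cx V) F - 0 - ∑ i, algebraMap K (CR V) (grad p F i) * (cx V i - algebraMap K (CR V) (p i))) -
      (0 - 0 - ∑ i, algebraMap K (CR V) (grad p f i) * (cx V i - algebraMap K (CR V) (p i)))) := by
    have e1 : ∀ j, lin (cx V) M j - algebraMap K (CR V) (ch hp (lin (cx V) M j)) =
        ∑ i, algebraMap K (CR V) (M j i) * (cx V i - algebraMap K (CR V) (p i)) := by
      intro j
      rw [char_lin]
      simp only [ch_cx, lin, Matrix.mulVec, dotProduct, map_sum, map_mul, mul_sub, Finset.sum_sub_distrib,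
        Algebra.smul_def]
    have e2 : ∀ i, algebraMap K (CR V) (grad p F i) = algebraMap K (CR V) (grad p f i) +
        ∑ j, algebraMap K (CR V) (c j) * algebraMap K (CR V) (M j i) := by
      intro i
      rw [← hfr]
      simp [Finset.sum_apply]
    simp only [e1, e2, add_mul, Finset.sum_add_distrib, Finset.mul_sum, Finset.sum_mul]
    rw [Finset.sum_comm]
    simp only [mul_assoc]
    ring
  rw [e]
  refine Submodule.add_mem _ (Ideal.mem_sup_left (Ideal.sum_mem _ fun j _ => ?_)) (Ideal.mem_sup_right h3)
  exact Ideal.mul_mem_left _ _ (Ideal.subset_span ⟨j, rfl⟩)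

theorem mumford {K : Type} [Field K] [IsAlgClosed K] [CharZero K] {n d : ℕ} {V : Set (Fin n → K)}
    (h1 : IsIrreducibleVariety V) (h2 : IsSmoothVariety V) (hd : varDim V = d) {p : Fin n → K} (hp : p ∈ V) :
    n ≤ Module.finrank K ((idD V (geomDegree V)).map (grad p)) + d := by
  classical
  have := h1.2
  obtain ⟨-, -, M, hM, hMT, hinj, -, -, -, hmin⟩ := exists_norm h1 hd (tsub V p)
    (by rw [finrank_tsub, h2 p hp, hd])
  set U := (idD V (geomDegree V)).map (grad p)
  let W := U ⊔ Submodule.span K (Set.range M.row)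
  suffices hW : W = ⊤ by
    have e1 := Submodule.finrank_add_le_finrank_add_finrank U (Submodule.span K (Set.range M.row))
    have e2 : Module.finrank K (Submodule.span K (Set.range M.row)) ≤ d := by
      have := finrank_range_le_card (R := K) M.row
      simpa [Set.finrank] using this
    have e3 : Module.finrank K W = n := by rw [hW, finrank_top]; simp
    have e4 : Module.finrank K (U ⊔ Submodule.span K (Set.range M.row) : Submodule K (Fin n → K)) = n := e3
    omega
  by_contra hW
  have hfin := fiber_finite (cx V) (cx_surj V) _ hM (fun j => ch hp (lin (cx V) M j))
  let ι := Option {χ : {χ : CR V →ₐ[K] K | ∀ j, χ (lin (cx V) M j) = ch hp (lin (cx V) M j)} // χ.1 ≠ ch hp}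
  have : Finite {χ : CR V →ₐ[K] K | ∀ j, χ (lin (cx V) M j) = ch hp (lin (cx V) M j)} := hfin
  have : Finite ι := inferInstance
  let dot : (Fin n → K) → (Fin n → K) →ₗ[K] K := fun q => 
    { toFun := fun u => u ⬝ᵥ q
      map_add' := fun a b => add_dotProduct _ _ _
      map_smul' := fun c a => smul_dotProduct _ _ _ }
  let Hy : ι → Submodule K (Fin n → K) := fun o => o.elim W
    fun χ => LinearMap.ker (dot ((fun i => χ.1.1 (cx V i)) - p))
  obtain ⟨u, hu⟩ := exists_avoid Hy (by
    rintro (_ | χ)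
    · exact hW
    · intro h
      apply χ.2
      refine char_ext (cx V) (cx_surj V) fun i => ?_
      have : (Pi.single i 1 : Fin n → K) ∈ Hy (some χ) := by rw [h]; trivial
      have h3 : Pi.single i 1 ⬝ᵥ ((fun i => χ.1.1 (cx V i)) - p) = 0 := this
      rw [single_dotProduct, one_mul] at h3
      rw [ch_cx]; exact sub_eq_zero.1 h3)
  apply hu none
  change u ∈ W
  let t : CR V := ∑ i, u i • cx V i
  obtain ⟨f, hfD, hf0, hfm⟩ := exists_minpol (lin (cx V) M) t (RInt.sum _ _ _ hM) (hmin t)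
  have hne := pderiv_ne (lin (cx V) M) (rint_all_isIntegral _ (cx_surj V) _ hM) (ch hp) (ker_le_sup hp M hMT) t
    (by
      intro ψ hψ hψt
      by_contra hcon
      apply hu (some ⟨⟨ψ, hψ⟩, hcon⟩)
      change u ⬝ᵥ ((fun i => ψ (cx V i)) - p) = 0
      rw [dotProduct_sub, sub_eq_zero]
      simpa [t, ch_cx, dotProduct] using hψt) f hf0 hfm
  -- the polynomial in the original variables
  let g : Option (Fin d) → MvPolynomial (Fin n) K := oe (fun j => ∑ i, C (M j i) * X i) (∑ i, C (u i) * X i)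
  have hgc : ∀ o, aeval (cx V) (g o) = oe (lin (cx V) M) t o := by
    rintro (_ | j)
    · simp only [g, oe, t, Option.elim, map_sum, map_mul, aeval_X, aeval_C]
      exact Finset.sum_congr rfl fun i _ => (Algebra.smul_def _ _).symm
    · simp [g, oe, lin, Algebra.smul_def]
  have hgd : ∀ o, (g o).totalDegree ≤ 1 := by
    have key : ∀ v : Fin n → K, (∑ i, C (v i) * X i : MvPolynomial (Fin n) K).totalDegree ≤ 1 := fun v =>
      totalDegree_finsetSum_le fun i _ => (totalDegree_mul _ _).trans (by simp)
    rintro (_ | j)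
    · exact key _
    · exact key _
  have hgg : ∀ v : Fin n → K, grad p (∑ i, C (v i) * X i : MvPolynomial (Fin n) K) = v := by
    intro v
    ext i
    simp [grad_apply, Derivation.leibniz, pderiv_X, Pi.single_apply]
  have hcomp : ∀ h : MvPolynomial (Option (Fin d)) K,
      aeval (cx V) (aeval g h) = aeval (oe (lin (cx V) M) t) h := by
    intro h
    rw [← AlgHom.comp_apply, comp_aeval, ← funext hgc]
  have hpt : ∀ h : MvPolynomial (Option (Fin d)) K, eval p (aeval g h) =
      eval (oe (fun j => ch hp (lin (cx V) M j)) (ch hp t)) h := by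
    intro h
    rw [← ch_aeval hp, hcomp, char_eval, ← oe_comp]
  have hI : aeval g f ∈ idD V (geomDegree V) := by
    rw [mem_idD, ← aeval_cx_eq_zero]
    refine ⟨?_, (totalDegree_aeval_le g hgd f).trans hfD⟩
    rw [hcomp]; exact hf0
  have hch := chain p g f
  rw [Fintype.sum_option] at hch
  have hgn : grad p (g none) = u := hgg u
  have hgs : ∀ j, grad p (g (some j)) = M.row j := fun j => hgg (M j)
  rw [hgn, hpt] at hch
  simp only [hgs] at hch
  have hmem : eval (oe (fun j => ch hp (lin (cx V) M j)) (ch hp t)) (pderiv none f) • u ∈ W := by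
    rw [← sub_eq_iff_eq_add] at hch
    rw [← hch]
    refine Submodule.sub_mem _ (Submodule.mem_sup_left ⟨_, hI, rfl⟩) (Submodule.mem_sup_right ?_)
    exact Submodule.sum_mem _ fun j _ => Submodule.smul_mem _ _ (Submodule.subset_span ⟨j, rfl⟩)
  exact (Submodule.smul_mem_iff _ hne).1 hmem

end TB

namespace TB

lemma grad_mul {K : Type*} [Field K] {σ : Type*} (p : σ → K) (f g : MvPolynomial σ K) :
    grad p (f * g) = eval p f • grad p g + eval p g • grad p f := by
  ext i; simp [grad_apply, Derivation.leibniz]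

lemma grad_X {K : Type*} [Field K] {σ : Type*} [DecidableEq σ] (p : σ → K) (i : σ) :
    grad p (X i : MvPolynomial σ K) = Pi.single i 1 := by
  ext j; simp [grad_apply, pderiv_X, Pi.single_apply, eq_comm]

/-- first lift -/
noncomputable def lf {K : Type} [Field K] {n : ℕ} (f : MvPolynomial (Fin n) K) : MvPolynomial (Fin (n + n)) K :=
  rename (Fin.castAdd n) f

/-- derivative lift -/
noncomputable def ldf {K : Type} [Field K] {n : ℕ} (f : MvPolynomial (Fin n) K) : MvPolynomial (Fin (n + n)) K :=
  ∑ j, lf (pderiv j f) * X (Fin.natAdd n j)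

lemma eval_lf {K : Type} [Field K] {n : ℕ} (z : Fin (n + n) → K) (f : MvPolynomial (Fin n) K) :
    eval z (lf f) = eval (fstProj z) f := by
  rw [lf, eval_rename]; rfl

lemma eval_ldf {K : Type} [Field K] {n : ℕ} (z : Fin (n + n) → K) (f : MvPolynomial (Fin n) K) :
    eval z (ldf f) = grad (fstProj z) f ⬝ᵥ sndProj z := by
  simp only [ldf, map_sum, map_mul, eval_lf, eval_X]; rfl

lemma lf_eq {K : Type} [Field K] {n : ℕ} (f : MvPolynomial (Fin n) K) :
    lf f = aeval (fun i => X (Fin.castAdd n i)) f := by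
  have : rename (R := K) (Fin.castAdd n : Fin n → _) = aeval (fun i : Fin n => X (Fin.castAdd n i)) := by
    ext i; simp
  exact DFunLike.congr_fun this f

lemma grad_lf {K : Type} [Field K] {n : ℕ} (z w : Fin (n + n) → K) (f : MvPolynomial (Fin n) K) :
    grad z (lf f) ⬝ᵥ w = grad (fstProj z) f ⬝ᵥ fstProj w := by
  have : lf f = aeval (fun i => X (Fin.castAdd n i)) f := lf_eq f
  rw [this, chain, sum_dotProduct]
  refine Finset.sum_congr rfl fun i _ => ?_
  rw [smul_dotProduct, grad_X, single_dotProduct, one_mul]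
  have : lf (pderiv i f) = aeval (fun i => X (Fin.castAdd n i)) (pderiv i f) := lf_eq _
  rw [← this, eval_lf]; rfl

lemma grad_ldf {K : Type} [Field K] {n : ℕ} (z w : Fin (n + n) → K) (hw : fstProj w = 0)
    (f : MvPolynomial (Fin n) K) :
    grad z (ldf f) ⬝ᵥ w = grad (fstProj z) f ⬝ᵥ sndProj w := by
  rw [ldf, map_sum, sum_dotProduct]
  refine Finset.sum_congr rfl fun i _ => ?_
  rw [grad_mul, add_dotProduct, smul_dotProduct, smul_dotProduct, grad_lf, hw, dotProduct_zero, grad_X,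
    single_dotProduct, one_mul, eval_lf, smul_zero, add_zero]
  rfl

lemma mem_TB {K : Type} [Field K] {n : ℕ} (V : Set (Fin n → K)) (z : Fin (n + n) → K) :
    z ∈ tangentBundle V ↔ fstProj z ∈ V ∧ sndProj z ∈ tsub V (fstProj z) := Iff.rfl

lemma lf_mem {K : Type} [Field K] {n : ℕ} {V : Set (Fin n → K)} {f : MvPolynomial (Fin n) K}
    (hf : f ∈ vanishingIdeal K V) : lf f ∈ vanishingIdeal K (tangentBundle V) := by
  intro z hz
  have : eval z (lf f) = 0 := by rw [eval_lf]; exact hf _ hz.1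
  exact this

lemma ldf_mem {K : Type} [Field K] {n : ℕ} {V : Set (Fin n → K)} {f : MvPolynomial (Fin n) K}
    (hf : f ∈ vanishingIdeal K V) : ldf f ∈ vanishingIdeal K (tangentBundle V) := by
  intro z hz
  have : eval z (ldf f) = 0 := by rw [eval_ldf]; exact hz.2 f hf
  exact this

lemma algebraic_TB {K : Type} [Field K] {n : ℕ} {V : Set (Fin n → K)} (hV : IsAlgebraicSet V) :
    IsAlgebraicSet (tangentBundle V) := by
  obtain ⟨I, hI⟩ := hV
  refine ⟨vanishingIdeal K (tangentBundle V), Set.Subset.antisymm (fun z hz f hf => hf z hz) fun z hz => ?_⟩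
  refine ⟨?_, fun f hf => ?_⟩
  · rw [hI]
    intro f hf
    have h1 : eval z (lf f) = 0 := hz _ (lf_mem (by
      rw [hI]; intro x hx; exact hx f hf))
    rw [eval_lf] at h1; exact h1
  · have h1 : eval z (ldf f) = 0 := hz _ (ldf_mem hf)
    rw [eval_ldf] at h1; exact h1

lemma finrank_tsub_TB {K : Type} [Field K] {n d : ℕ} {V : Set (Fin n → K)} (h2 : IsSmoothVariety V)
    (hd : varDim V = d) {z : Fin (n + n) → K} (hz : z ∈ tangentBundle V) :
    Module.finrank K (tsub (tangentBundle V) z) ≤ d + d := by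
  have hT : Module.finrank K (tsub V (fstProj z)) = d := by rw [finrank_tsub, h2 _ hz.1, hd]
  let π : tsub (tangentBundle V) z →ₗ[K] (Fin n → K) :=
    { toFun := fun w => fstProj w.1
      map_add' := fun _ _ => rfl
      map_smul' := fun _ _ => rfl }
  have hr : LinearMap.range π ≤ tsub V (fstProj z) := by
    rintro _ ⟨w, rfl⟩
    rw [mem_tsub]
    intro f hf
    change grad (fstProj z) f ⬝ᵥ fstProj w.1 = 0
    rw [← grad_lf]
    exact w.2 _ (lf_mem hf)
  let ρ : LinearMap.ker π →ₗ[K] tsub V (fstProj z) :=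
    { toFun := fun w => ⟨sndProj w.1.1, by
        rw [mem_tsub]
        intro f hf
        rw [← grad_ldf _ _ (show fstProj w.1.1 = 0 from w.2)]
        exact w.1.2 _ (ldf_mem hf)⟩
      map_add' := fun _ _ => rfl
      map_smul' := fun _ _ => rfl }
  have hρ : Function.Injective ρ := by
    rw [injective_iff_map_eq_zero]
    intro w hw
    have hw1 : fstProj w.1.1 = 0 := w.2
    have hw2 : sndProj w.1.1 = 0 := congrArg Subtype.val hw
    ext i
    refine Fin.addCases (fun i => ?_) (fun i => ?_) i
    · exact congrFun hw1 i
    · exact congrFun hw2 i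
  have e1 := LinearMap.finrank_range_add_finrank_ker π
  have e2 := Submodule.finrank_mono hr
  have e3 := LinearMap.finrank_le_finrank_of_injective hρ
  omega

lemma mem_min_of_nak {A : Type*} [CommRing A] [IsNoetherianRing A] (m : Ideal A) (hm : m.IsPrime) (s : Set A)
    (hs : Ideal.span s ≤ m) (h : m ≤ Ideal.span s ⊔ m * m) : m ∈ (Ideal.span s).minimalPrimes := by
  refine ⟨⟨hm, hs⟩, ?_⟩
  rintro q ⟨hq, hsq⟩ hqm
  have hle : m.map (Ideal.Quotient.mk q) ≤ (m.map (Ideal.Quotient.mk q)) • m.map (Ideal.Quotient.mk q) := by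
    rw [smul_eq_mul, ← Ideal.map_mul]
    refine (Ideal.map_mono h).trans ?_
    rw [Ideal.map_sup]
    refine sup_le ((Ideal.map_mono hsq).trans ?_) le_rfl
    rw [Ideal.map_quotient_self]; exact bot_le
  obtain ⟨r, hr1, hr⟩ := Submodule.exists_sub_one_mem_and_smul_eq_zero_of_fg_of_le_smul _ _
    (IsNoetherian.noetherian _) hle
  obtain ⟨r, rfl⟩ := Ideal.Quotient.mk_surjective r
  have hrm : r - 1 ∈ m := by
    rw [← map_one (Ideal.Quotient.mk q), ← map_sub] at hr1
    obtain ⟨z, hz, hz'⟩ := (Ideal.mem_map_iff_of_surjective _ Ideal.Quotient.mk_surjective).1 hr1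
    rw [Ideal.Quotient.eq] at hz'
    have := m.sub_mem hz (hqm hz')
    simpa using this
  have hrq : r ∉ q := by
    intro h
    have h3 := m.sub_mem (hqm h) hrm
    rw [sub_sub_cancel] at h3
    exact hm.ne_top ((Ideal.eq_top_iff_one _).2 h3)
  intro a ha
  have := hr _ (Ideal.mem_map_of_mem _ ha)
  rw [smul_eq_mul, ← map_mul, Ideal.Quotient.eq_zero_iff_mem] at this
  exact (hq.mem_or_mem this).resolve_left hrq

lemma varDim_TB_le {K : Type} [Field K] [IsAlgClosed K] {n d : ℕ} {V : Set (Fin n → K)} (hV : IsAlgebraicSet V)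
    (h2 : IsSmoothVariety V) (hd : varDim V = d) : varDim (tangentBundle V) ≤ d + d := by
  classical
  have hdim : ringKrullDim (CR (tangentBundle V)) ≤ ((d + d : ℕ) : ℕ∞) := by
    rw [ringKrullDim_le_iff_isMaximal_height_le]
    intro Q hQ
    obtain ⟨ψ, rfl⟩ := exists_char (K := K) Q hQ
    rw [eq_ch (algebraic_TB hV) ψ]
    set hz := char_mem (algebraic_TB hV) ψ
    set z : Fin (n + n) → K := fun i => ψ (cx _ i)
    have hfr := finrank_tsub_TB h2 hd hz
    obtain ⟨g, hg⟩ := (_root_.finrank_le_iff_exists_linearMap (R := K) (M := tsub (tangentBundle V) z)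
      (M' := Fin (d + d) → K)).1 (by simpa using hfr)
    obtain ⟨G, hG⟩ := LinearMap.exists_extend g
    have hGM := ker_le_sup hz (LinearMap.toMatrix' G) (by
      intro w hw h0
      rw [LinearMap.toMatrix'_mulVec] at h0
      have : g ⟨w, hw⟩ = 0 := by rw [← hG]; exact h0
      exact congrArg Subtype.val (hg (by rw [this, map_zero] : g ⟨w, hw⟩ = g 0)))
    set m := RingHom.ker (ch hz)
    set s := Set.range fun j => lin (cx _) (LinearMap.toMatrix' G) j -
      algebraMap K (CR (tangentBundle V)) (ch hz (lin (cx _) (LinearMap.toMatrix' G) j))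
    have hmin : m ∈ (Ideal.span s).minimalPrimes :=
      mem_min_of_nak m (RingHom.ker_isPrime _) s (Ideal.span_le.2 (by
        rintro _ ⟨j, rfl⟩; exact mem_ker_sub _ _)) hGM
    refine WithBot.coe_le_coe.2 ?_
    refine (Ideal.height_le_card_of_mem_minimalPrimes_span (Set.finite_range _) hmin).trans ?_
    have := Finset.card_image_le (s := Finset.univ) (f := fun j => lin (cx _) (LinearMap.toMatrix' G) j -
      algebraMap K (CR (tangentBundle V)) (ch hz (lin (cx _) (LinearMap.toMatrix' G) j)))
    rw [Finset.card_univ, Fintype.card_fin, ← Set.ncard_coe_finset, Finset.coe_image, Finset.coe_univ, Set.image_univ] at this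
    exact_mod_cast this
  rw [varDim]
  generalize ringKrullDim (MvPolynomial (Fin (n + n)) K ⧸ vanishingIdeal K (tangentBundle V)) = t at hdim
  induction t with
  | bot => simp
  | coe t => exact ENat.toNat_le_of_le_natCast (WithBot.coe_le_coe.1 hdim)

end TB

namespace TB

lemma det_deg {K : Type*} [Field K] {σ : Type*} {n : ℕ} (N : Matrix (Fin n) (Fin n) (MvPolynomial σ K))
    (a : Fin n → ℕ) (h : ∀ r j, (N r j).totalDegree ≤ a r) : N.det.totalDegree ≤ ∑ r, a r := by
  rw [← Matrix.det_transpose, Matrix.det_apply]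
  refine totalDegree_finsetSum_le fun τ _ => ?_
  refine (totalDegree_smul_le _ _).trans ?_
  refine (totalDegree_finsetProd _ _).trans (Finset.sum_le_sum fun i _ => ?_)
  exact h _ _

lemma adj_deg {K : Type*} [Field K] {σ : Type*} {n : ℕ} (N : Matrix (Fin n) (Fin n) (MvPolynomial σ K))
    (a : Fin n → ℕ) (h : ∀ r j, (N r j).totalDegree ≤ a r) (i r : Fin n) :
    (N.adjugate i r).totalDegree ≤ ∑ r, a r := by
  rw [Matrix.adjugate_apply]
  refine det_deg _ _ fun r' j => ?_
  by_cases hr : r' = r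
  · subst hr
    rw [Matrix.updateRow_self]
    by_cases hj : j = i
    · subst hj; simp
    · rw [Pi.single_eq_of_ne hj]; simp
  · rw [Matrix.updateRow_ne hr]; exact h _ _

lemma eval_adj {K : Type*} [Field K] {σ : Type*} {n : ℕ} (N : Matrix (Fin n) (Fin n) (MvPolynomial σ K))
    (x : σ → K) : ((eval x).mapMatrix N).adjugate = (eval x).mapMatrix N.adjugate :=
  ((eval x).map_adjugate N).symm

lemma core2 {K : Type} [Field K] [IsAlgClosed K] [CharZero K] {n d : ℕ} {V : Set (Fin n → K)}
    (h1 : IsIrreducibleVariety V) (hd : varDim V = d)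
    (N : Matrix (Fin n) (Fin n) (MvPolynomial (Fin n) K)) (R : Fin n → MvPolynomial (Fin n) K)
    (a : Fin n → ℕ) (hN : ∀ r j, (N r j).totalDegree ≤ a r) (hR : ∀ r, (R r).totalDegree ≤ 1)
    (A2 B2 : Matrix (Fin d) (Fin n) K) (c2 : Fin d → K)
    (Z : Finset ((Fin n → K) × (Fin n → K)))
    (hZ : ∀ x y, (x, y) ∈ Z ↔ x ∈ V ∧ eval x N.det ≠ 0 ∧
      (∀ r, ∑ j, eval x (N r j) * y j = eval x (R r)) ∧ ∀ k, A2 k ⬝ᵥ x + B2 k ⬝ᵥ y = c2 k) :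
    Z.card ≤ geomDegree V * (∑ r, a r + 1) ^ d := by
  classical
  have := h1.2
  obtain ⟨-, -, M, -, -, -, hht, -, ⟨θ, s, c, hs, hpack⟩, -⟩ := exists_norm h1 hd ⊥ (by simp)
  let F : Fin d → MvPolynomial (Fin n) K := fun k =>
    N.det * affForm (A2 k) (c2 k) + ∑ j, C (B2 k j) * ∑ r, N.adjugate j r * R r
  have hF : ∀ x k, eval x (F k) = eval x N.det * (A2 k ⬝ᵥ x - c2 k) +
      B2 k ⬝ᵥ (((eval x).mapMatrix N).adjugate.mulVec fun r => eval x (R r)) := by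
    intro x k
    rw [eval_adj]
    simp [F, eval_affForm, dotProduct, Matrix.mulVec]
  have hdet : ∀ x, ((eval x).mapMatrix N).det = eval x N.det := fun x => ((eval x).map_det N).symm
  have hsol : ∀ x y, (∀ r, ∑ j, eval x (N r j) * y j = eval x (R r)) ↔
      ((eval x).mapMatrix N).mulVec y = fun r => eval x (R r) := by
    intro x y
    rw [funext_iff]; rfl
  have hsol2 : ∀ x y, (∀ r, ∑ j, eval x (N r j) * y j = eval x (R r)) →
      ((eval x).mapMatrix N).adjugate.mulVec (fun r => eval x (R r)) = eval x N.det • y := by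
    intro x y h
    rw [← (hsol x y).1 h, Matrix.mulVec_mulVec, Matrix.adjugate_mul, hdet, Matrix.smul_mulVec, Matrix.one_mulVec]
  let S : Finset (CR V →ₐ[K] K) := Z.attach.image fun p => ch (((hZ p.1.1 p.1.2).1 p.2).1)
  have hcard : S.card = Z.card := by
    rw [Finset.card_image_of_injective, Finset.card_attach]
    rintro ⟨⟨x, y⟩, hp⟩ ⟨⟨x', y'⟩, hp'⟩ hpq
    have hx : x = x' := by
      ext i
      have := congrArg (fun χ => χ (cx V i)) hpq
      simpa [ch_cx] using this
    subst hx
    have h3 := (hZ _ _).1 hp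
    have h4 := (hZ _ _).1 hp'
    have : eval x N.det • y = eval x N.det • y' := by
      rw [← hsol2 x y h3.2.2.1, ← hsol2 x y' h4.2.2.1]
    have := smul_right_injective _ h3.2.1 this
    subst this; rfl
  have hb := bezout (cx V) (cx_surj V) (lin (cx V) M) _ θ s hs c hpack F (fun _ => ∑ r, a r + 1)
    (fun _ => by omega) ?_ S ?_ ?_
  · rw [← hcard]; simpa using hb
  · intro k
    refine (totalDegree_add _ _).trans (max_le ?_ ?_)
    · exact (totalDegree_mul _ _).trans (add_le_add (det_deg N a hN) (affForm_deg _ _))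
    · refine totalDegree_finsetSum_le fun j _ => ?_
      refine (totalDegree_mul _ _).trans ?_
      rw [totalDegree_C, zero_add]
      refine totalDegree_finsetSum_le fun r _ => ?_
      exact (totalDegree_mul _ _).trans (add_le_add (adj_deg N a hN _ _) (hR _))
  · intro χ _
    rw [Fintype.card_fin]
    exact hht _ (RingHom.ker_isMaximal_of_surjective _ (fun c => ⟨algebraMap K _ c, by simp⟩))
  · intro χ hχ
    obtain ⟨⟨⟨x, y⟩, hp⟩, -, rfl⟩ := Finset.mem_image.1 hχ
    obtain ⟨hx, hx1, hx2, hx3⟩ := (hZ _ _).1 hp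
    refine iso_min _ _ ?_ (aeval (cx V) N.det) (by rw [ch_aeval]; exact hx1) S fun ψ hψ hψ1 => ?_
    · rw [Ideal.span_le, Set.range_subset_iff]
      intro k
      rw [SetLike.mem_coe, RingHom.mem_ker, ch_aeval]
      change eval x (F k) = 0
      rw [hF, hsol2 x y hx2, dotProduct_smul, ← hx3 k, smul_eq_mul]; ring
    · rw [char_eval] at hψ1
      set x' := fun i => ψ (cx V i) with hx'
      let y' := (eval x' N.det)⁻¹ • ((eval x').mapMatrix N).adjugate.mulVec fun r => eval x' (R r)
      have hmem : (x', y') ∈ Z := by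
        refine (hZ _ _).2 ⟨char_mem h1.1 ψ, hψ1, ?_, fun k => ?_⟩
        · rw [hsol, Matrix.mulVec_smul, Matrix.mulVec_mulVec, Matrix.mul_adjugate, hdet, Matrix.smul_mulVec,
            Matrix.one_mulVec, smul_smul, inv_mul_cancel₀ hψ1, one_smul]
        · have h5 : ψ (aeval (cx V) (F k)) = 0 := hψ (Ideal.subset_span ⟨k, rfl⟩)
          rw [char_eval, hF] at h5
          have h6 : B2 k ⬝ᵥ y' = (eval x' N.det)⁻¹ * (B2 k ⬝ᵥ (((eval x').mapMatrix N).adjugate.mulVec fun r => eval x' (R r))) := by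
            rw [dotProduct_smul, smul_eq_mul]
          rw [h6]
          have h7 : B2 k ⬝ᵥ (((eval x').mapMatrix N).adjugate.mulVec fun r => eval x' (R r)) =
            - (eval x' N.det * (A2 k ⬝ᵥ x' - c2 k)) := by linear_combination h5
          rw [h7]; field_simp; ring
      exact Finset.mem_image.2 ⟨⟨_, hmem⟩, Finset.mem_attach _ _, (eq_ch h1.1 ψ).symm⟩

end TB

namespace TB

lemma core1' {K : Type} [Field K] [IsAlgClosed K] {n d δ : ℕ} {V : Set (Fin n → K)}
    {A : Type} [CommRing A] [IsDomain A] [IsNoetherianRing A] [Algebra K A] [Algebra.FiniteType K A] [IsJacobsonRing A]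
    (x0 : Fin n → A) (hx0 : Function.Surjective (aeval x0 : MvPolynomial (Fin n) K →ₐ[K] A))
    (hV : ∀ ψ : A →ₐ[K] K, (fun i => ψ (x0 i)) ∈ V)
    (ch0 : ∀ {x : Fin n → K}, x ∈ V → (A →ₐ[K] K)) (hch0 : ∀ {x : Fin n → K} (hx : x ∈ V) i, ch0 hx (x0 i) = x i)
    (hht : ∀ Q : Ideal A, Q.IsMaximal → (d : ℕ∞) ≤ Q.height)
    (l0 : Fin d → A) (θ : Fin δ → A) (s : A) (c : ℕ) (hs : s ≠ 0)
    (hpack : ∀ α : Fin n →₀ ℕ, ∃ b : Fin δ → MvPolynomial (Fin d) K,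
        (∀ j, (b j).totalDegree ≤ (α.sum fun _ e => e) + c) ∧
        s * aeval x0 (monomial α (1:K)) = ∑ j, aeval l0 (b j) * θ j)
    (N : Matrix (Fin n) (Fin n) (MvPolynomial (Fin n) K)) (R : Fin n → MvPolynomial (Fin n) K)
    (a : Fin n → ℕ) (hN : ∀ r j, (N r j).totalDegree ≤ a r) (hR : ∀ r, (R r).totalDegree ≤ 1)
    (A2 B2 : Matrix (Fin d) (Fin n) K) (c2 : Fin d → K)
    (Z : Finset ((Fin n → K) × (Fin n → K)))
    (hZ : ∀ x y, (x, y) ∈ Z ↔ x ∈ V ∧ eval x N.det ≠ 0 ∧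
      (∀ r, ∑ j, eval x (N r j) * y j = eval x (R r)) ∧ ∀ k, A2 k ⬝ᵥ x + B2 k ⬝ᵥ y = c2 k) :
    Z.card ≤ δ * ∏ r, (a r + 1) := by
  classical
  let Ca : A →ₐ[K] MvPolynomial (Fin n) (A) := IsScalarTower.toAlgHom K (A) _
  have hCa : ∀ t, Ca t = C t := fun _ => rfl
  let x' : Fin n ⊕ Fin n → MvPolynomial (Fin n) (A) := Sum.elim (fun i => Ca (x0 i)) X
  let l' : Fin d ⊕ Fin n → MvPolynomial (Fin n) (A) := Sum.elim (fun i => Ca (l0 i)) X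
  have hxl : ∀ f : MvPolynomial (Fin n) K, aeval x' (rename Sum.inl f) = Ca (aeval x0 f) := by
    intro f
    rw [aeval_rename]; exact (comp_aeval_apply _ _ _).symm
  have hll : ∀ f : MvPolynomial (Fin d) K, aeval l' (rename Sum.inl f) = Ca (aeval l0 f) := by
    intro f
    rw [aeval_rename]; exact (comp_aeval_apply _ _ _).symm
  have hsurj : Function.Surjective (aeval x' : MvPolynomial (Fin n ⊕ Fin n) K →ₐ[K] MvPolynomial (Fin n) (A)) := by
    intro g
    induction g using MvPolynomial.induction_on with
    | C t =>
      obtain ⟨f, rfl⟩ := hx0 t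
      exact ⟨_, hxl f⟩
    | add p q hp hq =>
      obtain ⟨p, rfl⟩ := hp
      obtain ⟨q, rfl⟩ := hq
      exact ⟨p + q, map_add _ _ _⟩
    | mul_X p i hp =>
      obtain ⟨p, rfl⟩ := hp
      exact ⟨p * X (Sum.inr i), by rw [map_mul, aeval_X]; rfl⟩
  let F : Fin d ⊕ Fin n → MvPolynomial (Fin n ⊕ Fin n) K :=
    Sum.elim (fun k => affForm (Sum.elim (A2 k) (B2 k)) (c2 k))
      (fun r => ∑ j, rename Sum.inl (N r j) * X (Sum.inr j) - rename Sum.inl (R r))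
  have hF1 : ∀ x y k, eval (Sum.elim x y) (F (Sum.inl k)) = A2 k ⬝ᵥ x + B2 k ⬝ᵥ y - c2 k := by
    intro x y k
    simp [F, eval_affForm, dotProduct]
  have hF2 : ∀ x y r, eval (Sum.elim x y) (F (Sum.inr r)) = ∑ j, eval x (N r j) * y j - eval x (R r) := by
    intro x y k
    simp [F, eval_rename]
  let cha : ∀ {x : Fin n → K} (hx : x ∈ V) (y : Fin n → K), MvPolynomial (Fin n) (A) →ₐ[K] K :=
    fun hx y => aevalTower (ch0 hx) y
  have hcha : ∀ {x : Fin n → K} (hx : x ∈ V) (y : Fin n → K), (fun i => cha hx y (x' i)) = Sum.elim x y := by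
    intro x hx y
    ext i
    rcases i with i | i
    · simp [cha, x', hCa, hch0]
    · simp [cha, x']
  let S : Finset (MvPolynomial (Fin n) (A) →ₐ[K] K) :=
    Z.attach.image fun p => cha (((hZ p.1.1 p.1.2).1 p.2).1) p.1.2
  have hcard : S.card = Z.card := by
    rw [Finset.card_image_of_injective, Finset.card_attach]
    rintro ⟨⟨x, y⟩, hp⟩ ⟨⟨z, w⟩, hp'⟩ hpq
    have h3 := hcha ((hZ _ _).1 hp).1 y
    have h4 := hcha ((hZ _ _).1 hp').1 w
    have h5 : Sum.elim x y = Sum.elim z w := by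
      rw [← h3, ← h4]
      ext i
      exact congrArg (fun χ => χ (x' i)) hpq
    have hx : x = z := by ext i; exact congrFun h5 (Sum.inl i)
    have hy : y = w := by ext i; exact congrFun h5 (Sum.inr i)
    subst hx; subst hy; rfl
  have hpack' : ∀ α : Fin n ⊕ Fin n →₀ ℕ, ∃ b : Fin (δ) → MvPolynomial (Fin d ⊕ Fin n) K,
        (∀ j, (b j).totalDegree ≤ (α.sum fun _ e => e) + c) ∧
        Ca s * aeval x' (monomial α (1:K)) = ∑ j, aeval l' (b j) * Ca (θ j) := by
    intro α
    let α1 : Fin n →₀ ℕ := Finsupp.equivFunOnFinite.symm fun i => α (Sum.inl i)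
    obtain ⟨b, hb1, hb2⟩ := hpack α1
    let m2 : MvPolynomial (Fin d ⊕ Fin n) K := ∏ i, X (Sum.inr i) ^ α (Sum.inr i)
    have hm2 : m2.totalDegree ≤ ∑ i, α (Sum.inr i) := by
      refine (totalDegree_finsetProd _ _).trans (Finset.sum_le_sum fun i _ => ?_)
      rw [totalDegree_X_pow]
    have hα : (α.sum fun _ e => e) = (α1.sum fun _ e => e) + ∑ i, α (Sum.inr i) := by
      rw [Finsupp.sum_fintype _ _ (by simp), Finsupp.sum_fintype _ _ (by simp), Fintype.sum_sum_type]
      rfl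
    have hmon : aeval x' (monomial α (1:K)) = Ca (aeval x0 (monomial α1 (1:K))) * aeval l' m2 := by
      rw [aeval_monomial, aeval_monomial, Finsupp.prod_fintype _ _ (by simp),
        Finsupp.prod_fintype _ _ (by simp), Fintype.prod_sum_type, map_one, map_one, one_mul, one_mul, map_prod, map_prod]
      congr 1
      · refine Finset.prod_congr rfl fun i _ => ?_
        rw [map_pow]; rfl
      · refine Finset.prod_congr rfl fun i _ => ?_
        rw [map_pow, aeval_X]; rfl
    refine ⟨fun j => rename Sum.inl (b j) * m2, fun j => ?_, ?_⟩
    · refine (totalDegree_mul _ _).trans ?_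
      have := (totalDegree_rename_le Sum.inl (b j) : (rename (Sum.inl : _ → Fin d ⊕ Fin n) (b j)).totalDegree ≤ _)
      have := hb1 j
      omega
    · rw [hmon, ← mul_assoc, ← map_mul, hb2, map_sum, Finset.sum_mul]
      refine Finset.sum_congr rfl fun j _ => ?_
      rw [map_mul, map_mul, hll]; ring
  have hs' : Ca s ≠ 0 := by
    rw [hCa]; simpa using hs
  have hb := bezout x' hsurj l' _ (fun j => Ca (θ j)) (Ca s) hs' c hpack' F
    (Sum.elim (fun _ => 1) fun r => a r + 1) (by rintro (k | r) <;> simp) ?_ S ?_ ?_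
  · rw [← hcard]; simpa [Fintype.prod_sum_type] using hb
  · rintro (k | r)
    · exact affForm_deg _ _
    · change totalDegree (∑ j, rename Sum.inl (N r j) * X (Sum.inr j) - rename Sum.inl (R r)) ≤ a r + 1
      refine (totalDegree_sub _ _).trans (max_le ?_ ?_)
      · refine totalDegree_finsetSum_le fun j _ => ?_
        refine (totalDegree_mul _ _).trans ?_
        rw [totalDegree_X]
        exact Nat.add_le_add_right ((totalDegree_rename_le _ _).trans (hN _ _)) 1
      · refine (totalDegree_rename_le _ _).trans ((hR r).trans (by omega))
  · intro χ _
    rw [Fintype.card_sum, Fintype.card_fin, Fintype.card_fin, Nat.cast_add]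
    exact height_maximal_mvPolynomial n (d : ℕ∞) hht (RingHom.ker χ)
      (RingHom.ker_isMaximal_of_surjective _ (fun c => ⟨algebraMap K _ c, AlgHom.commutes χ c⟩))
  · intro χ hχ
    obtain ⟨⟨⟨x, y⟩, hp⟩, -, rfl⟩ := Finset.mem_image.1 hχ
    obtain ⟨hx, hx1, hx2, hx3⟩ := (hZ _ _).1 hp
    refine iso_min _ _ ?_ (aeval x' (rename Sum.inl N.det)) ?_ S fun ψ hψ hψ1 => ?_
    · rw [Ideal.span_le, Set.range_subset_iff]
      intro k
      rw [SetLike.mem_coe, RingHom.mem_ker, char_eval]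
      simp only [hcha]
      rcases k with k | r
      · rw [hF1, hx3, sub_self]
      · rw [hF2, hx2, sub_self]
    · rw [char_eval]
      simp only [hcha]
      rw [eval_rename]
      exact hx1
    · let z : Fin n → K := fun i => ψ (Ca (x0 i))
      let w : Fin n → K := fun i => ψ (X i)
      have hzw : (fun i => ψ (x' i)) = Sum.elim z w := by
        ext i; rcases i with i | i <;> rfl
      rw [char_eval, hzw, eval_rename] at hψ1
      have hmem : (z, w) ∈ Z := by
        refine (hZ _ _).2 ⟨hV (ψ.comp Ca), hψ1, fun r => ?_, fun k => ?_⟩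
        · have h5 : ψ (aeval x' (F (Sum.inr r))) = 0 := hψ (Ideal.subset_span ⟨_, rfl⟩)
          rw [char_eval, hzw, hF2] at h5
          exact sub_eq_zero.1 h5
        · have h5 : ψ (aeval x' (F (Sum.inl k))) = 0 := hψ (Ideal.subset_span ⟨_, rfl⟩)
          rw [char_eval, hzw, hF1] at h5
          exact sub_eq_zero.1 h5
      refine Finset.mem_image.2 ⟨⟨_, hmem⟩, Finset.mem_attach _ _, ?_⟩
      refine char_ext x' hsurj fun i => ?_
      have h6 := congrFun (hcha ((hZ _ _).1 hmem).1 w) i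
      rw [← hzw] at h6
      exact h6

lemma core1 {K : Type} [Field K] [IsAlgClosed K] [CharZero K] {n d : ℕ} {V : Set (Fin n → K)}
    (h1 : IsIrreducibleVariety V) (hd : varDim V = d)
    (N : Matrix (Fin n) (Fin n) (MvPolynomial (Fin n) K)) (R : Fin n → MvPolynomial (Fin n) K)
    (a : Fin n → ℕ) (hN : ∀ r j, (N r j).totalDegree ≤ a r) (hR : ∀ r, (R r).totalDegree ≤ 1)
    (A2 B2 : Matrix (Fin d) (Fin n) K) (c2 : Fin d → K)
    (Z : Finset ((Fin n → K) × (Fin n → K)))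
    (hZ : ∀ x y, (x, y) ∈ Z ↔ x ∈ V ∧ eval x N.det ≠ 0 ∧
      (∀ r, ∑ j, eval x (N r j) * y j = eval x (R r)) ∧ ∀ k, A2 k ⬝ᵥ x + B2 k ⬝ᵥ y = c2 k) :
    Z.card ≤ geomDegree V * ∏ r, (a r + 1) := by
  have := h1.2
  obtain ⟨-, -, M, -, -, -, hht, -, ⟨θ, s, c, hs, hpack⟩, -⟩ := exists_norm h1 hd ⊥ (by simp)
  have : IsJacobsonRing (CR V) := isJacobsonRing_of_surjective ⟨_, Ideal.Quotient.mk_surjective⟩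
  exact core1' (cx V) (cx_surj V) (char_mem h1.1) ch ch_cx hht (lin (cx V) M) θ s c hs hpack N R a hN hR A2 B2 c2 Z hZ

end TB

namespace TB

lemma exists_gen {K E ι : Type*} [Field K] [Infinite K] [AddCommGroup E] [Module K E] [Finite ι]
    {F : ι → Type*} [∀ i, AddCommGroup (F i)] [∀ i, Module K (F i)] [∀ i, FiniteDimensional K (F i)]
    (φ : ∀ i, E →ₗ[K] F i) (m : ℕ) (hm : ∀ i, m ≤ Module.finrank K (LinearMap.range (φ i))) :
    ∃ e : Fin m → E, ∀ i, LinearIndependent K (fun k => φ i (e k)) := by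
  suffices H : ∀ k ≤ m, ∃ e : Fin k → E, ∀ i, LinearIndependent K (fun k => φ i (e k)) from H m le_rfl
  intro k
  induction k with
  | zero => exact fun _ => ⟨Fin.elim0, fun i => linearIndependent_empty_type⟩
  | succ k ih =>
    intro hk
    obtain ⟨e, he⟩ := ih (by omega)
    obtain ⟨u, hu⟩ := exists_avoid (fun i => (Submodule.span K (Set.range fun k => φ i (e k))).comap (φ i)) (by
      intro i htop
      have h1 : LinearMap.range (φ i) ≤ Submodule.span K (Set.range fun k => φ i (e k)) := by
        rintro _ ⟨v, rfl⟩
        have : v ∈ (Submodule.span K (Set.range fun k => φ i (e k))).comap (φ i) := by rw [htop]; trivial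
        exact this
      have h2 := Submodule.finrank_mono h1
      have h3 := finrank_range_le_card (R := K) fun k => φ i (e k)
      rw [Fintype.card_fin, Set.finrank] at h3
      have := hm i
      omega)
    refine ⟨Fin.snoc e u, fun i => ?_⟩
    have : (fun k' => φ i ((Fin.snoc e u : Fin (k+1) → E) k')) = Fin.snoc (fun k => φ i (e k)) (φ i u) := by
      ext k'
      refine Fin.lastCases ?_ (fun k' => ?_) k'
      · simp
      · simp
    rw [this, linearIndependent_finSnoc]
    exact ⟨he i, hu i⟩

lemma pderiv_deg {K σ : Type*} [Field K] (j : σ) (f : MvPolynomial σ K) {D : ℕ} (h : f.totalDegree ≤ D) :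
    (pderiv j f).totalDegree ≤ D - 1 := by
  classical
  have : pderiv j f = ∑ s ∈ f.support, pderiv j (monomial s (coeff s f)) := by
    rw [← map_sum, ← f.as_sum]
  rw [this]
  refine totalDegree_finsetSum_le fun s hs => ?_
  rw [pderiv_monomial]
  by_cases hj : s j = 0
  · rw [hj]; simp
  refine (totalDegree_monomial_le _ _).trans ?_
  have h1 := (le_totalDegree hs).trans h
  have h2 : (s - Finsupp.single j 1) + Finsupp.single j 1 = s := by
    ext i
    by_cases hi : i = j
    · subst hi; simp; omega
    · simp [Ne.symm hi]
  have h3 : ((s - Finsupp.single j 1) + Finsupp.single j 1).sum (fun _ e => e) =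
      (s - Finsupp.single j 1).sum (fun _ e => e) + (Finsupp.single j 1).sum (fun _ e => e) :=
    Finsupp.sum_add_index' (fun _ => rfl) (fun _ _ _ => rfl)
  rw [h2, Finsupp.sum_single_index rfl] at h3
  change (s - Finsupp.single j 1).sum (fun _ e => e) ≤ _
  omega

lemma tsub_of_indep {K : Type} [Field K] {n m d : ℕ} {V : Set (Fin n → K)} {x : Fin n → K}
    (hT : Module.finrank K (tsub V x) = d) (hn : m + d = n) (f : Fin m → MvPolynomial (Fin n) K)
    (hf : ∀ i, f i ∈ vanishingIdeal K V) (hli : LinearIndependent K fun i => grad x (f i)) (y : Fin n → K)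
    (hy : ∀ i, grad x (f i) ⬝ᵥ y = 0) : y ∈ tsub V x := by
  let G : Matrix (Fin m) (Fin n) K := fun i => grad x (f i)
  have h1 := finrank_ker_rows G hli
  have hle : tsub V x ≤ LinearMap.ker G.mulVecLin := by
    intro v hv
    rw [LinearMap.mem_ker]
    ext i
    exact hv _ (hf i)
  have := Submodule.eq_of_le_of_finrank_eq hle (by omega)
  rw [this, LinearMap.mem_ker]
  ext i
  exact hy i

lemma dot_zero_of_span {K : Type*} [Field K] {n : ℕ} {ι : Type*} (v : ι → Fin n → K)
    (hv : Submodule.span K (Set.range v) = ⊤) (u : Fin n → K) (h : ∀ i, v i ⬝ᵥ u = 0) : u = 0 := by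
  have h1 : ∀ w ∈ Submodule.span K (Set.range v), w ⬝ᵥ u = 0 := by
    intro w hw
    induction hw using Submodule.span_induction with
    | mem w hw => obtain ⟨i, rfl⟩ := hw; exact h i
    | zero => simp
    | add a b _ _ ha hb => rw [add_dotProduct, ha, hb, add_zero]
    | smul c a _ ha => rw [smul_dotProduct, ha, smul_zero]
  ext i
  have := h1 (Pi.single i 1) (by rw [hv]; trivial)
  rwa [single_dotProduct, one_mul] at this

end TB

namespace TB

lemma choose_rows {K : Type*} [Field K] [Infinite K] {ι : Type*} [Finite ι] [Nonempty ι] {n m d : ℕ}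
    (hn : m + d = n) (W : ι → Submodule K (Fin n → K)) (hW : ∀ i, Module.finrank K (W i) = m)
    (b : Matrix (Fin (d + d)) (Fin n) K) (hb : ∀ i, W i ⊔ Submodule.span K (Set.range b) = ⊤) :
    ∃ μ ν : Fin d → Fin (d + d) → K,
      (∀ i, LinearIndependent K (fun k => (W i).mkQ (Matrix.vecMul (μ k) b))) ∧
      Submodule.span K (Set.range (Sum.elim μ ν)) = ⊤ := by
  classical
  obtain ⟨μ, hμ⟩ := exists_gen (F := fun i => (Fin n → K) ⧸ W i)
    (fun i => (W i).mkQ ∘ₗ b.vecMulLinear) d (by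
      intro i
      have htop : LinearMap.range ((W i).mkQ ∘ₗ b.vecMulLinear) = ⊤ := by
        have h1 : Submodule.span K (Set.range b) = LinearMap.range b.vecMulLinear := by
          exact (range_vecMulLinear b).symm
        rw [LinearMap.range_comp, ← h1]
        have := congrArg (Submodule.map (W i).mkQ) (hb i)
        rw [Submodule.map_sup, Submodule.mkQ_map_self, bot_sup_eq, Submodule.map_top, Submodule.range_mkQ] at this
        exact this
      rw [htop, finrank_top]
      have := Submodule.finrank_quotient_add_finrank (W i)
      rw [hW, Module.finrank_fin_fun] at this
      omega)
  have hμi : LinearIndependent K μ := LinearIndependent.of_comp _ (hμ (Classical.arbitrary ι))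
  let U := Submodule.span K (Set.range μ)
  have hU : Module.finrank K U = d := by
    have := finrank_span_eq_card hμi
    simpa using this
  obtain ⟨ν, hν⟩ := exists_gen (ι := Unit) (F := fun _ => (Fin (d + d) → K) ⧸ U)
    (fun _ => U.mkQ) d (by
      intro i
      rw [Submodule.range_mkQ, finrank_top]
      have := Submodule.finrank_quotient_add_finrank U
      rw [hU, Module.finrank_fin_fun] at this
      omega)
  refine ⟨μ, ν, fun i => hμ i, ?_⟩
  have hli : LinearIndependent K (fun k => (⟨μ k, Submodule.subset_span ⟨k, rfl⟩⟩ : U)) :=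
    LinearIndependent.of_comp U.subtype hμi
  have h2 := LinearIndependent.sumElim_of_quotient hli ν (hν ())
  exact LinearIndependent.span_eq_top_of_card_eq_finrank' h2 (by simp)

lemma geom_bound {K : Type} [Field K] [IsAlgClosed K] [CharZero K]
    {n d : ℕ} (V : Set (Fin n → K)) (h1 : IsIrreducibleVariety V)
    (h2 : IsSmoothVariety V) (hd : varDim V = d) (L : AffineSubspace K (Fin (n + n) → K))
    (hL : Module.finrank K L.direction = n + n - varDim (tangentBundle V))
    (hfin : (tangentBundle V ∩ (L : Set (Fin (n + n) → K))).Finite) :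
    (tangentBundle V ∩ (L : Set (Fin (n + n) → K))).ncard ≤
      min ((geomDegree V) ^ (n - d + 1))
        (geomDegree V * ((n - d) * (geomDegree V - 1) + 1) ^ d) := by
  classical
  rcases (tangentBundle V ∩ (L : Set (Fin (n + n) → K))).eq_empty_or_nonempty with he | ⟨z0, hz0V, hz0⟩
  · rw [he]; simp
  obtain ⟨hD, hdn, -⟩ := exists_norm h1 hd ⊥ (by simp)
  have hTle := varDim_TB_le h1.1 h2 hd
  obtain ⟨w, hw⟩ := affine_eqs (e := d + d) L z0 hz0 (by omega)
  set D := geomDegree V with hDdef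
  have hn : (n - d) + d = n := by omega
  let ι := (hfin.toFinset : Finset (Fin (n + n) → K))
  have hι : ∀ z : ι, z.1 ∈ tangentBundle V ∧ z.1 ∈ L := fun z => hfin.mem_toFinset.1 z.2
  have : Nonempty ι := ⟨⟨z0, hfin.mem_toFinset.2 ⟨hz0V, hz0⟩⟩⟩
  have hTd : ∀ x ∈ V, Module.finrank K (tsub V x) = d := fun x hx => by rw [finrank_tsub, h2 x hx, hd]
  -- choose equations
  obtain ⟨f, hf⟩ := exists_gen (ι := ι) (F := fun _ => Fin n → K)
    (fun z => (grad (fstProj z.1)).comp (idD V D).subtype) (n - d) (by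
      intro z
      rw [LinearMap.range_comp, Submodule.range_subtype]
      have := mumford h1 h2 hd (hι z).1.1
      rw [← hDdef] at this
      omega)
  have hfmem : ∀ i, (f i).1 ∈ vanishingIdeal K V := fun i => ((mem_idD _ _ _).1 (f i).2).1
  have hfdeg : ∀ i, (f i).1.totalDegree ≤ D := fun i => ((mem_idD _ _ _).1 (f i).2).2
  have hf' : ∀ z : ι, LinearIndependent K fun i => grad (fstProj z.1) (f i).1 := hf
  let b : Matrix (Fin (d + d)) (Fin n) K := fun k j => w k (Fin.natAdd n j)
  let b' : Matrix (Fin (d + d)) (Fin n) K := fun k j => w k (Fin.castAdd n j)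
  have hwz : ∀ z, w.mulVec z = b'.mulVec (fstProj z) + b.mulVec (sndProj z) := by
    intro z
    ext k
    change ∑ i, w k i * z i = _
    rw [Fin.sum_univ_add]; rfl
  have happ1 : ∀ x y : Fin n → K, fstProj (Fin.append x y) = x := fun x y => by
    ext i; simp [fstProj]
  have happ2 : ∀ x y : Fin n → K, sndProj (Fin.append x y) = y := fun x y => by
    ext i; exact Fin.append_right x y i
  have hbinj : ∀ z : ι, ∀ v ∈ tsub V (fstProj z.1), b.mulVec v = 0 → v = 0 := by
    intro z v hv hbv
    by_contra hv0
    have hsub : Set.range (fun c : K => Fin.append (fstProj z.1) (sndProj z.1 + c • v)) ⊆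
        tangentBundle V ∩ (L : Set (Fin (n + n) → K)) := by
      rintro _ ⟨c, rfl⟩
      refine ⟨?_, ?_⟩
      · rw [mem_TB, happ1, happ2]
        exact ⟨(hι z).1.1, Submodule.add_mem _ (hι z).1.2 (Submodule.smul_mem _ _ hv)⟩
      · have h5 := (hw _).1 (hι z).2
        refine (hw _).2 ?_
        rw [← h5, hwz, hwz, happ1, happ2, Matrix.mulVec_add, Matrix.mulVec_smul, hbv, smul_zero, add_zero]
    refine Set.infinite_range_of_injective ?_ (hfin.subset hsub)
    intro c c' hcc
    have h6 := congrArg sndProj hcc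
    simp only [happ2] at h6
    exact smul_left_injective K hv0 (add_left_cancel h6)
  let W : ι → Submodule K (Fin n → K) := fun z => Submodule.span K (Set.range fun i => grad (fstProj z.1) (f i).1)
  obtain ⟨μ, ν, hμ, hμν⟩ := choose_rows hn W (fun z => by
    have := finrank_span_eq_card (hf' z)
    simpa using this) b (fun z => by
    refine top_of_perp _ fun u hu => hbinj z u ?_ ?_
    · refine tsub_of_indep (hTd _ (hι z).1.1) hn _ hfmem (hf' z) u fun i => ?_
      exact hu _ (Submodule.mem_sup_left (Submodule.subset_span ⟨i, rfl⟩))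
    · ext k
      exact hu _ (Submodule.mem_sup_right (Submodule.subset_span ⟨k, rfl⟩)))
  -- the two groups of linear equations
  let A1 : Matrix (Fin d) (Fin n) K := Matrix.of μ * b'
  let B1 : Matrix (Fin d) (Fin n) K := Matrix.of μ * b
  let A2 : Matrix (Fin d) (Fin n) K := Matrix.of ν * b'
  let B2 : Matrix (Fin d) (Fin n) K := Matrix.of ν * b
  let c1 : Fin d → K := (Matrix.of μ).mulVec (w.mulVec z0)
  let c2 : Fin d → K := (Matrix.of ν).mulVec (w.mulVec z0)
  have hmul : ∀ (ρ : Fin d → Fin (d + d) → K) z k, ρ k ⬝ᵥ (w.mulVec z) =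
      (Matrix.of ρ * b') k ⬝ᵥ fstProj z + (Matrix.of ρ * b) k ⬝ᵥ sndProj z := by
    intro ρ z k
    rw [hwz, dotProduct_add, Matrix.dotProduct_mulVec, Matrix.dotProduct_mulVec]; rfl
  have hLiff : ∀ z, z ∈ L ↔ (∀ k, A1 k ⬝ᵥ fstProj z + B1 k ⬝ᵥ sndProj z = c1 k) ∧
      ∀ k, A2 k ⬝ᵥ fstProj z + B2 k ⬝ᵥ sndProj z = c2 k := by
    intro z
    rw [hw]
    constructor
    · intro h
      refine ⟨fun k => ?_, fun k => ?_⟩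
      · rw [← hmul, h]; rfl
      · rw [← hmul, h]; rfl
    · rintro ⟨ha, hb⟩
      refine sub_eq_zero.1 (dot_zero_of_span _ hμν _ ?_)
      rintro (k | k)
      · rw [Sum.elim_inl, dotProduct_sub, hmul, ha k]; exact sub_self _
      · rw [Sum.elim_inr, dotProduct_sub, hmul, hb k]; exact sub_self _
  let e : Fin (n - d) ⊕ Fin d ≃ Fin n := finSumFinEquiv.trans (finCongr hn)
  let N : Matrix (Fin n) (Fin n) (MvPolynomial (Fin n) K) := fun r j =>
    Sum.elim (fun i => pderiv j (f i).1) (fun k => C (B1 k j)) (e.symm r)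
  let R : Fin n → MvPolynomial (Fin n) K := fun r =>
    Sum.elim (fun _ => 0) (fun k => - affForm (A1 k) (c1 k)) (e.symm r)
  let a : Fin n → ℕ := fun r => Sum.elim (fun _ => D - 1) (fun _ => 0) (e.symm r)
  have hNdeg : ∀ r j, (N r j).totalDegree ≤ a r := by
    intro r j
    change totalDegree (Sum.elim _ _ (e.symm r)) ≤ Sum.elim _ _ (e.symm r)
    rcases e.symm r with i | k
    · exact pderiv_deg j _ (hfdeg i)
    · simp
  have hRdeg : ∀ r, (R r).totalDegree ≤ 1 := by
    intro r
    change totalDegree (Sum.elim _ _ (e.symm r)) ≤ 1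
    rcases e.symm r with i | k
    · simp
    · rw [Sum.elim_inr, totalDegree_neg]; exact affForm_deg _ _
  have hNrow : ∀ x, ((eval x).mapMatrix N).row ∘ e = Sum.elim (fun i => grad x (f i).1) B1 := by
    intro x
    ext s j
    change eval x (Sum.elim _ _ (e.symm (e s))) = _
    rw [Equiv.symm_apply_apply]
    rcases s with i | k
    · rfl
    · exact eval_C _
  have hdet : ∀ x, eval x N.det ≠ 0 ↔ LinearIndependent K (Sum.elim (fun i => grad x (f i).1) B1) := by
    intro x
    rw [← hNrow, linearIndependent_equiv, Matrix.linearIndependent_rows_iff_isUnit, Matrix.isUnit_iff_isUnit_det,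
      isUnit_iff_ne_zero, ← RingHom.map_det]
  have hsys : ∀ x y, (∀ r, ∑ j, eval x (N r j) * y j = eval x (R r)) ↔
      (∀ i, grad x (f i).1 ⬝ᵥ y = 0) ∧ ∀ k, A1 k ⬝ᵥ x + B1 k ⬝ᵥ y = c1 k := by
    intro x y
    rw [← e.forall_congr_right, Sum.forall]
    refine and_congr (forall_congr' fun i => ?_) (forall_congr' fun k => ?_)
    · have : R (e (Sum.inl i)) = 0 := by simp only [R, Equiv.symm_apply_apply]; rfl
      rw [this, map_zero]
      have : ∀ j, N (e (Sum.inl i)) j = pderiv j (f i).1 := fun j => by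
        simp only [N, Equiv.symm_apply_apply]; rfl
      simp only [this]
      rfl
    · have : R (e (Sum.inr k)) = - affForm (A1 k) (c1 k) := by simp only [R, Equiv.symm_apply_apply]; rfl
      rw [this, map_neg, eval_affForm]
      have : ∀ j, N (e (Sum.inr k)) j = C (B1 k j) := fun j => by
        simp only [N, Equiv.symm_apply_apply]; rfl
      simp only [this, eval_C]
      change B1 k ⬝ᵥ y = _ ↔ _
      constructor <;> intro h <;> linear_combination h
  let Z : Finset ((Fin n → K) × (Fin n → K)) := hfin.toFinset.image fun z => (fstProj z, sndProj z)
  have hcard : Z.card = (tangentBundle V ∩ (L : Set (Fin (n + n) → K))).ncard := by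
    rw [Finset.card_image_of_injective, Set.ncard_eq_toFinset_card _ hfin]
    intro z z' h
    rw [Prod.mk.injEq] at h
    ext i
    refine Fin.addCases (fun i => ?_) (fun i => ?_) i
    · exact congrFun h.1 i
    · exact congrFun h.2 i
  have hZ : ∀ x y, (x, y) ∈ Z ↔ x ∈ V ∧ eval x N.det ≠ 0 ∧
      (∀ r, ∑ j, eval x (N r j) * y j = eval x (R r)) ∧ ∀ k, A2 k ⬝ᵥ x + B2 k ⬝ᵥ y = c2 k := by
    intro x y
    rw [hsys, hdet]
    constructor
    · intro h
      obtain ⟨z, hz, hzz⟩ := Finset.mem_image.1 h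
      rw [Prod.mk.injEq] at hzz
      obtain ⟨rfl, rfl⟩ := hzz
      obtain ⟨hzT, hzL⟩ := hfin.mem_toFinset.1 hz
      obtain ⟨hL1, hL2⟩ := (hLiff z).1 hzL
      refine ⟨hzT.1, ?_, ⟨fun i => hzT.2 _ (hfmem i), hL1⟩, hL2⟩
      have hli : LinearIndependent K (fun i => (⟨grad (fstProj z) (f i).1, Submodule.subset_span ⟨i, rfl⟩⟩ : W ⟨z, hz⟩)) :=
        LinearIndependent.of_comp (W ⟨z, hz⟩).subtype (hf' ⟨z, hz⟩)
      exact LinearIndependent.sumElim_of_quotient hli B1 (hμ ⟨z, hz⟩)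
    · rintro ⟨hx, hli, ⟨hg, hL1⟩, hL2⟩
      refine Finset.mem_image.2 ⟨Fin.append x y, hfin.mem_toFinset.2 ⟨?_, (hLiff _).2 ?_⟩, ?_⟩
      · rw [mem_TB, happ1, happ2]
        exact ⟨hx, tsub_of_indep (hTd _ hx) hn _ hfmem (hli.comp Sum.inl Sum.inl_injective) y hg⟩
      · rw [happ1, happ2]; exact ⟨hL1, hL2⟩
      · rw [happ1, happ2]
  have hsum : ∑ r, a r = (n - d) * (D - 1) := by
    rw [← e.sum_comp, Fintype.sum_sum_type]
    simp [a]
  have hprod : ∏ r, (a r + 1) = D ^ (n - d) := by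
    rw [← e.prod_comp, Fintype.prod_sum_type]
    simp [a, Nat.sub_add_cancel hD]
  have b1 := core1 h1 hd N R a hNdeg hRdeg A2 B2 c2 Z hZ
  have b2 := core2 h1 hd N R a hNdeg hRdeg A2 B2 c2 Z hZ
  rw [hcard, hprod] at b1
  rw [hcard, hsum] at b2
  refine le_min ?_ b2
  rw [pow_succ']; exact b1

theorem final {K : Type} [Field K] [IsAlgClosed K] [CharZero K]
    {n d : ℕ} (V : Set (Fin n → K)) (h1 : IsIrreducibleVariety V)
    (h2 : IsSmoothVariety V) (hd : varDim V = d) :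
    geomDegree (tangentBundle V) ≤
      min ((geomDegree V) ^ (n - d + 1))
        (geomDegree V * ((n - d) * (geomDegree V - 1) + 1) ^ d) := by
  refine csSup_le' ?_
  rintro m ⟨L, hL, hfin, rfl⟩
  exact geom_bound V h1 h2 hd L hL hfin

end TB

/-- **Theorem B.** For a smooth irreducible algebraic variety `V ⊆ A^n` of dimension `d`,
`deg(TV) ≤ min{deg(V)^{n-d+1}, deg(V)·((n-d)(deg(V)-1)+1)^d}`. -/
theorem degree_tangentBundle_le_min {K : Type} [Field K] [IsAlgClosed K] [CharZero K]
    {n d : ℕ} (V : Set (Fin n → K)) (h1 : IsIrreducibleVariety V)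
    (h2 : IsSmoothVariety V) (hd : varDim V = d) :
    geomDegree (tangentBundle V) ≤
      min ((geomDegree V) ^ (n - d + 1))
        (geomDegree V * ((n - d) * (geomDegree V - 1) + 1) ^ d) := by
  exact TB.final V h1 h2 hd
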